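/- Let d > 2s and let ρ be an admissible weight with exponents (γ₀,γ). Let u₁ and u₂ be two weak solutions of the Cauchy problem ρ u_t + (-Δ)^s(u^m) = 0 taking the same positive finite Radon measure μ on ℝ^d as initial datum. Then u₁ = u₂ almost everywhere on ℝ^d × (0,∞). -/

import Mathlib

open MeasureTheory Filter Topology Set
open scoped ENNReal NNReal

noncomputable section

/-- `d`-dimensional Euclidean space. -/
abbrev Ed (d : ℕ) : Type := EuclideanSpace ℝ (Fin d)

/-- An admissible weight with exponents `(γ₀, γ)` and constants `0 < c < C`:
a measurable, everywhere positive function comparable to `|x|^{-γ₀}` near the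
origin and to `|x|^{-γ}` at infinity. -/
def AdmissibleWeight (d : ℕ) (ρ : Ed d → ℝ) (γ₀ γ c C : ℝ) : Prop :=
  0 < c ∧ c < C ∧ Measurable ρ ∧ (∀ x, 0 < ρ x) ∧
    (∀ᵐ x ∂(volume : Measure (Ed d)), ‖x‖ ≤ 1 →
      c * ‖x‖ ^ (-γ₀) ≤ ρ x ∧ ρ x ≤ C * ‖x‖ ^ (-γ₀)) ∧
    (∀ᵐ x ∂(volume : Measure (Ed d)), 1 < ‖x‖ →
      c * ‖x‖ ^ (-γ) ≤ ρ x ∧ ρ x ≤ C * ‖x‖ ^ (-γ))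

/-- The Gagliardo bilinear form `E(v,w)` of order `s` with normalizing constant `κ`. -/
def gagliardoE (d : ℕ) (s κ : ℝ) (v w : Ed d → ℝ) : ℝ :=
  (κ / 2) * ∫ p : Ed d × Ed d,
    (v p.1 - v p.2) * (w p.1 - w p.2) / ‖p.1 - p.2‖ ^ ((d : ℝ) + 2 * s)

/-- The squared homogeneous fractional Sobolev seminorm `‖v‖_{Ḣ^s}² = E(v,v)`,
with values in `[0,∞]`. -/
def gagliardoSq (d : ℕ) (s κ : ℝ) (v : Ed d → ℝ) : ℝ≥0∞ :=
  ENNReal.ofReal (κ / 2) * ∫⁻ p : Ed d × Ed d,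
    ENNReal.ofReal ((v p.1 - v p.2) ^ 2 / ‖p.1 - p.2‖ ^ ((d : ℝ) + 2 * s))

/-- The weighted `L^p` norm `‖v‖_{p,ρ}`, valued in `[0,∞]`. -/
def wnorm (d : ℕ) (p : ℝ) (ρ v : Ed d → ℝ) : ℝ≥0∞ :=
  (∫⁻ x : Ed d, ENNReal.ofReal (|v x| ^ p * ρ x)) ^ (1 / p)

/-- Smooth compactly supported test functions on `ℝ^d × (0,∞)`. -/
def IsTestFn (d : ℕ) (φ : Ed d × ℝ → ℝ) : Prop :=
  ContDiff ℝ (⊤ : ℕ∞) φ ∧ HasCompactSupport φ ∧ tsupport φ ⊆ univ ×ˢ Ioi (0 : ℝ)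

/-- Conditions (i)–(iii) of the definition of weak solution of
`ρ u_t + (-Δ)^s(u^m) = 0` on `ℝ^d × (0,∞)` (no initial datum prescribed). -/
structure WeakSolCore (d : ℕ) (s m κ : ℝ) (ρ : Ed d → ℝ) (u : Ed d → ℝ → ℝ) : Prop where
  measurable : Measurable (Function.uncurry u)
  nonneg : ∀ x t, 0 ≤ u x t
  /-- (i), first part: `ess sup_{t>0} ∫ u(·,t) ρ < ∞`. -/
  massBound : ∃ M : ℝ, ∀ᵐ t ∂(volume.restrict (Ioi (0 : ℝ))),
    Integrable (fun x : Ed d => u x t * ρ x) ∧ (∫ x : Ed d, u x t * ρ x) ≤ M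
  /-- (i), second part: `u` essentially bounded on `ℝ^d × (τ,∞)` for every `τ > 0`. -/
  essBdd : ∀ τ : ℝ, 0 < τ → ∃ B : ℝ,
    ∀ᵐ p ∂(volume : Measure (Ed d × ℝ)), τ < p.2 → u p.1 p.2 ≤ B
  /-- (ii), first part: `‖u^m(·,t)‖_{Ḣ^s} < ∞` for a.e. `t > 0`. -/
  energyFinite : ∀ᵐ t ∂(volume.restrict (Ioi (0 : ℝ))),
    gagliardoSq d s κ (fun x => u x t ^ m) < ⊤
  /-- (ii), second part: `t ↦ ‖u^m(·,t)‖_{Ḣ^s}²` locally integrable on `(0,∞)`. -/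
  energyLocInt : ∀ t₁ t₂ : ℝ, 0 < t₁ → t₁ < t₂ →
    (∫⁻ t in Ioc t₁ t₂, gagliardoSq d s κ (fun x => u x t ^ m)) ≠ ⊤
  /-- (iii): the weak formulation against all test functions. -/
  weakForm : ∀ φ : Ed d × ℝ → ℝ, IsTestFn d φ →
    -(∫ t in Ioi (0 : ℝ), ∫ x : Ed d, u x t * deriv (fun τ => φ (x, τ)) t * ρ x)
      + ∫ t in Ioi (0 : ℝ),
          gagliardoE d s κ (fun x => u x t ^ m) (fun x => φ (x, t)) = 0

/-- Condition (iv): `ρ(·)u(·,t) → μ` as `t → 0` essentially, tested against all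
bounded continuous functions. -/
def HasInitialTrace (d : ℕ) (ρ : Ed d → ℝ) (u : Ed d → ℝ → ℝ)
    (μ : Measure (Ed d)) : Prop :=
  ∃ N : Set ℝ, volume N = 0 ∧
    ∀ φ : Ed d → ℝ, Continuous φ → (∃ B : ℝ, ∀ x, |φ x| ≤ B) →
      Tendsto (fun t => ∫ x : Ed d, φ x * (u x t * ρ x))
        (𝓝[(Ioi (0 : ℝ)) \ N] 0) (𝓝 (∫ x, φ x ∂μ))

/-- Weak solution of the Cauchy problem with initial datum `μ`. -/
def IsWeakSolution (d : ℕ) (s m κ : ℝ) (ρ : Ed d → ℝ) (μ : Measure (Ed d))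
    (u : Ed d → ℝ → ℝ) : Prop :=
  WeakSolCore d s m κ ρ u ∧ HasInitialTrace d ρ u μ

section

/-! ### The jump measure and the energy form -/

/-- The increment `(x, y) ↦ v x - v y`. -/
def incr {d : ℕ} (v : Ed d → ℝ) (p : Ed d × Ed d) : ℝ := v p.1 - v p.2

/-- The measure with density `(κ/2) |x - y|^{-(d+2s)}` with respect to `dx dy`. -/
def jumpMeasure (d : ℕ) (s κ : ℝ) : Measure (Ed d × Ed d) :=
  volume.withDensity fun p => ENNReal.ofReal ((κ / 2) / ‖p.1 - p.2‖ ^ ((d : ℝ) + 2 * s))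

/-- The measure with density `ρ` with respect to Lebesgue measure. -/
def weightMeasure {d : ℕ} (ρ : Ed d → ℝ) : Measure (Ed d) :=
  volume.withDensity fun x => ENNReal.ofReal (ρ x)

/-- The energy form as an integral against the jump measure. -/
def energy (d : ℕ) (s κ : ℝ) (v w : Ed d → ℝ) : ℝ :=
  ∫ p, incr v p * incr w p ∂(jumpMeasure d s κ)

/-- Measurable functions with square integrable increments. -/
structure FiniteEnergy (d : ℕ) (s κ : ℝ) (v : Ed d → ℝ) : Prop where
  measurable : Measurable v
  memLp : MemLp (incr v) 2 (jumpMeasure d s κ)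

variable {d : ℕ} {s κ : ℝ}

lemma Measurable.incr {v : Ed d → ℝ} (hv : Measurable v) : Measurable (_root_.incr v) :=
  (hv.comp measurable_fst).sub (hv.comp measurable_snd)

lemma measurable_jumpDensity :
    Measurable fun p : Ed d × Ed d =>
      ENNReal.ofReal ((κ / 2) / ‖p.1 - p.2‖ ^ ((d : ℝ) + 2 * s)) := by
  fun_prop

instance : SigmaFinite (jumpMeasure d s κ) := SigmaFinite.withDensity_ofReal _

lemma jumpMeasure_absolutelyContinuous :
    jumpMeasure d s κ ≪ (volume : Measure (Ed d × Ed d)) :=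
  withDensity_absolutelyContinuous _ _

lemma integral_jumpMeasure (hκ : 0 < κ) (F : Ed d × Ed d → ℝ) :
    ∫ p, F p ∂(jumpMeasure d s κ) =
      ∫ p : Ed d × Ed d, (κ / 2) / ‖p.1 - p.2‖ ^ ((d : ℝ) + 2 * s) * F p := by
  rw [jumpMeasure, integral_withDensity_eq_integral_toReal_smul measurable_jumpDensity
    (by simp)]
  refine integral_congr_ae (.of_forall fun p => ?_)
  simp only [smul_eq_mul]
  rw [ENNReal.toReal_ofReal (by positivity)]

lemma lintegral_jumpMeasure {F : Ed d × Ed d → ℝ≥0∞} (hF : Measurable F) :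
    ∫⁻ p, F p ∂(jumpMeasure d s κ) =
      ∫⁻ p : Ed d × Ed d,
        ENNReal.ofReal ((κ / 2) / ‖p.1 - p.2‖ ^ ((d : ℝ) + 2 * s)) * F p := by
  rw [jumpMeasure, lintegral_withDensity_eq_lintegral_mul _ measurable_jumpDensity hF]
  rfl

lemma gagliardoE_eq_energy (hκ : 0 < κ) (v w : Ed d → ℝ) :
    gagliardoE d s κ v w = energy d s κ v w := by
  rw [gagliardoE, energy, integral_jumpMeasure hκ, ← integral_const_mul]
  refine integral_congr_ae (.of_forall fun p => ?_)
  simp only [incr]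
  ring

lemma gagliardoSq_eq_lintegral (hκ : 0 < κ) {v : Ed d → ℝ} (hv : Measurable v) :
    gagliardoSq d s κ v = ∫⁻ p, ENNReal.ofReal (incr v p ^ 2) ∂(jumpMeasure d s κ) := by
  have h1 : Measurable fun p => ENNReal.ofReal (incr v p ^ 2) :=
    (hv.incr.pow_const 2).ennreal_ofReal
  rw [gagliardoSq, lintegral_jumpMeasure h1, ← lintegral_const_mul]
  · refine lintegral_congr fun p => ?_
    rw [← ENNReal.ofReal_mul (by positivity), ← ENNReal.ofReal_mul (by positivity)]
    simp only [incr]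
    congr 1
    ring
  · have := hv.incr
    unfold incr at this
    fun_prop

lemma lintegral_sq_lt_top_iff_memLp {α : Type*} [MeasurableSpace α] {μ : Measure α} {f : α → ℝ}
    (hf : AEStronglyMeasurable f μ) :
    ∫⁻ a, ENNReal.ofReal (f a ^ 2) ∂μ < ⊤ ↔ MemLp f 2 μ := by
  rw [memLp_two_iff_integrable_sq hf]
  refine ⟨fun h => ⟨hf.pow 2, ?_⟩, fun h => ?_⟩
  · rwa [hasFiniteIntegral_iff_ofReal (.of_forall fun a => by positivity)]
  · rw [← hasFiniteIntegral_iff_ofReal (.of_forall fun a => by positivity)]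
    exact h.2

namespace FiniteEnergy

variable {v w z : Ed d → ℝ}

lemma add (hv : FiniteEnergy d s κ v) (hw : FiniteEnergy d s κ w) :
    FiniteEnergy d s κ (fun x => v x + w x) := by
  refine ⟨hv.1.add hw.1, ?_⟩
  convert hv.2.add hw.2 using 1
  ext p
  simp only [incr, Pi.add_apply]
  ring

lemma const_mul (c : ℝ) (hv : FiniteEnergy d s κ v) :
    FiniteEnergy d s κ (fun x => c * v x) := by
  refine ⟨hv.1.const_mul c, ?_⟩
  convert hv.2.const_mul c using 1
  ext p
  simp only [incr]
  ring

lemma sub (hv : FiniteEnergy d s κ v) (hw : FiniteEnergy d s κ w) :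
    FiniteEnergy d s κ (fun x => v x - w x) := by
  refine ⟨hv.1.sub hw.1, ?_⟩
  convert hv.2.sub hw.2 using 1
  ext p
  simp only [incr, Pi.sub_apply]
  ring

lemma of_abs_incr_le (hv : FiniteEnergy d s κ v) (hw : Measurable w)
    (h : ∀ x y, |w x - w y| ≤ |v x - v y|) : FiniteEnergy d s κ w :=
  ⟨hw, hv.2.of_le hw.incr.aestronglyMeasurable (.of_forall fun p => by
    simpa [incr, Real.norm_eq_abs] using h p.1 p.2)⟩

lemma integrable_mul (hv : FiniteEnergy d s κ v) (hw : FiniteEnergy d s κ w) :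
    Integrable (fun p => incr v p * incr w p) (jumpMeasure d s κ) :=
  hv.2.integrable_mul hw.2

lemma zero : FiniteEnergy d s κ (fun _ => 0) := by
  refine ⟨measurable_const, ?_⟩
  convert MemLp.zero (ε := ℝ) using 1
  ext p
  simp [incr]

end FiniteEnergy

section EnergyForm

variable {v w z : Ed d → ℝ}

lemma energy_comm (v w : Ed d → ℝ) : energy d s κ v w = energy d s κ w v := by
  simp only [energy, mul_comm]

lemma energy_add_left (hv : FiniteEnergy d s κ v) (hw : FiniteEnergy d s κ w)
    (hz : FiniteEnergy d s κ z) :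
    energy d s κ (fun x => v x + w x) z = energy d s κ v z + energy d s κ w z := by
  simp only [energy]
  rw [← integral_add (hv.integrable_mul hz) (hw.integrable_mul hz)]
  refine integral_congr_ae (.of_forall fun p => ?_)
  simp only [incr]
  ring

lemma energy_sub_left (hv : FiniteEnergy d s κ v) (hw : FiniteEnergy d s κ w)
    (hz : FiniteEnergy d s κ z) :
    energy d s κ (fun x => v x - w x) z = energy d s κ v z - energy d s κ w z := by
  simp only [energy]
  rw [← integral_sub (hv.integrable_mul hz) (hw.integrable_mul hz)]
  refine integral_congr_ae (.of_forall fun p => ?_)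
  simp only [incr]
  ring

lemma energy_const_mul_left (c : ℝ) (v w : Ed d → ℝ) :
    energy d s κ (fun x => c * v x) w = c * energy d s κ v w := by
  simp only [energy]
  rw [← integral_const_mul]
  refine integral_congr_ae (.of_forall fun p => ?_)
  simp only [incr]
  ring

lemma energy_add_right (hv : FiniteEnergy d s κ v) (hw : FiniteEnergy d s κ w)
    (hz : FiniteEnergy d s κ z) :
    energy d s κ z (fun x => v x + w x) = energy d s κ z v + energy d s κ z w := by
  simp only [energy_comm z, energy_add_left hv hw hz]

lemma energy_sub_right (hv : FiniteEnergy d s κ v) (hw : FiniteEnergy d s κ w)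
    (hz : FiniteEnergy d s κ z) :
    energy d s κ z (fun x => v x - w x) = energy d s κ z v - energy d s κ z w := by
  simp only [energy_comm z, energy_sub_left hv hw hz]

lemma energy_const_mul_right (c : ℝ) (v w : Ed d → ℝ) :
    energy d s κ v (fun x => c * w x) = c * energy d s κ v w := by
  simp only [energy_comm v, energy_const_mul_left]

lemma energy_self_nonneg (v : Ed d → ℝ) : 0 ≤ energy d s κ v v :=
  integral_nonneg fun _ => mul_self_nonneg _

lemma energy_sq_le (hv : FiniteEnergy d s κ v) (hw : FiniteEnergy d s κ w) :
    energy d s κ v w ^ 2 ≤ energy d s κ v v * energy d s κ w w := by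
  have key : ∀ t : ℝ, 0 ≤ energy d s κ w w * (t * t) + (2 * energy d s κ v w) * t
      + energy d s κ v v := by
    intro t
    have hz := hv.add (hw.const_mul t)
    have h := energy_self_nonneg (d := d) (s := s) (κ := κ) (fun x => v x + t * w x)
    rw [energy_add_left hv (hw.const_mul t) hz, energy_const_mul_left,
      energy_add_right hv (hw.const_mul t) hv, energy_add_right hv (hw.const_mul t) hw,
      energy_const_mul_right, energy_const_mul_right, energy_comm w v] at h
    linarith
  have := discrim_le_zero key
  unfold discrim at this
  nlinarith

lemma energy_self_le_of_monotone_comp (hv : FiniteEnergy d s κ v) (hw : FiniteEnergy d s κ w)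
    (h : ∀ x y, (w x - w y) ^ 2 ≤ (v x - v y) * (w x - w y)) :
    energy d s κ w w ≤ energy d s κ v w := by
  refine integral_mono (hw.integrable_mul hw) (hv.integrable_mul hw) fun p => ?_
  have := h p.1 p.2
  simp only [incr]
  nlinarith

end EnergyForm

/-! ### The weighted measure, test functions and decaying functions -/

lemma weightMeasure_absolutelyContinuous (ρ : Ed d → ℝ) :
    weightMeasure ρ ≪ (volume : Measure (Ed d)) :=
  withDensity_absolutelyContinuous _ _

lemma absolutelyContinuous_weightMeasure {ρ : Ed d → ℝ} (hm : Measurable ρ)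
    (hpos : ∀ x, 0 < ρ x) : (volume : Measure (Ed d)) ≪ weightMeasure ρ :=
  withDensity_absolutelyContinuous' hm.ennreal_ofReal.aemeasurable
    (.of_forall fun x => by simp [hpos x])

instance (ρ : Ed d → ℝ) : SigmaFinite (weightMeasure ρ) := SigmaFinite.withDensity_ofReal _

lemma integral_weightMeasure {ρ : Ed d → ℝ} (hm : Measurable ρ) (hpos : ∀ x, 0 < ρ x)
    (f : Ed d → ℝ) : ∫ x, f x ∂(weightMeasure ρ) = ∫ x, f x * ρ x := by
  rw [weightMeasure, integral_withDensity_eq_integral_toReal_smul hm.ennreal_ofReal (by simp)]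
  refine integral_congr_ae (.of_forall fun p => ?_)
  simp only [smul_eq_mul]
  rw [ENNReal.toReal_ofReal (hpos _).le, mul_comm]

lemma integrable_weightMeasure_iff {ρ : Ed d → ℝ} (hm : Measurable ρ) (hpos : ∀ x, 0 < ρ x)
    (f : Ed d → ℝ) :
    Integrable f (weightMeasure ρ) ↔ Integrable (fun x => f x * ρ x) := by
  rw [weightMeasure, integrable_withDensity_iff_integrable_smul' hm.ennreal_ofReal (by simp)]
  refine integrable_congr (.of_forall fun p => ?_)
  simp only [smul_eq_mul]
  rw [ENNReal.toReal_ofReal (hpos _).le, mul_comm]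

/-- Bounded, weighted-integrable functions of finite energy. -/
structure EnergyTest (d : ℕ) (s κ : ℝ) (ρ : Ed d → ℝ) (φ : Ed d → ℝ) : Prop
    extends FiniteEnergy d s κ φ where
  bdd : ∃ B, ∀ x, |φ x| ≤ B
  integrable : Integrable φ (weightMeasure ρ)

/-- Bounded functions of finite energy all of whose superlevel sets have finite weighted
measure. -/
structure EnergyDecaying (d : ℕ) (s κ : ℝ) (ρ : Ed d → ℝ) (φ : Ed d → ℝ) : Prop
    extends FiniteEnergy d s κ φ where
  bdd : ∃ B, ∀ x, |φ x| ≤ B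
  decay : ∀ ε : ℝ, 0 < ε → weightMeasure ρ {x | ε < |φ x|} < ⊤

variable {ρ : Ed d → ℝ} {φ ψ : Ed d → ℝ}

namespace EnergyTest

lemma add (hφ : EnergyTest d s κ ρ φ) (hψ : EnergyTest d s κ ρ ψ) :
    EnergyTest d s κ ρ (fun x => φ x + ψ x) := by
  obtain ⟨B, hB⟩ := hφ.bdd
  obtain ⟨C, hC⟩ := hψ.bdd
  exact ⟨hφ.toFiniteEnergy.add hψ.toFiniteEnergy,
    ⟨B + C, fun x => (abs_add_le _ _).trans (add_le_add (hB x) (hC x))⟩,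
    hφ.integrable.add hψ.integrable⟩

lemma const_mul (c : ℝ) (hφ : EnergyTest d s κ ρ φ) :
    EnergyTest d s κ ρ (fun x => c * φ x) := by
  obtain ⟨B, hB⟩ := hφ.bdd
  exact ⟨hφ.toFiniteEnergy.const_mul c,
    ⟨|c| * B, fun x => by
      rw [abs_mul]; exact mul_le_mul_of_nonneg_left (hB x) (abs_nonneg c)⟩,
    hφ.integrable.const_mul c⟩

lemma sub (hφ : EnergyTest d s κ ρ φ) (hψ : EnergyTest d s κ ρ ψ) :
    EnergyTest d s κ ρ (fun x => φ x - ψ x) := by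
  convert hφ.add (hψ.const_mul (-1)) using 2
  ring

lemma integrable_bdd_mul (hφ : EnergyTest d s κ ρ φ) {f : Ed d → ℝ}
    (hf : Integrable f (weightMeasure ρ)) :
    Integrable (fun x => f x * φ x) (weightMeasure ρ) := by
  obtain ⟨B, hB⟩ := hφ.bdd
  exact hf.mul_bdd hφ.measurable.aestronglyMeasurable
    (.of_forall fun x => by simpa [Real.norm_eq_abs] using hB x)

lemma zero : EnergyTest d s κ ρ (fun _ => 0) :=
  ⟨FiniteEnergy.zero, ⟨0, by simp⟩, integrable_zero _ _ _⟩

lemma energyDecaying (hφ : EnergyTest d s κ ρ φ) : EnergyDecaying d s κ ρ φ := by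
  refine ⟨hφ.toFiniteEnergy, hφ.bdd, fun ε hε => ?_⟩
  have h := hφ.integrable.norm.measure_gt_lt_top hε
  simpa [Real.norm_eq_abs] using h

end EnergyTest

namespace EnergyDecaying

lemma add (hφ : EnergyDecaying d s κ ρ φ) (hψ : EnergyDecaying d s κ ρ ψ) :
    EnergyDecaying d s κ ρ (fun x => φ x + ψ x) := by
  obtain ⟨B, hB⟩ := hφ.bdd
  obtain ⟨C, hC⟩ := hψ.bdd
  refine ⟨hφ.toFiniteEnergy.add hψ.toFiniteEnergy,
    ⟨B + C, fun x => (abs_add_le _ _).trans (add_le_add (hB x) (hC x))⟩, fun ε hε => ?_⟩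
  refine (measure_mono (t := {x | ε / 2 < |φ x|} ∪ {x | ε / 2 < |ψ x|}) fun x hx => ?_).trans_lt
    ((measure_union_le _ _).trans_lt (ENNReal.add_lt_top.2
      ⟨hφ.decay _ (half_pos hε), hψ.decay _ (half_pos hε)⟩))
  by_contra hcon
  simp only [mem_union, mem_ofPred_eq, not_or, not_lt] at hcon hx
  linarith [abs_add_le (φ x) (ψ x)]

lemma const_mul (c : ℝ) (hφ : EnergyDecaying d s κ ρ φ) :
    EnergyDecaying d s κ ρ (fun x => c * φ x) := by
  obtain ⟨B, hB⟩ := hφ.bdd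
  refine ⟨hφ.toFiniteEnergy.const_mul c,
    ⟨|c| * B, fun x => by
      rw [abs_mul]; exact mul_le_mul_of_nonneg_left (hB x) (abs_nonneg c)⟩, fun ε hε => ?_⟩
  have hc : 0 < |c| + 1 := by positivity
  refine (measure_mono fun x hx => ?_).trans_lt (hφ.decay (ε / (|c| + 1)) (by positivity))
  simp only [mem_ofPred_eq, abs_mul] at hx ⊢
  rw [div_lt_iff₀ hc]
  nlinarith [abs_nonneg (φ x)]

lemma sub (hφ : EnergyDecaying d s κ ρ φ) (hψ : EnergyDecaying d s κ ρ ψ) :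
    EnergyDecaying d s κ ρ (fun x => φ x - ψ x) := by
  convert hφ.add (hψ.const_mul (-1)) using 2
  ring

lemma integrable_of_support (hφ : EnergyDecaying d s κ ρ φ) {w : Ed d → ℝ} (hw : Measurable w)
    {B ε : ℝ} (hε : 0 < ε) (hB : ∀ x, |w x| ≤ B) (hs : ∀ x, |φ x| ≤ ε → w x = 0) :
    Integrable w (weightMeasure ρ) := by
  have hS : MeasurableSet {x | ε < |φ x|} :=
    measurableSet_lt measurable_const (by simpa using hφ.measurable.norm)
  have h1 : IntegrableOn w {x | ε < |φ x|} (weightMeasure ρ) :=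
    Measure.integrableOn_of_bounded (M := B) (hφ.decay ε hε).ne hw.aestronglyMeasurable
      (.of_forall fun x => by simpa [Real.norm_eq_abs] using hB x)
  refine (integrableOn_iff_integrable_of_support_subset fun x hx => ?_).1 h1
  by_contra hcon
  exact hx (hs x (not_lt.1 hcon))

lemma posPart_sub (hφ : EnergyDecaying d s κ ρ φ) {ε : ℝ} (hε : 0 < ε) :
    EnergyTest d s κ ρ (fun x => max (φ x - ε) 0) := by
  obtain ⟨B, hB⟩ := hφ.bdd
  have hm : Measurable fun x => max (φ x - ε) 0 := (hφ.measurable.sub_const ε).max measurable_const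
  have hb : ∀ x, |max (φ x - ε) 0| ≤ B := fun x => by
    have := hB x
    rw [abs_le] at this
    rw [abs_of_nonneg (le_max_right _ _)]
    exact max_le (by linarith) (by linarith)
  refine ⟨hφ.toFiniteEnergy.of_abs_incr_le hm fun x y => ?_, ⟨B, hb⟩,
    hφ.integrable_of_support hm hε hb fun x hx => ?_⟩
  · have := abs_max_sub_max_le_abs (φ x - ε) (φ y - ε) 0
    simpa using this
  · exact max_eq_right (by linarith [le_abs_self (φ x)])

lemma energy_posPart_le (hφ : EnergyDecaying d s κ ρ φ) {ε : ℝ} (hε : 0 < ε) :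
    energy d s κ (fun x => max (φ x - ε) 0) (fun x => max (φ x - ε) 0) ≤
      energy d s κ φ (fun x => max (φ x - ε) 0) := by
  refine energy_self_le_of_monotone_comp hφ.toFiniteEnergy
    (hφ.posPart_sub hε).toFiniteEnergy fun x y => ?_
  rcases le_total (φ x - ε) 0 with h1 | h1 <;> rcases le_total (φ y - ε) 0 with h2 | h2 <;>
    simp only [max_eq_left, max_eq_right, h1, h2] <;> nlinarith

end EnergyDecaying

end

/-! ### The heat kernel -/

/-- The Gauss–Weierstrass kernel on `ℝ^d`. -/
def heat {d : ℕ} (t : ℝ) (x : Ed d) : ℝ :=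
  (4 * Real.pi * t) ^ (-(d : ℝ) / 2) * Real.exp (-(‖x‖ ^ 2 / (4 * t)))

section Heat

variable {d : ℕ}

lemma heat_nonneg {t : ℝ} (ht : 0 < t) (x : Ed d) : 0 ≤ heat t x := by
  unfold heat; positivity

lemma heat_neg (t : ℝ) (x : Ed d) : heat t (-x) = heat t x := by simp [heat]

lemma measurable_heat : Measurable fun p : ℝ × Ed d => heat p.1 p.2 := by
  unfold heat; fun_prop

lemma continuous_heat (t : ℝ) : Continuous (heat t : Ed d → ℝ) := by
  unfold heat; fun_prop

lemma heat_le {t : ℝ} (ht : 0 < t) (x : Ed d) :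
    heat t x ≤ (4 * Real.pi * t) ^ (-(d : ℝ) / 2) := by
  unfold heat
  refine mul_le_of_le_one_right (by positivity) ?_
  rw [Real.exp_le_one_iff]
  have : 0 ≤ ‖x‖ ^ 2 / (4 * t) := by positivity
  linarith

lemma integral_heat {t : ℝ} (ht : 0 < t) : ∫ x : Ed d, heat t x = 1 := by
  have h := GaussianFourier.integral_rexp_neg_mul_sq_norm (V := Ed d)
    (b := 1 / (4 * t)) (by positivity)
  simp only [heat]
  rw [integral_const_mul]
  have h2 : ∀ v : Ed d, -(‖v‖ ^ 2 / (4 * t)) = -(1 / (4 * t)) * ‖v‖ ^ 2 := fun v => by ring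
  simp only [h2, h, finrank_euclideanSpace_fin]
  have h3 : Real.pi / (1 / (4 * t)) = 4 * Real.pi * t := by field_simp
  rw [h3, neg_div, Real.rpow_neg (by positivity)]
  exact inv_mul_cancel₀ (by positivity)

lemma integrable_heat {t : ℝ} (ht : 0 < t) : Integrable (heat t : Ed d → ℝ) :=
  Integrable.of_integral_ne_zero (by rw [integral_heat ht]; exact one_ne_zero)

lemma lintegral_heat {t : ℝ} (ht : 0 < t) : ∫⁻ x : Ed d, ENNReal.ofReal (heat t x) = 1 := by
  rw [← ofReal_integral_eq_lintegral_ofReal (integrable_heat ht)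
    (.of_forall fun x => heat_nonneg ht x), integral_heat ht, ENNReal.ofReal_one]

lemma heat_mul_heat {r t : ℝ} (hr : 0 < r) (ht : 0 < t) (x y : Ed d) :
    heat t (x - y) * heat r y =
      heat (t + r) x * heat (r * t / (t + r)) (y - (r / (t + r)) • x) := by
  have hne : (t + r) ≠ 0 := by positivity
  unfold heat
  have e1 : ∀ a b c e : ℝ, a * b * (c * e) = (a * c) * (b * e) := fun a b c e => by ring
  rw [e1, e1 _ (Real.exp (-(‖x‖ ^ 2 / (4 * (t + r)))))]
  rw [← Real.mul_rpow (by positivity) (by positivity),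
    ← Real.mul_rpow (by positivity) (by positivity), ← Real.exp_add, ← Real.exp_add]
  congr 2
  · field_simp
  · rw [norm_sub_sq_real, norm_sub_sq_real, norm_smul, inner_smul_right, real_inner_comm y x,
      Real.norm_of_nonneg (by positivity)]
    field_simp
    ring

lemma lintegral_heat_mul_heat {r t : ℝ} (hr : 0 < r) (ht : 0 < t) (x : Ed d) :
    ∫⁻ y, ENNReal.ofReal (heat t (x - y)) * ENNReal.ofReal (heat r y) =
      ENNReal.ofReal (heat (t + r) x) := by
  have h : ∀ y, ENNReal.ofReal (heat t (x - y)) * ENNReal.ofReal (heat r y) =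
      ENNReal.ofReal (heat (t + r) x) *
        ENNReal.ofReal (heat (r * t / (t + r)) (y - (r / (t + r)) • x)) := fun y => by
    rw [← ENNReal.ofReal_mul (heat_nonneg ht _), heat_mul_heat hr ht,
      ENNReal.ofReal_mul (heat_nonneg (by positivity) _)]
  simp only [h]
  rw [lintegral_const_mul' _ _ ENNReal.ofReal_ne_top,
    lintegral_sub_right_eq_self (fun y : Ed d => ENNReal.ofReal (heat (r * t / (t + r)) y)),
    lintegral_heat (by positivity), mul_one]

lemma heat_scale {t : ℝ} (ht : 0 < t) (x : Ed d) :
    heat t x = t ^ (-(d : ℝ) / 2) * heat 1 ((Real.sqrt t)⁻¹ • x) := by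
  unfold heat
  rw [Real.mul_rpow (by positivity) ht.le, norm_smul, Real.norm_of_nonneg (by positivity),
    mul_pow, inv_pow, Real.sq_sqrt ht.le]
  have : ‖x‖ ^ 2 / (4 * t) = t⁻¹ * ‖x‖ ^ 2 / (4 * 1) := by field_simp
  rw [this]; simp only [mul_one]; ring

/-- The constant in the subordination formula for powers of the norm. -/
def subordConst (d : ℕ) (q : ℝ) : ℝ :=
  (4 * Real.pi) ^ (-(d : ℝ) / 2) * (4 ^ q * Real.Gamma q)

lemma subordConst_pos {q : ℝ} (hq : 0 < q) : 0 < subordConst d q := by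
  unfold subordConst
  have := Real.Gamma_pos_of_pos hq
  positivity

/-- Powers of the norm as superpositions of heat kernels. -/
lemma lintegral_rpow_mul_heat {q : ℝ} (hq : 0 < q) {x : Ed d} (hx : x ≠ 0) :
    ∫⁻ t in Ioi (0 : ℝ), ENNReal.ofReal (t ^ ((d : ℝ) / 2 - q - 1)) * ENNReal.ofReal (heat t x) =
      ENNReal.ofReal (subordConst d q * ‖x‖ ^ (-(2 * q))) := by
  have hx' : 0 < ‖x‖ := norm_pos_iff.2 hx
  set l : ℝ := ‖x‖ ^ 2 / 4 with hl
  have hl0 : 0 < l := by positivity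
  have h1 := Real.integral_rpow_mul_exp_neg_mul_Ioi hq hl0
  rw [← integral_comp_rpow_Ioi _ (p := -1) (by norm_num)] at h1
  have h2 : ∫ t in Ioi (0 : ℝ), t ^ ((d : ℝ) / 2 - q - 1) * heat t x =
      subordConst d q * ‖x‖ ^ (-(2 * q)) := by
    have h3 : ∫ t in Ioi (0 : ℝ), t ^ ((d : ℝ) / 2 - q - 1) * heat t x =
        ∫ t in Ioi (0 : ℝ), (4 * Real.pi) ^ (-(d : ℝ) / 2) * ((|(-1 : ℝ)| * t ^ ((-1 : ℝ) - 1)) •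
          ((t ^ (-1 : ℝ)) ^ (q - 1) * Real.exp (-(l * t ^ (-1 : ℝ))))) := by
      refine setIntegral_congr_fun measurableSet_Ioi fun t ht => ?_
      have ht : 0 < t := ht
      simp only [heat, smul_eq_mul, abs_neg, abs_one, one_mul]
      rw [Real.mul_rpow (by positivity) ht.le, ← Real.rpow_mul ht.le, Real.rpow_neg_one]
      have e1 : ‖x‖ ^ 2 / (4 * t) = l * t⁻¹ := by rw [hl]; field_simp
      have e2 : t ^ ((d : ℝ) / 2 - q - 1) * t ^ (-(d : ℝ) / 2) =
          t ^ ((-1 : ℝ) - 1) * t ^ (-1 * (q - 1)) := by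
        rw [← Real.rpow_add ht, ← Real.rpow_add ht]; congr 1; ring
      rw [e1]
      linear_combination ((4 * Real.pi) ^ (-(d : ℝ) / 2) * Real.exp (-(l * t⁻¹))) * e2
    rw [h3, integral_const_mul, h1, subordConst, mul_assoc]
    congr 1
    rw [hl, one_div, inv_div, Real.div_rpow (by norm_num) (by positivity),
      ← Real.rpow_natCast ‖x‖ 2, ← Real.rpow_mul hx'.le, Real.rpow_neg hx'.le]
    push_cast
    field_simp
  have h3 : IntegrableOn (fun t => t ^ ((d : ℝ) / 2 - q - 1) * heat t x) (Ioi 0) :=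
    Integrable.of_integral_ne_zero (by
      rw [h2]; have := subordConst_pos (d := d) hq; positivity)
  rw [← h2, ofReal_integral_eq_lintegral_ofReal h3]
  · refine setLIntegral_congr_fun measurableSet_Ioi fun t ht => ?_
    exact (ENNReal.ofReal_mul (Real.rpow_nonneg (le_of_lt ht) _)).symm
  · exact (ae_restrict_mem measurableSet_Ioi).mono fun t ht =>
      mul_nonneg (Real.rpow_nonneg (le_of_lt ht) _) (heat_nonneg ht _)

end Heat

/-! ### Superpositions of heat kernels -/

/-- The superposition of heat kernels with weight `w`. -/
def heatMix {d : ℕ} (w : ℝ → ℝ≥0∞) (x : Ed d) : ℝ≥0∞ :=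
  ∫⁻ t in Ioi (0 : ℝ), w t * ENNReal.ofReal (heat t x)

section HeatMix

variable {d : ℕ} {w v : ℝ → ℝ≥0∞}

lemma measurable_heatMix (hw : Measurable w) : Measurable (heatMix w : Ed d → ℝ≥0∞) := by
  unfold heatMix
  have : Measurable fun p : Ed d × ℝ => w p.2 * ENNReal.ofReal (heat p.2 p.1) :=
    (hw.comp measurable_snd).mul (measurable_heat.comp measurable_swap).ennreal_ofReal
  exact this.lintegral_prod_right'

lemma heatMix_neg (x : Ed d) : heatMix w (-x) = heatMix w x := by
  simp [heatMix, heat_neg]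

lemma heatMix_sub_comm (x y : Ed d) : heatMix w (x - y) = heatMix w (y - x) := by
  rw [← heatMix_neg, neg_sub]

lemma heatMix_add (hw : Measurable w) (x : Ed d) :
    heatMix (fun t => w t + v t) x = heatMix w x + heatMix v x := by
  simp only [heatMix, add_mul]
  rw [lintegral_add_left]
  exact hw.mul (measurable_heat.comp (measurable_id.prodMk measurable_const)).ennreal_ofReal

lemma heatMix_const_mul (c : ℝ≥0∞) (hw : Measurable w) (x : Ed d) :
    heatMix (fun t => c * w t) x = c * heatMix w x := by
  simp only [heatMix, mul_assoc]
  rw [lintegral_const_mul]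
  exact hw.mul (measurable_heat.comp (measurable_id.prodMk measurable_const)).ennreal_ofReal

lemma heatMix_congr (h : ∀ t, 0 < t → w t = v t) (x : Ed d) : heatMix w x = heatMix v x := by
  refine setLIntegral_congr_fun measurableSet_Ioi fun t ht => ?_
  simp only [h t ht]

lemma lintegral_heatMix_mul (hw : Measurable w) (x : Ed d) {f : Ed d → ℝ≥0∞} (hf : Measurable f) :
    ∫⁻ y, heatMix w (x - y) * f y =
      ∫⁻ t in Ioi (0 : ℝ), w t * ∫⁻ y, ENNReal.ofReal (heat t (x - y)) * f y := by
  have hm : Measurable fun p : Ed d × ℝ => ENNReal.ofReal (heat p.2 (x - p.1)) :=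
    (measurable_heat.comp (measurable_snd.prodMk (measurable_fst.const_sub x))).ennreal_ofReal
  have h1 : ∀ y, heatMix w (x - y) * f y =
      ∫⁻ t in Ioi (0 : ℝ), w t * (ENNReal.ofReal (heat t (x - y)) * f y) := fun y => by
    rw [heatMix, ← lintegral_mul_const]
    · simp only [mul_assoc]
    · exact hw.mul (hm.comp measurable_prodMk_left)
  simp only [h1]
  rw [lintegral_lintegral_swap]
  · refine lintegral_congr fun t => ?_
    rw [lintegral_const_mul]
    exact (hm.comp measurable_prodMk_right).mul hf
  · exact ((hw.comp measurable_snd).mul (hm.mul (hf.comp measurable_fst))).aemeasurable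

lemma lintegral_heatMix (hw : Measurable w) :
    ∫⁻ x : Ed d, heatMix w x = ∫⁻ t in Ioi (0 : ℝ), w t := by
  have h := lintegral_heatMix_mul (d := d) hw 0 (f := fun _ => 1) measurable_const
  simp only [mul_one, zero_sub, heatMix_neg, heat_neg] at h
  rw [h]
  refine setLIntegral_congr_fun measurableSet_Ioi fun t ht => ?_
  simp only [lintegral_heat ht, mul_one]

lemma lintegral_heat_mul_heatMix (hv : Measurable v) {t : ℝ} (ht : 0 < t) (x : Ed d) :
    ∫⁻ y, ENNReal.ofReal (heat t (x - y)) * heatMix v y =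
      ∫⁻ R in Ioi t, v (R - t) * ENNReal.ofReal (heat R x) := by
  have hm : Measurable fun y : Ed d => ENNReal.ofReal (heat t (x - y)) :=
    ((continuous_heat t).comp (continuous_const.sub continuous_id)).measurable.ennreal_ofReal
  have h2 : ∫⁻ y, ENNReal.ofReal (heat t (x - y)) * heatMix v y =
      ∫⁻ y, heatMix v (0 - y) * ENNReal.ofReal (heat t (x - y)) := by
    refine lintegral_congr fun y => ?_
    rw [zero_sub, heatMix_neg, mul_comm]
  rw [h2, lintegral_heatMix_mul hv 0 hm]
  have h3 : ∀ r ∈ Ioi (0 : ℝ), v r * ∫⁻ y : Ed d,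
      ENNReal.ofReal (heat r (0 - y)) * ENNReal.ofReal (heat t (x - y)) =
      v r * ENNReal.ofReal (heat (t + r) x) := fun r hr => by
    rw [← lintegral_heat_mul_heat hr ht]
    simp only [zero_sub, heat_neg, mul_comm]
  rw [setLIntegral_congr_fun measurableSet_Ioi h3, ← lintegral_indicator measurableSet_Ioi,
    ← lintegral_indicator measurableSet_Ioi,
    ← lintegral_sub_right_eq_self (fun r => (Ioi (0 : ℝ)).indicator
      (fun r => v r * ENNReal.ofReal (heat (t + r) x)) r) t]
  refine lintegral_congr fun R => ?_
  by_cases h : t < R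
  · rw [indicator_of_mem (by simpa using h), indicator_of_mem (by simpa using h)]
    simp
  · rw [indicator_of_notMem (by simpa using h), indicator_of_notMem (by simpa using h)]

/-- The convolution of two superpositions corresponds to the convolution of the weights. -/
lemma lintegral_heatMix_mul_heatMix (hw : Measurable w) (hv : Measurable v) (x : Ed d) :
    ∫⁻ y, heatMix w (x - y) * heatMix v y =
      heatMix (fun R => ∫⁻ t in Ioo 0 R, w t * v (R - t)) x := by
  have hm : Measurable fun R : ℝ => ENNReal.ofReal (heat R x) :=
    (measurable_heat.comp (measurable_id.prodMk measurable_const)).ennreal_ofReal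
  rw [lintegral_heatMix_mul hw x (measurable_heatMix hv)]
  rw [setLIntegral_congr_fun measurableSet_Ioi
    (fun t ht => by rw [lintegral_heat_mul_heatMix hv ht x])]
  have hF : Measurable fun p : ℝ × ℝ => w p.1 * (v (p.2 - p.1) * ENNReal.ofReal (heat p.2 x)) :=
    (hw.comp measurable_fst).mul
      ((hv.comp (measurable_snd.sub measurable_fst)).mul (hm.comp measurable_snd))
  have hS : MeasurableSet {p : ℝ × ℝ | 0 < p.1 ∧ p.1 < p.2} :=
    (measurableSet_lt measurable_const measurable_fst).inter
      (measurableSet_lt measurable_fst measurable_snd)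
  have h1 : ∫⁻ t in Ioi (0 : ℝ), w t * ∫⁻ R in Ioi t, v (R - t) * ENNReal.ofReal (heat R x) =
      ∫⁻ t, ∫⁻ R, {p : ℝ × ℝ | 0 < p.1 ∧ p.1 < p.2}.indicator
        (fun p => w p.1 * (v (p.2 - p.1) * ENNReal.ofReal (heat p.2 x))) (t, R) := by
    rw [← lintegral_indicator measurableSet_Ioi]
    refine lintegral_congr fun t => ?_
    by_cases ht : 0 < t
    · rw [indicator_of_mem (by exact ht), ← lintegral_const_mul, ← lintegral_indicator
        measurableSet_Ioi]
      · refine lintegral_congr fun R => ?_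
        by_cases hR : t < R
        · rw [indicator_of_mem (by exact hR), indicator_of_mem (by exact ⟨ht, hR⟩)]
        · rw [indicator_of_notMem (by exact hR), indicator_of_notMem (fun h => hR h.2)]
      · exact (hv.comp (measurable_id.sub_const t)).mul hm
    · rw [indicator_of_notMem (by exact ht)]
      symm
      rw [lintegral_eq_zero_iff' (by
        exact ((hF.indicator hS).comp measurable_prodMk_left).aemeasurable)]
      refine .of_forall fun R => indicator_of_notMem (fun h => ht h.1) _
  rw [h1, lintegral_lintegral_swap]
  swap
  · exact (hF.indicator hS).aemeasurable
  rw [heatMix, ← lintegral_indicator measurableSet_Ioi]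
  refine lintegral_congr fun R => ?_
  have h2 : ∀ t, {p : ℝ × ℝ | 0 < p.1 ∧ p.1 < p.2}.indicator
        (fun p => w p.1 * (v (p.2 - p.1) * ENNReal.ofReal (heat p.2 x))) (t, R) =
      (Ioo 0 R).indicator (fun t => w t * v (R - t) * ENNReal.ofReal (heat R x)) t := fun t => by
    by_cases h : 0 < t ∧ t < R
    · rw [indicator_of_mem (by exact h), indicator_of_mem (by exact h), mul_assoc]
    · rw [indicator_of_notMem (by exact h), indicator_of_notMem (by exact h)]
  simp only [h2]
  rw [lintegral_indicator measurableSet_Ioo]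
  by_cases hR : 0 < R
  · rw [indicator_of_mem (by exact hR), lintegral_mul_const]
    exact hw.mul (hv.comp (measurable_const.sub measurable_id))
  · rw [indicator_of_notMem (by exact hR), Ioo_eq_empty hR]
    simp

lemma lintegral_heat_mul_eq_scale {t : ℝ} (ht : 0 < t) (x : Ed d) {f : Ed d → ℝ≥0∞} :
    ∫⁻ y, ENNReal.ofReal (heat t (x - y)) * f y =
      ∫⁻ z, ENNReal.ofReal (heat 1 z) * f (x - Real.sqrt t • z) := by
  have hs : Real.sqrt t ≠ 0 := (Real.sqrt_pos.2 ht).ne'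
  rw [← lintegral_sub_left_eq_self (fun y => ENNReal.ofReal (heat t (x - y)) * f y) x]
  simp only [sub_sub_cancel]
  have e : (volume : Measure (Ed d)) = ENNReal.ofReal (Real.sqrt t ^ d) •
      Measure.map (fun z : Ed d => Real.sqrt t • z) volume := by
    have := Measure.map_addHaar_smul (volume : Measure (Ed d)) hs
    rw [this, smul_smul, finrank_euclideanSpace_fin, ← ENNReal.ofReal_mul (by positivity),
      abs_of_nonneg (by positivity), mul_inv_cancel₀ (by positivity), ENNReal.ofReal_one, one_smul]
  conv_lhs => rw [e]
  have hme : MeasurableEmbedding (fun z : Ed d => Real.sqrt t • z) :=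
    (Homeomorph.smulOfNeZero _ hs).measurableEmbedding
  rw [lintegral_smul_measure, hme.lintegral_map, smul_eq_mul,
    ← lintegral_const_mul' _ _ ENNReal.ofReal_ne_top]
  refine lintegral_congr fun z => ?_
  rw [heat_scale ht, smul_smul, inv_mul_cancel₀ hs, one_smul, ← mul_assoc,
    ← ENNReal.ofReal_mul (by positivity), ← mul_assoc]
  have : Real.sqrt t ^ d = t ^ ((d : ℝ) / 2) := by
    rw [Real.sqrt_eq_rpow, ← Real.rpow_natCast, ← Real.rpow_mul ht.le]; congr 1; ring
  rw [this, ← Real.rpow_add ht]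
  have h0 : (d : ℝ) / 2 + -(d : ℝ) / 2 = 0 := by ring
  rw [h0, Real.rpow_zero, one_mul]

/-- Averages of the heat semigroup over short times form an approximate identity. -/
lemma tendsto_lintegral_heat_average (hw : Measurable w) (hwt : ∫⁻ t in Ioi (0 : ℝ), w t ≠ ⊤)
    {f : Ed d → ℝ≥0∞} (hf : Continuous f) {B : ℝ≥0∞} (hB : B ≠ ⊤) (hfB : ∀ x, f x ≤ B)
    {ε : ℕ → ℝ} (hε : ∀ n, 0 < ε n) (hε0 : Tendsto ε atTop (𝓝 0)) (x : Ed d) :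
    Tendsto (fun n => ∫⁻ t in Ioi (0 : ℝ), w t *
        ∫⁻ y, ENNReal.ofReal (heat (ε n * t) (x - y)) * f y) atTop
      (𝓝 ((∫⁻ t in Ioi (0 : ℝ), w t) * f x)) := by
  have hmh : Measurable fun z : Ed d => ENNReal.ofReal (heat 1 z) :=
    (continuous_heat 1).measurable.ennreal_ofReal
  have hle : ∀ t, 0 < t → ∫⁻ z, ENNReal.ofReal (heat 1 z) * f (x - Real.sqrt t • z) ≤ B := by
    intro t ht
    calc _ ≤ ∫⁻ z : Ed d, ENNReal.ofReal (heat 1 z) * B := by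
          gcongr; exact hfB _
      _ = B := by rw [lintegral_mul_const _ hmh, lintegral_heat one_pos, one_mul]
  have h1 : ∀ n, ∫⁻ t in Ioi (0 : ℝ), w t *
        ∫⁻ y, ENNReal.ofReal (heat (ε n * t) (x - y)) * f y =
      ∫⁻ t in Ioi (0 : ℝ), w t *
        ∫⁻ z, ENNReal.ofReal (heat 1 z) * f (x - Real.sqrt (ε n * t) • z) := fun n =>
    setLIntegral_congr_fun measurableSet_Ioi fun t ht => by
      rw [lintegral_heat_mul_eq_scale (mul_pos (hε n) ht)]
  rw [funext h1, ← lintegral_mul_const _ hw]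
  have hint : ∫⁻ t in Ioi (0 : ℝ), w t * B ≠ ⊤ := by
    rw [lintegral_mul_const _ hw]; exact ENNReal.mul_ne_top hwt hB
  refine tendsto_lintegral_of_dominated_convergence (fun t => w t * B) ?_ ?_ hint ?_
  · intro n
    refine hw.mul ?_
    have : Measurable fun p : ℝ × Ed d =>
        ENNReal.ofReal (heat 1 p.2) * f (x - Real.sqrt (ε n * p.1) • p.2) :=
      (hmh.comp measurable_snd).mul (hf.measurable.comp (by fun_prop))
    exact this.lintegral_prod_right'
  · intro n
    filter_upwards [ae_restrict_mem measurableSet_Ioi] with t ht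
    gcongr
    exact hle _ (mul_pos (hε n) ht)
  · have hfin : ∀ᵐ t ∂(volume.restrict (Ioi (0 : ℝ))), w t < ⊤ := ae_lt_top hw hwt
    filter_upwards [hfin] with t hwtop
    refine ENNReal.Tendsto.const_mul ?_ (.inr hwtop.ne)
    have h2 : f x = ∫⁻ z : Ed d, ENNReal.ofReal (heat 1 z) * f x := by
      rw [lintegral_mul_const _ hmh, lintegral_heat one_pos, one_mul]
    rw [h2]
    refine tendsto_lintegral_of_dominated_convergence (fun z => ENNReal.ofReal (heat 1 z) * B)
      ?_ ?_ ?_ ?_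
    · exact fun n => hmh.mul (hf.measurable.comp (by fun_prop))
    · exact fun n => .of_forall fun z => mul_le_mul' le_rfl (hfB _)
    · rw [lintegral_mul_const _ hmh, lintegral_heat one_pos, one_mul]; exact hB
    · refine .of_forall fun z => ENNReal.Tendsto.const_mul ?_ (.inr ENNReal.ofReal_ne_top)
      refine (hf.tendsto x).comp ?_
      have h3 : Tendsto (fun n => x - Real.sqrt (ε n * t) • z) atTop
          (𝓝 (x - Real.sqrt (0 * t) • z)) :=
        tendsto_const_nhds.sub
          (((Real.continuous_sqrt.tendsto _).comp (hε0.mul_const t)).smul_const z)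
      simpa using h3

end HeatMix

/-! ### Riesz kernels -/

/-- The weight representing the defect of superharmonicity of the Riesz kernel. -/
def defectWeight (s ε r : ℝ) : ℝ := 1 / (s * r) * ((r / ε) ^ s - max (r / ε - 1) 0 ^ s)

/-- The Riesz kernel `|x|^{-(d-2s)}`, up to a constant. -/
def rieszKernel {d : ℕ} (s : ℝ) : Ed d → ℝ≥0∞ := heatMix fun r => ENNReal.ofReal (r ^ (s - 1))

/-- An integrable regularisation of the kernel `|x|^{-(d+2s)}`, up to a constant. -/
def truncKernel {d : ℕ} (s ε : ℝ) : Ed d → ℝ≥0∞ :=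
  heatMix ((Ioi ε).indicator fun t => ENNReal.ofReal (t ^ (-s - 1)))

/-- The defect kernel relating `rieszKernel` to its convolution with `truncKernel`. -/
def defectKernel {d : ℕ} (s ε : ℝ) : Ed d → ℝ≥0∞ :=
  heatMix fun r => ENNReal.ofReal (defectWeight s ε r)

section Riesz

variable {d : ℕ} {s : ℝ}

lemma measurable_defectWeight (ε : ℝ) : Measurable (defectWeight s ε) := by
  unfold defectWeight; fun_prop

lemma defectWeight_nonneg (hs : 0 < s) {ε r : ℝ} (hε : 0 < ε) (hr : 0 < r) :
    0 ≤ defectWeight s ε r := by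
  unfold defectWeight
  refine mul_nonneg (by positivity) (sub_nonneg.2 (Real.rpow_le_rpow (le_max_right _ _) ?_ hs.le))
  exact max_le (by linarith) (by positivity)

lemma defectWeight_scale {ε r : ℝ} (hε : 0 < ε) (hr : 0 < r) :
    defectWeight s ε (ε * r) = ε⁻¹ * defectWeight s 1 r := by
  unfold defectWeight
  rw [mul_div_cancel_left₀ _ hε.ne', div_one]
  by_cases hs : s = 0
  · simp [hs]
  · field_simp

lemma defectWeight_le_rpow (hs : 0 < s) {r : ℝ} (hr : 0 < r) :
    defectWeight s 1 r ≤ 1 / s * r ^ (s - 1) := by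
  have h : (0 : ℝ) ≤ max (r / 1 - 1) 0 ^ s := Real.rpow_nonneg (le_max_right _ _) _
  unfold defectWeight
  rw [Real.rpow_sub_one hr.ne']
  calc _ ≤ 1 / (s * r) * (r / 1) ^ s := by gcongr; linarith
    _ = _ := by rw [div_one]; field_simp

lemma defectWeight_le_rpow_of_one_le (hs : 0 < s) (hs1 : s < 1) {r : ℝ} (hr : 1 ≤ r) :
    defectWeight s 1 r ≤ 1 / s * r ^ (s - 2) := by
  have hr0 : 0 < r := by linarith
  have h1 : r * (1 - 1 / r) = r - 1 := by field_simp
  have h2 : 0 ≤ 1 - 1 / r := by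
    rw [sub_nonneg, div_le_one hr0]; exact hr
  have h2' : 1 - 1 / r ≤ 1 := by
    have : 0 ≤ 1 / r := by positivity
    linarith
  have h3 : 1 - 1 / r ≤ (1 - 1 / r) ^ s := by
    rcases h2.eq_or_lt with h | h
    · rw [← h]; exact Real.rpow_nonneg le_rfl _
    · simpa using Real.rpow_le_rpow_of_exponent_ge h h2' hs1.le
  unfold defectWeight
  rw [div_one, max_eq_left (by linarith), ← h1, Real.mul_rpow hr0.le h2]
  have h4 : r ^ (s - 2) = r ^ s / r ^ 2 := by
    rw [Real.rpow_sub hr0]; norm_num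
  have h5 : r ^ s - r ^ s * (1 - 1 / r) ^ s ≤ r ^ s * (1 / r) := by
    have : 0 ≤ r ^ s := by positivity
    nlinarith
  calc _ ≤ 1 / (s * r) * (r ^ s * (1 / r)) := by gcongr
    _ = _ := by rw [h4]; field_simp

lemma lintegral_defectWeight_lt_top (hs : 0 < s) (hs1 : s < 1) :
    ∫⁻ r in Ioi (0 : ℝ), ENNReal.ofReal (defectWeight s 1 r) < ⊤ := by
  have hsplit : Ioi (0 : ℝ) = Ioc 0 1 ∪ Ioi 1 := (Ioc_union_Ioi_eq_Ioi zero_le_one).symm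
  have hint : IntegrableOn (defectWeight s 1) (Ioi 0) := by
    rw [hsplit]
    refine IntegrableOn.union ?_ ?_
    · have h : IntegrableOn (fun r : ℝ => 1 / s * r ^ (s - 1)) (Ioc 0 1) := by
        refine Integrable.const_mul ?_ _
        have := intervalIntegral.intervalIntegrable_rpow' (a := 0) (b := 1) (r := s - 1)
          (by linarith)
        rwa [intervalIntegrable_iff_integrableOn_Ioc_of_le zero_le_one] at this
      refine h.mono' (measurable_defectWeight 1).aestronglyMeasurable ?_
      filter_upwards [ae_restrict_mem measurableSet_Ioc] with r hr
      rw [Real.norm_of_nonneg (defectWeight_nonneg hs one_pos hr.1)]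
      exact defectWeight_le_rpow hs hr.1
    · have h : IntegrableOn (fun r : ℝ => 1 / s * r ^ (s - 2)) (Ioi 1) :=
        (integrableOn_Ioi_rpow_of_lt (by linarith) one_pos).const_mul _
      refine h.mono' (measurable_defectWeight 1).aestronglyMeasurable ?_
      filter_upwards [ae_restrict_mem measurableSet_Ioi] with r hr
      have hr : 1 < r := hr
      rw [Real.norm_of_nonneg (defectWeight_nonneg hs one_pos (by linarith))]
      exact defectWeight_le_rpow_of_one_le hs hs1 hr.le
  refine lt_of_le_of_lt (lintegral_mono fun r => ?_) hint.hasFiniteIntegral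
  rw [← ofReal_norm]
  exact ENNReal.ofReal_le_ofReal (le_abs_self _)

lemma lintegral_defectWeight_pos (hs : 0 < s) :
    0 < ∫⁻ r in Ioi (0 : ℝ), ENNReal.ofReal (defectWeight s 1 r) := by
  have h : ∀ r ∈ Ioo (0 : ℝ) 1, 0 < defectWeight s 1 r := fun r hr => by
    unfold defectWeight
    rw [div_one, max_eq_right (by linarith [hr.2]), Real.zero_rpow hs.ne', sub_zero]
    have := hr.1
    positivity
  refine lt_of_lt_of_le ?_
    (lintegral_mono_set (show Ioo (0 : ℝ) 1 ⊆ Ioi 0 from Ioo_subset_Ioi_self))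
  rw [setLIntegral_pos_iff (measurable_defectWeight 1).ennreal_ofReal]
  refine lt_of_lt_of_le (b := volume (Ioo (0 : ℝ) 1)) (by simp) (measure_mono fun r hr => ?_)
  exact ⟨by simpa using h r hr, hr⟩

lemma lintegral_comp_mul_Ioi {ε : ℝ} (hε : 0 < ε) (F : ℝ → ℝ≥0∞) :
    ∫⁻ r in Ioi (0 : ℝ), F r = ∫⁻ σ in Ioi (0 : ℝ), ENNReal.ofReal ε * F (ε * σ) := by
  have h := lintegral_image_eq_lintegral_abs_deriv_mul (s := Ioi (0 : ℝ)) (f := fun σ => ε * σ)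
    (f' := fun _ => ε) measurableSet_Ioi
    (fun x _ => by simpa using ((hasDerivAt_id x).const_mul ε).hasDerivWithinAt)
    (fun x _ y _ hxy => mul_left_cancel₀ hε.ne' hxy) F
  rw [abs_of_pos hε] at h
  rw [← h]
  congr 2
  ext x
  simp only [mem_Ioi, mem_image]
  exact ⟨fun hx => ⟨x / ε, by positivity, by field_simp⟩,
    fun ⟨y, hy, e⟩ => e ▸ mul_pos hε hy⟩

lemma lintegral_defectWeight {ε : ℝ} (hε : 0 < ε) :
    ∫⁻ r in Ioi (0 : ℝ), ENNReal.ofReal (defectWeight s ε r) =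
      ∫⁻ r in Ioi (0 : ℝ), ENNReal.ofReal (defectWeight s 1 r) := by
  rw [lintegral_comp_mul_Ioi hε]
  refine setLIntegral_congr_fun measurableSet_Ioi fun r hr => ?_
  rw [defectWeight_scale hε hr, ← ENNReal.ofReal_mul hε.le, ← mul_assoc,
    mul_inv_cancel₀ hε.ne', one_mul]

lemma lintegral_truncWeight (hs : 0 < s) {ε : ℝ} (hε : 0 < ε) :
    ∫⁻ t in Ioi (0 : ℝ), (Ioi ε).indicator (fun t => ENNReal.ofReal (t ^ (-s - 1))) t =
      ENNReal.ofReal (ε ^ (-s) / s) := by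
  rw [setLIntegral_indicator measurableSet_Ioi, inter_eq_left.2 (Ioi_subset_Ioi hε.le),
    ← ofReal_integral_eq_lintegral_ofReal (integrableOn_Ioi_rpow_of_lt (by linarith) hε),
    integral_Ioi_rpow_of_lt (by linarith) hε]
  · congr 1
    rw [show -s - 1 + 1 = -s by ring, neg_div_neg_eq]
  · exact (ae_restrict_mem measurableSet_Ioi).mono fun t ht =>
      Real.rpow_nonneg (hε.le.trans (le_of_lt ht)) _

lemma lintegral_rpow_mul_rpow_sub (hs : 0 < s) {ε r : ℝ} (hε : 0 < ε) (hr : ε < r) :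
    ∫⁻ t in Ioo ε r, ENNReal.ofReal (t ^ (-s - 1)) * ENNReal.ofReal ((r - t) ^ (s - 1)) =
      ENNReal.ofReal (1 / (s * r) * (r / ε - 1) ^ s) := by
  have hr0 : 0 < r := hε.trans hr
  set F : ℝ → ℝ := fun t => -(1 / (s * r) * (r / t - 1) ^ s) with hF
  have hcont : ContinuousOn F (Icc ε r) := by
    refine ContinuousOn.neg (continuousOn_const.mul (ContinuousOn.rpow_const ?_ ?_))
    · exact (continuousOn_const.div continuousOn_id
        (fun x hx => (hε.trans_le hx.1).ne')).sub continuousOn_const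
    · exact fun x hx => .inr hs.le
  have hder : ∀ t ∈ Ioo ε r, HasDerivAt F (t ^ (-s - 1) * (r - t) ^ (s - 1)) t := by
    intro t ht
    have ht0 : 0 < t := hε.trans ht.1
    have hpos : 0 < r / t - 1 := by rw [sub_pos, one_lt_div ht0]; exact ht.2
    have h1 : HasDerivAt (fun t : ℝ => r / t - 1) (-(r / t ^ 2)) t := by
      have := ((hasDerivAt_inv ht0.ne').const_mul r).sub_const 1
      simp only [← div_eq_mul_inv] at this
      refine this.congr_deriv ?_
      rw [div_eq_mul_inv]; ring
    have h2 := ((h1.rpow_const (p := s) (.inl hpos.ne')).const_mul (1 / (s * r))).neg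
    refine h2.congr_deriv ?_
    have e1 : r / t - 1 = (r - t) / t := by field_simp
    rw [e1, Real.div_rpow (by linarith [ht.2]) ht0.le, Real.rpow_sub_one ht0.ne' (-s),
      Real.rpow_neg ht0.le, Real.rpow_sub_one ht0.ne' s]
    field_simp
  have hnn : ∀ t ∈ Ioo ε r, 0 ≤ t ^ (-s - 1) * (r - t) ^ (s - 1) := fun t ht =>
    mul_nonneg (Real.rpow_nonneg (hε.trans ht.1).le _) (Real.rpow_nonneg (by linarith [ht.2]) _)
  have hint := intervalIntegral.integrableOn_deriv_of_nonneg hcont hder hnn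
  have hval := intervalIntegral.integral_eq_sub_of_hasDerivAt_of_le hr.le hcont hder
    ((intervalIntegrable_iff_integrableOn_Ioc_of_le hr.le).2 hint)
  rw [intervalIntegral.integral_of_le hr.le, integral_Ioc_eq_integral_Ioo] at hval
  have hval' : F r - F ε = 1 / (s * r) * (r / ε - 1) ^ s := by
    simp only [hF, div_self hr0.ne', sub_self, Real.zero_rpow hs.ne']; ring
  rw [hval'] at hval
  rw [← hval, ofReal_integral_eq_lintegral_ofReal (hint.mono_set Ioo_subset_Ioc_self)]
  · refine setLIntegral_congr_fun measurableSet_Ioo fun t ht => ?_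
    exact (ENNReal.ofReal_mul (Real.rpow_nonneg (hε.trans ht.1).le _)).symm
  · exact (ae_restrict_mem measurableSet_Ioo).mono fun t ht => hnn t ht

lemma weight_identity (hs : 0 < s) {ε r : ℝ} (hε : 0 < ε) (hr : 0 < r) :
    (∫⁻ t in Ioo 0 r, (Ioi ε).indicator (fun t => ENNReal.ofReal (t ^ (-s - 1))) t *
        ENNReal.ofReal ((r - t) ^ (s - 1))) + ENNReal.ofReal (defectWeight s ε r) =
      ENNReal.ofReal (ε ^ (-s) / s) * ENNReal.ofReal (r ^ (s - 1)) := by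
  have hrhs : ε ^ (-s) / s * r ^ (s - 1) = 1 / (s * r) * (r / ε) ^ s := by
    rw [Real.div_rpow hr.le hε.le, Real.rpow_neg hε.le, Real.rpow_sub_one hr.ne']
    field_simp
  have e : ∀ t, (Ioi ε).indicator (fun t => ENNReal.ofReal (t ^ (-s - 1))) t *
        ENNReal.ofReal ((r - t) ^ (s - 1)) =
      (Ioi ε).indicator (fun t => ENNReal.ofReal (t ^ (-s - 1)) *
        ENNReal.ofReal ((r - t) ^ (s - 1))) t := fun t => by
    by_cases h : t ∈ Ioi ε <;> simp [h]
  simp only [e]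
  rw [setLIntegral_indicator measurableSet_Ioi, ← ENNReal.ofReal_mul (by positivity), hrhs]
  rcases le_or_gt r ε with h | h
  · have : Ioi ε ∩ Ioo 0 r = ∅ := by
      ext t; simp only [mem_inter_iff, mem_Ioi, mem_Ioo, mem_empty_iff_false, iff_false]
      intro ⟨h1, h2, h3⟩; linarith
    have h' : r / ε - 1 ≤ 0 := by rw [sub_nonpos, div_le_one hε]; exact h
    rw [this, Measure.restrict_empty, lintegral_zero_measure, zero_add, defectWeight,
      max_eq_right h', Real.zero_rpow hs.ne', sub_zero]
  · have : Ioi ε ∩ Ioo 0 r = Ioo ε r := by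
      ext t; simp only [mem_inter_iff, mem_Ioi, mem_Ioo]
      exact ⟨fun h => ⟨h.1, h.2.2⟩, fun h => ⟨h.1, hε.trans h.1, h.2⟩⟩
    have h' : 0 ≤ r / ε - 1 := by rw [sub_nonneg, one_le_div hε]; exact h.le
    rw [this, lintegral_rpow_mul_rpow_sub hs hε h,
      ← ENNReal.ofReal_add (by positivity) (defectWeight_nonneg hs hε hr), defectWeight,
      max_eq_left h']
    congr 1; ring

private lemma measurable_ofReal_rpow (a : ℝ) : Measurable fun r : ℝ => ENNReal.ofReal (r ^ a) :=
  (measurable_id.pow_const a).ennreal_ofReal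

lemma measurable_rieszKernel : Measurable (rieszKernel s : Ed d → ℝ≥0∞) :=
  measurable_heatMix (measurable_ofReal_rpow _)

lemma measurable_truncKernel (ε : ℝ) : Measurable (truncKernel s ε : Ed d → ℝ≥0∞) :=
  measurable_heatMix ((measurable_ofReal_rpow _).indicator measurableSet_Ioi)

lemma measurable_defectKernel (ε : ℝ) : Measurable (defectKernel s ε : Ed d → ℝ≥0∞) :=
  measurable_heatMix (measurable_defectWeight ε).ennreal_ofReal

/-- The Riesz kernel is superharmonic with respect to `truncKernel`, with explicit defect. -/
lemma lintegral_truncKernel_mul_rieszKernel (hs : 0 < s) {ε : ℝ} (hε : 0 < ε) (x : Ed d) :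
    (∫⁻ y, truncKernel s ε (x - y) * rieszKernel s y) + defectKernel s ε x =
      ENNReal.ofReal (ε ^ (-s) / s) * rieszKernel s x := by
  have hm := (measurable_ofReal_rpow (-s - 1)).indicator (measurableSet_Ioi (a := ε))
  rw [truncKernel, rieszKernel, lintegral_heatMix_mul_heatMix hm (measurable_ofReal_rpow _),
    defectKernel, add_comm, ← heatMix_add (measurable_defectWeight ε).ennreal_ofReal,
    ← heatMix_const_mul _ (measurable_ofReal_rpow _)]
  refine heatMix_congr (fun r hr => ?_) x
  rw [add_comm]
  exact weight_identity hs hε hr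

lemma lintegral_truncKernel (hs : 0 < s) {ε : ℝ} (hε : 0 < ε) :
    ∫⁻ x : Ed d, truncKernel s ε x = ENNReal.ofReal (ε ^ (-s) / s) := by
  rw [truncKernel, lintegral_heatMix ((measurable_ofReal_rpow _).indicator measurableSet_Ioi),
    lintegral_truncWeight hs hε]

/-- The total mass of the defect kernels. -/
def defectMass (s : ℝ) : ℝ≥0∞ := ∫⁻ r in Ioi (0 : ℝ), ENNReal.ofReal (defectWeight s 1 r)

lemma lintegral_defectKernel {ε : ℝ} (hε : 0 < ε) :
    ∫⁻ x : Ed d, defectKernel s ε x = defectMass s := by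
  rw [defectKernel, lintegral_heatMix (measurable_defectWeight ε).ennreal_ofReal,
    lintegral_defectWeight hε, defectMass]

lemma rieszKernel_eq (hd : 2 * s < d) {x : Ed d} (hx : x ≠ 0) :
    rieszKernel s x =
      ENNReal.ofReal (subordConst d ((d : ℝ) / 2 - s) * ‖x‖ ^ (-((d : ℝ) - 2 * s))) := by
  have h := lintegral_rpow_mul_heat (q := (d : ℝ) / 2 - s) (by linarith) hx
  rw [show (d : ℝ) / 2 - ((d : ℝ) / 2 - s) - 1 = s - 1 by ring,
    show 2 * ((d : ℝ) / 2 - s) = (d : ℝ) - 2 * s by ring] at h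
  exact h

lemma truncKernel_mono {ε ε' : ℝ} (h : ε ≤ ε') (x : Ed d) :
    truncKernel s ε' x ≤ truncKernel s ε x := by
  refine lintegral_mono fun t => mul_le_mul_left ?_ _
  exact indicator_le_indicator_of_subset (Ioi_subset_Ioi h) (fun _ => zero_le) t

lemma truncKernel_zero (hs : 0 < s) {x : Ed d} (hx : x ≠ 0) :
    truncKernel s 0 x =
      ENNReal.ofReal (subordConst d ((d : ℝ) / 2 + s) * ‖x‖ ^ (-((d : ℝ) + 2 * s))) := by
  have h := lintegral_rpow_mul_heat (q := (d : ℝ) / 2 + s) (by positivity) hx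
  rw [show (d : ℝ) / 2 - ((d : ℝ) / 2 + s) - 1 = -s - 1 by ring,
    show 2 * ((d : ℝ) / 2 + s) = (d : ℝ) + 2 * s by ring] at h
  rw [← h]
  exact heatMix_congr (fun t ht => by simp [ht]) x

lemma tendsto_truncKernel {ε : ℕ → ℝ} (hε0 : Tendsto ε atTop (𝓝 0)) (ha : Antitone ε)
    (x : Ed d) :
    Tendsto (fun n => truncKernel s (ε n) x) atTop (𝓝 (truncKernel s 0 x)) := by
  have hm : Measurable fun t : ℝ => ENNReal.ofReal (heat t x) :=
    (measurable_heat.comp (measurable_id.prodMk measurable_const)).ennreal_ofReal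
  refine lintegral_tendsto_of_tendsto_of_monotone
    (fun n => (((measurable_ofReal_rpow _).indicator measurableSet_Ioi).mul hm).aemeasurable)
    (.of_forall fun t n k hnk => mul_le_mul_left (indicator_le_indicator_of_subset
      (Ioi_subset_Ioi (ha hnk)) (fun _ => zero_le) t) _) ?_
  filter_upwards [ae_restrict_mem measurableSet_Ioi] with t ht
  refine tendsto_nhds_of_eventually_eq ?_
  filter_upwards [(tendsto_order.1 hε0).2 t ht] with n hn
  rw [indicator_of_mem (by exact hn), indicator_of_mem (by exact ht)]

end Riesz

/-! ### Weakly singular integrals -/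

section WeaklySingular

variable {d : ℕ}

lemma ae_ne_of_pos (hd : 0 < d) (x : Ed d) : ∀ᵐ y ∂(volume : Measure (Ed d)), y ≠ x := by
  have h := Measure.addHaar_closedBall (volume : Measure (Ed d)) x le_rfl
  rw [finrank_euclideanSpace_fin, zero_pow hd.ne', ENNReal.ofReal_zero, zero_mul,
    Metric.closedBall_zero] at h
  exact compl_mem_ae_iff.2 h

lemma integrableOn_ball_norm_rpow (hd : 0 < d) {b : ℝ} (hb : b < d) (R : ℝ) :
    IntegrableOn (fun z : Ed d => ‖z‖ ^ (-b)) (Metric.ball 0 R) := by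
  refine integrableOn_ball_of_norm_le_rpow (C := 1) (α := b)
    (by rw [finrank_euclideanSpace_fin]; exact hd) (by simpa using hb) (.of_forall fun x => ?_)
    (Measurable.aestronglyMeasurable (by fun_prop))
  rw [one_mul, Real.norm_of_nonneg (by positivity)]

/-- The integral of `|z|^{-b}` over the ball of radius `1/(n+1)`. -/
private def cap (d : ℕ) (b : ℝ) (n : ℕ) : ℝ :=
  ∫ z in Metric.ball (0 : Ed d) (1 / ((n : ℝ) + 1)), ‖z‖ ^ (-b)

private lemma tendsto_cap (hd : 0 < d) {b : ℝ} (hb : b < d) :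
    Tendsto (cap d b) atTop (𝓝 0) := by
  have h : Tendsto (fun n : ℕ => ∫ z : Ed d,
      (Metric.ball (0 : Ed d) (1 / ((n : ℝ) + 1))).indicator (fun z => ‖z‖ ^ (-b)) z) atTop
      (𝓝 (∫ _ : Ed d, (0 : ℝ))) := by
    refine tendsto_integral_of_dominated_convergence
      ((Metric.ball (0 : Ed d) 1).indicator (fun z => ‖z‖ ^ (-b))) ?_ ?_ ?_ ?_
    · intro n
      exact (Measurable.indicator (by fun_prop) measurableSet_ball).aestronglyMeasurable
    · rw [integrable_indicator_iff measurableSet_ball]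
      exact integrableOn_ball_norm_rpow hd hb 1
    · intro n
      refine .of_forall fun z => ?_
      rw [Real.norm_of_nonneg (indicator_nonneg (fun _ _ => by positivity) _)]
      refine indicator_le_indicator_of_subset (Metric.ball_subset_ball ?_)
        (fun _ => by positivity) z
      rw [div_le_one (by positivity)]; linarith [(Nat.cast_nonneg n : (0 : ℝ) ≤ n)]
    · filter_upwards [ae_ne_of_pos hd 0] with z hz
      refine tendsto_nhds_of_eventually_eq ?_
      have := (tendsto_order.1 (tendsto_one_div_add_atTop_nhds_zero_nat (𝕜 := ℝ))).2 ‖z‖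
        (norm_pos_iff.2 hz)
      filter_upwards [this] with n hn
      refine indicator_of_notMem ?_ _
      simpa using hn.le
  simp only [integral_zero] at h
  refine h.congr fun n => ?_
  rw [integral_indicator measurableSet_ball, cap]

variable {a γ M : ℝ} {h : Ed d → ℝ}

private lemma max_norm_pos (n : ℕ) (z : Ed d) : 0 < max ‖z‖ (1 / ((n : ℝ) + 1)) :=
  lt_max_of_lt_right (by positivity)

private lemma sub_trunc_le (ha : 0 < a) (hγ : 0 ≤ γ) {x y : Ed d} (hy : y ≠ 0)
    (hyx : y ≠ x) (h0 : 0 ≤ h y) (hM : h y ≤ M * ‖y‖ ^ (-γ)) (n : ℕ) :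
    0 ≤ ‖x - y‖ ^ (-a) * h y - max ‖x - y‖ (1 / ((n : ℝ) + 1)) ^ (-a) * h y ∧
    ‖x - y‖ ^ (-a) * h y - max ‖x - y‖ (1 / ((n : ℝ) + 1)) ^ (-a) * h y ≤
      M * ((Metric.ball (0 : Ed d) (1 / ((n : ℝ) + 1))).indicator
          (fun z => ‖z‖ ^ (-(a + γ))) (x - y) +
        (Metric.ball (0 : Ed d) (1 / ((n : ℝ) + 1))).indicator
          (fun z => ‖z‖ ^ (-(a + γ))) y) := by
  have hp : 0 < ‖x - y‖ := norm_pos_iff.2 (sub_ne_zero.2 (Ne.symm hyx))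
  have hq : 0 < ‖y‖ := norm_pos_iff.2 hy
  have hM0 : 0 ≤ M := by
    by_contra hneg
    have : M * ‖y‖ ^ (-γ) < 0 := mul_neg_of_neg_of_pos (not_le.1 hneg) (by positivity)
    linarith
  have hnn : ∀ z : Ed d, 0 ≤ (Metric.ball (0 : Ed d) (1 / ((n : ℝ) + 1))).indicator
          (fun z => ‖z‖ ^ (-(a + γ))) z := fun z => indicator_nonneg (fun _ _ => by positivity) _
  have hmono : max ‖x - y‖ (1 / ((n : ℝ) + 1)) ^ (-a) ≤ ‖x - y‖ ^ (-a) :=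
    Real.rpow_le_rpow_of_nonpos hp (le_max_left _ _) (by linarith)
  have hmax0 : 0 ≤ max ‖x - y‖ (1 / ((n : ℝ) + 1)) ^ (-a) :=
    Real.rpow_nonneg (max_norm_pos n _).le _
  refine ⟨by rw [← sub_mul]; exact mul_nonneg (sub_nonneg.2 hmono) h0, ?_⟩
  rcases le_or_gt (1 / ((n : ℝ) + 1)) ‖x - y‖ with hδ | hδ
  · rw [max_eq_left hδ, sub_self]
    exact mul_nonneg hM0 (add_nonneg (hnn _) (hnn _))
  · have h1 : ‖x - y‖ ^ (-a) * h y - max ‖x - y‖ (1 / ((n : ℝ) + 1)) ^ (-a) * h y ≤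
        M * (‖x - y‖ ^ (-a) * ‖y‖ ^ (-γ)) := by
      have : ‖x - y‖ ^ (-a) * h y ≤ ‖x - y‖ ^ (-a) * (M * ‖y‖ ^ (-γ)) := by gcongr
      nlinarith [mul_nonneg hmax0 h0]
    refine h1.trans (mul_le_mul_of_nonneg_left ?_ hM0)
    rw [indicator_of_mem (by simpa using hδ)]
    rcases le_or_gt ‖x - y‖ ‖y‖ with hpq | hpq
    · have : ‖y‖ ^ (-γ) ≤ ‖x - y‖ ^ (-γ) := Real.rpow_le_rpow_of_nonpos hp hpq (by linarith)
      have e : ‖x - y‖ ^ (-(a + γ)) = ‖x - y‖ ^ (-a) * ‖x - y‖ ^ (-γ) := by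
        rw [← Real.rpow_add hp]; ring_nf
      rw [e]
      have : ‖x - y‖ ^ (-a) * ‖y‖ ^ (-γ) ≤ ‖x - y‖ ^ (-a) * ‖x - y‖ ^ (-γ) := by gcongr
      linarith [hnn y]
    · rw [indicator_of_mem (s := Metric.ball (0 : Ed d) (1 / ((n : ℝ) + 1))) (a := y)
        (by simpa using hpq.trans hδ)]
      have : ‖x - y‖ ^ (-a) ≤ ‖y‖ ^ (-a) := Real.rpow_le_rpow_of_nonpos hq hpq.le (by linarith)
      have e : ‖y‖ ^ (-(a + γ)) = ‖y‖ ^ (-a) * ‖y‖ ^ (-γ) := by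
        rw [← Real.rpow_add hq]; ring_nf
      rw [e]
      have : ‖x - y‖ ^ (-a) * ‖y‖ ^ (-γ) ≤ ‖y‖ ^ (-a) * ‖y‖ ^ (-γ) := by gcongr
      have : (0 : ℝ) ≤ ‖x - y‖ ^ (-(a + γ)) := by positivity
      linarith

private lemma integrable_cap_majorant (hd : 0 < d) (haγ : a + γ < d) (x : Ed d) (n : ℕ) :
    Integrable (fun y => M * ((Metric.ball (0 : Ed d) (1 / ((n : ℝ) + 1))).indicator
          (fun z => ‖z‖ ^ (-(a + γ))) (x - y) +
        (Metric.ball (0 : Ed d) (1 / ((n : ℝ) + 1))).indicator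
          (fun z => ‖z‖ ^ (-(a + γ))) y)) := by
  have h1 : Integrable ((Metric.ball (0 : Ed d) (1 / ((n : ℝ) + 1))).indicator
          (fun z : Ed d => ‖z‖ ^ (-(a + γ)))) := by
    rw [integrable_indicator_iff measurableSet_ball]
    exact integrableOn_ball_norm_rpow hd haγ _
  exact ((h1.comp_sub_left x).add h1).const_mul M

private lemma integral_cap_majorant (hd : 0 < d) (haγ : a + γ < d) (x : Ed d) (n : ℕ) :
    ∫ y, M * ((Metric.ball (0 : Ed d) (1 / ((n : ℝ) + 1))).indicator
          (fun z => ‖z‖ ^ (-(a + γ))) (x - y) +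
        (Metric.ball (0 : Ed d) (1 / ((n : ℝ) + 1))).indicator
          (fun z => ‖z‖ ^ (-(a + γ))) y) = M * (2 * cap d (a + γ) n) := by
  have h1 : Integrable ((Metric.ball (0 : Ed d) (1 / ((n : ℝ) + 1))).indicator
          (fun z : Ed d => ‖z‖ ^ (-(a + γ)))) := by
    rw [integrable_indicator_iff measurableSet_ball]
    exact integrableOn_ball_norm_rpow hd haγ _
  rw [integral_const_mul, integral_add (h1.comp_sub_left x) h1,
    integral_sub_left_eq_self (fun y => (Metric.ball (0 : Ed d) (1 / ((n : ℝ) + 1))).indicator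
          (fun z => ‖z‖ ^ (-(a + γ))) y) volume x, integral_indicator measurableSet_ball, cap]
  ring

private lemma integrable_trunc_mul (ha : 0 < a) (hi : Integrable h) (x : Ed d) (n : ℕ) :
    Integrable fun y => max ‖x - y‖ (1 / ((n : ℝ) + 1)) ^ (-a) * h y := by
  refine hi.bdd_mul (c := (1 / ((n : ℝ) + 1)) ^ (-a))
    (Measurable.aestronglyMeasurable (by fun_prop)) (.of_forall fun y => ?_)
  rw [Real.norm_of_nonneg (Real.rpow_nonneg (max_norm_pos n _).le _)]
  exact Real.rpow_le_rpow_of_nonpos (by positivity) (le_max_right _ _) (by linarith)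

lemma integrable_norm_sub_rpow_mul (hd : 0 < d) (ha : 0 < a) (hγ : 0 ≤ γ)
    (haγ : a + γ < d) (hi : Integrable h) (h0 : ∀ y, 0 ≤ h y)
    (hM : ∀ᵐ y ∂(volume : Measure (Ed d)), h y ≤ M * ‖y‖ ^ (-γ))
    (x : Ed d) :
    Integrable fun y => ‖x - y‖ ^ (-a) * h y := by
  have h2 : Integrable fun y => ‖x - y‖ ^ (-a) * h y -
      max ‖x - y‖ (1 / (((0 : ℕ) : ℝ) + 1)) ^ (-a) * h y := by
    refine (integrable_cap_majorant (M := M) hd haγ x 0).mono' ?_ ?_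
    · exact ((Measurable.aestronglyMeasurable (by fun_prop)).mul hi.1).sub
        ((Measurable.aestronglyMeasurable (by fun_prop)).mul hi.1)
    · filter_upwards [ae_ne_of_pos hd 0, ae_ne_of_pos hd x, hM] with y hy hyx hMy
      have := sub_trunc_le ha hγ hy hyx (h0 y) hMy 0
      rw [Real.norm_of_nonneg this.1]
      exact this.2
  refine (h2.add (integrable_trunc_mul ha hi x 0)).congr (.of_forall fun y => ?_)
  simp

private lemma abs_potential_sub_le (hd : 0 < d) (ha : 0 < a) (hγ : 0 ≤ γ)
    (haγ : a + γ < d) (hi : Integrable h) (h0 : ∀ y, 0 ≤ h y)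
    (hM : ∀ᵐ y ∂(volume : Measure (Ed d)), h y ≤ M * ‖y‖ ^ (-γ))
    (x : Ed d) (n : ℕ) :
    |(∫ y, ‖x - y‖ ^ (-a) * h y) - ∫ y, max ‖x - y‖ (1 / ((n : ℝ) + 1)) ^ (-a) * h y| ≤
      M * (2 * cap d (a + γ) n) := by
  rw [← integral_sub (integrable_norm_sub_rpow_mul hd ha hγ haγ hi h0 hM x)
    (integrable_trunc_mul ha hi x n), ← integral_cap_majorant hd haγ x n]
  refine (abs_integral_le_integral_abs).trans (integral_mono_of_nonneg
    (.of_forall fun y => abs_nonneg _) (integrable_cap_majorant hd haγ x n) ?_)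
  filter_upwards [ae_ne_of_pos hd 0, ae_ne_of_pos hd x, hM] with y hy hyx hMy
  have := sub_trunc_le ha hγ hy hyx (h0 y) hMy n
  rw [abs_of_nonneg this.1]
  exact this.2

private lemma tendstoUniformly_potential (hd : 0 < d) (ha : 0 < a) (hγ : 0 ≤ γ)
    (haγ : a + γ < d) (hi : Integrable h) (h0 : ∀ y, 0 ≤ h y)
    (hM : ∀ᵐ y ∂(volume : Measure (Ed d)), h y ≤ M * ‖y‖ ^ (-γ)) :
    TendstoUniformly (fun (n : ℕ) (x : Ed d) =>
      ∫ y, max ‖x - y‖ (1 / ((n : ℝ) + 1)) ^ (-a) * h y)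
      (fun x => ∫ y, ‖x - y‖ ^ (-a) * h y) atTop := by
  rw [Metric.tendstoUniformly_iff]
  intro ε hε
  have h1 : Tendsto (fun n => M * (2 * cap d (a + γ) n)) atTop (𝓝 0) := by
    simpa using ((tendsto_cap hd haγ).const_mul 2).const_mul M
  filter_upwards [(tendsto_order.1 h1).2 ε hε] with n hn x
  rw [Real.dist_eq]
  exact (abs_potential_sub_le hd ha hγ haγ hi h0 hM x n).trans_lt hn

private lemma norm_trunc_le (ha : 0 < a) (x y : Ed d) (n : ℕ) :
    ‖max ‖x - y‖ (1 / ((n : ℝ) + 1)) ^ (-a) * h y‖ ≤ (1 / ((n : ℝ) + 1)) ^ (-a) * ‖h y‖ := by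
  rw [norm_mul, Real.norm_of_nonneg (Real.rpow_nonneg (max_norm_pos n _).le _)]
  exact mul_le_mul_of_nonneg_right
    (Real.rpow_le_rpow_of_nonpos (by positivity) (le_max_right _ _) (by linarith)) (norm_nonneg _)

lemma continuous_potential (hd : 0 < d) (ha : 0 < a) (hγ : 0 ≤ γ)
    (haγ : a + γ < d) (hi : Integrable h) (h0 : ∀ y, 0 ≤ h y)
    (hM : ∀ᵐ y ∂(volume : Measure (Ed d)), h y ≤ M * ‖y‖ ^ (-γ)) :
    Continuous fun x => ∫ y, ‖x - y‖ ^ (-a) * h y := by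
  refine (tendstoUniformly_potential hd ha hγ haγ hi h0 hM).continuous
    (Frequently.of_forall fun n => ?_)
  refine continuous_of_dominated (F := fun x y => max ‖x - y‖ (1 / ((n : ℝ) + 1)) ^ (-a) * h y)
    (bound := fun y => (1 / ((n : ℝ) + 1)) ^ (-a) * ‖h y‖)
    (fun x => (integrable_trunc_mul ha hi x n).1)
    (fun x => .of_forall fun y => norm_trunc_le ha x y n) (hi.norm.const_mul _)
    (.of_forall fun y => Continuous.mul (Continuous.rpow_const (by fun_prop)
      fun x => .inl (max_norm_pos n _).ne') continuous_const)

lemma tendsto_potential_cocompact (hd : 0 < d) (ha : 0 < a) (hγ : 0 ≤ γ)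
    (haγ : a + γ < d) (hi : Integrable h) (h0 : ∀ y, 0 ≤ h y)
    (hM : ∀ᵐ y ∂(volume : Measure (Ed d)), h y ≤ M * ‖y‖ ^ (-γ)) :
    Tendsto (fun x => ∫ y, ‖x - y‖ ^ (-a) * h y) (cocompact (Ed d)) (𝓝 0) := by
  have hn : ∀ n : ℕ, Tendsto (fun x => ∫ y, max ‖x - y‖ (1 / ((n : ℝ) + 1)) ^ (-a) * h y)
      (cocompact (Ed d)) (𝓝 0) := by
    intro n
    have : Tendsto (fun x => ∫ y, max ‖x - y‖ (1 / ((n : ℝ) + 1)) ^ (-a) * h y)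
      (cocompact (Ed d)) (𝓝 (∫ _ : Ed d, (0 : ℝ))) := by
      have : (cocompact (Ed d)).IsCountablyGenerated := by
        rw [← Metric.cobounded_eq_cocompact, ← comap_norm_atTop]; infer_instance
      refine tendsto_integral_filter_of_dominated_convergence
        (fun y => (1 / ((n : ℝ) + 1)) ^ (-a) * ‖h y‖)
        (.of_forall fun x => (integrable_trunc_mul ha hi x n).1)
        (.of_forall fun x => .of_forall fun y => norm_trunc_le ha x y n) (hi.norm.const_mul _)
        (.of_forall fun y => ?_)
      have h1 : Tendsto (fun x : Ed d => ‖x - y‖) (cocompact (Ed d)) atTop := by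
        refine tendsto_atTop_mono (f := fun x => ‖x‖ - ‖y‖) (fun x => norm_sub_norm_le x y) ?_
        exact tendsto_atTop_add_const_right _ _ (tendsto_norm_cocompact_atTop)
      have h2 := (tendsto_rpow_neg_atTop ha).comp
        (tendsto_atTop_mono (fun x => le_max_left (‖x - y‖) (1 / ((n : ℝ) + 1))) h1)
      simpa using h2.mul_const (h y)
    simpa using this
  exact (tendstoUniformly_potential hd ha hγ haγ hi h0 hM).tendsto_of_eventually_tendsto
    (.of_forall hn) tendsto_const_nhds

end WeaklySingular

/-! ### Riesz potentials of measures -/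

lemma lintegral_le_of_tendsto {α : Type*} [MeasurableSpace α] {μ : Measure α} {F : ℕ → α → ℝ≥0∞}
    {G : α → ℝ≥0∞} {K : ℝ≥0∞} (hF : ∀ n, AEMeasurable (F n) μ)
    (h : ∀ᵐ a ∂μ, Tendsto (fun n => F n a) atTop (𝓝 (G a))) (hK : ∀ n, ∫⁻ a, F n a ∂μ ≤ K) :
    ∫⁻ a, G a ∂μ ≤ K :=
  calc ∫⁻ a, G a ∂μ = ∫⁻ a, liminf (fun n => F n a) atTop ∂μ :=
        lintegral_congr_ae (h.mono fun a ha => ha.liminf_eq.symm)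
    _ ≤ liminf (fun n => ∫⁻ a, F n a ∂μ) atTop := lintegral_liminf_le' hF
    _ ≤ liminf (fun _ : ℕ => K) atTop := liminf_le_liminf (.of_forall hK)
    _ = K := by simp

/-- The Riesz potential of a measure, up to a constant. -/
def rieszPot {d : ℕ} (s : ℝ) (η : Measure (Ed d)) (x : Ed d) : ℝ≥0∞ :=
  ∫⁻ y, rieszKernel s (x - y) ∂η

section Potential

variable {d : ℕ} {s : ℝ}

lemma truncKernel_le (hs : 0 < s) {ε : ℝ} (hε : 0 < ε) (x : Ed d) :
    truncKernel s ε x ≤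
      ENNReal.ofReal (ε ^ (-s) / s) * ENNReal.ofReal ((4 * Real.pi * ε) ^ (-(d : ℝ) / 2)) := by
  have hle : truncKernel s ε x ≤ ∫⁻ t in Ioi (0 : ℝ),
      (Ioi ε).indicator (fun t => ENNReal.ofReal (t ^ (-s - 1))) t *
        ENNReal.ofReal ((4 * Real.pi * ε) ^ (-(d : ℝ) / 2)) := by
    refine lintegral_mono fun t => ?_
    by_cases ht : t ∈ Ioi ε
    · have ht' : ε < t := ht
      refine mul_le_mul' le_rfl (ENNReal.ofReal_le_ofReal ((heat_le (hε.trans ht') x).trans ?_))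
      refine Real.rpow_le_rpow_of_nonpos (by positivity) (by gcongr) ?_
      have : (0 : ℝ) ≤ d := Nat.cast_nonneg d
      linarith
    · simp [indicator_of_notMem ht]
  refine hle.trans_eq ?_
  rw [lintegral_mul_const' _ _ ENNReal.ofReal_ne_top, lintegral_truncWeight hs hε]

lemma truncKernel_lt_top (hs : 0 < s) {ε : ℝ} (hε : 0 < ε) (x : Ed d) : truncKernel s ε x < ⊤ :=
  (truncKernel_le hs hε x).trans_lt (ENNReal.mul_lt_top ENNReal.ofReal_lt_top ENNReal.ofReal_lt_top)

lemma lintegral_truncKernel_mul_rieszPot (hs : 0 < s) {ε : ℝ} (hε : 0 < ε) (η : Measure (Ed d))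
    [SFinite η] (x : Ed d) :
    (∫⁻ z, truncKernel s ε (x - z) * rieszPot s η z) + ∫⁻ y, defectKernel s ε (x - y) ∂η =
      ENNReal.ofReal (ε ^ (-s) / s) * rieszPot s η x := by
  have hm : Measurable fun p : Ed d × Ed d =>
      truncKernel s ε (x - p.1) * rieszKernel s (p.1 - p.2) :=
    ((measurable_truncKernel ε).comp (measurable_fst.const_sub x)).mul
      (measurable_rieszKernel.comp (measurable_fst.sub measurable_snd))
  have h1 : ∫⁻ z, truncKernel s ε (x - z) * rieszPot s η z =
      ∫⁻ y, (∫⁻ z, truncKernel s ε ((x - y) - z) * rieszKernel s z) ∂η := by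
    calc _ = ∫⁻ z, ∫⁻ y, truncKernel s ε (x - z) * rieszKernel s (z - y) ∂η := by
          refine lintegral_congr fun z => ?_
          rw [rieszPot, lintegral_const_mul]
          exact measurable_rieszKernel.comp (measurable_id.const_sub z)
      _ = ∫⁻ y, (∫⁻ z, truncKernel s ε (x - z) * rieszKernel s (z - y)) ∂η := by
          rw [lintegral_lintegral_swap]; exact hm.aemeasurable
      _ = _ := by
          refine lintegral_congr fun y => ?_
          rw [← lintegral_add_right_eq_self (fun z => truncKernel s ε (x - z) *
            rieszKernel s (z - y)) y]
          refine lintegral_congr fun z => ?_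
          rw [add_sub_cancel_right, sub_sub, add_comm y z]
  have hm2 : Measurable fun y => ∫⁻ z, truncKernel s ε ((x - y) - z) * rieszKernel s z := by
    have : Measurable fun p : Ed d × Ed d =>
        truncKernel s ε ((x - p.1) - p.2) * rieszKernel s p.2 :=
      ((measurable_truncKernel ε).comp ((measurable_fst.const_sub x).sub measurable_snd)).mul
        (measurable_rieszKernel.comp measurable_snd)
    exact this.lintegral_prod_right'
  rw [h1, ← lintegral_add_left hm2, rieszPot, ← lintegral_const_mul]
  · exact lintegral_congr fun y => lintegral_truncKernel_mul_rieszKernel hs hε (x - y)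
  · exact measurable_rieszKernel.comp (measurable_id.const_sub x)

lemma tendsto_defectKernel_conv (hs : 0 < s) (hs1 : s < 1)
    {f : Ed d → ℝ≥0∞} (hf : Continuous f) {B : ℝ≥0∞} (hB : B ≠ ⊤) (hfB : ∀ x, f x ≤ B)
    {ε : ℕ → ℝ} (hε : ∀ n, 0 < ε n) (hε0 : Tendsto ε atTop (𝓝 0)) (x : Ed d) :
    Tendsto (fun n => ∫⁻ y, defectKernel s (ε n) (x - y) * f y) atTop
      (𝓝 (defectMass s * f x)) := by
  refine (tendsto_lintegral_heat_average (w := fun r => ENNReal.ofReal (defectWeight s 1 r))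
    (measurable_defectWeight 1).ennreal_ofReal (lintegral_defectWeight_lt_top hs hs1).ne hf hB hfB
    hε hε0 x).congr fun n => ?_
  rw [defectKernel, lintegral_heatMix_mul (measurable_defectWeight _).ennreal_ofReal x
    hf.measurable]
  conv_rhs => rw [lintegral_comp_mul_Ioi (hε n)]
  refine setLIntegral_congr_fun measurableSet_Ioi fun r hr => ?_
  rw [defectWeight_scale (hε n) hr, ENNReal.ofReal_mul (inv_nonneg.2 (hε n).le), ← mul_assoc,
    ← mul_assoc, ← ENNReal.ofReal_mul (hε n).le, mul_inv_cancel₀ (hε n).ne', ENNReal.ofReal_one,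
    one_mul]

lemma tendsto_truncKernel_conv (hs : 0 < s)
    {f : Ed d → ℝ≥0∞} (hf : Continuous f) {B : ℝ≥0∞} (hB : B ≠ ⊤) (hfB : ∀ x, f x ≤ B)
    {ε : ℕ → ℝ} (hε : ∀ n, 0 < ε n) (hε0 : Tendsto ε atTop (𝓝 0)) (x : Ed d) :
    Tendsto (fun n => ENNReal.ofReal (s * ε n ^ s) * ∫⁻ y, truncKernel s (ε n) (x - y) * f y)
      atTop (𝓝 (f x)) := by
  have hm : ∀ ε : ℝ, Measurable ((Ioi ε).indicator fun t => ENNReal.ofReal (t ^ (-s - 1))) :=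
    fun ε => Measurable.indicator (by fun_prop) measurableSet_Ioi
  have h := ENNReal.Tendsto.const_mul (a := ENNReal.ofReal s)
    (tendsto_lintegral_heat_average (hm 1)
    (by rw [lintegral_truncWeight hs one_pos]; exact ENNReal.ofReal_ne_top) hf hB hfB
    hε hε0 x) (.inr ENNReal.ofReal_ne_top)
  rw [lintegral_truncWeight hs one_pos, ← mul_assoc, ← ENNReal.ofReal_mul hs.le, Real.one_rpow,
    mul_one_div_cancel hs.ne', ENNReal.ofReal_one, one_mul] at h
  refine h.congr fun n => ?_
  have hn := hε n
  rw [ENNReal.ofReal_mul hs.le, mul_assoc]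
  congr 1
  rw [truncKernel, lintegral_heatMix_mul (hm _) x hf.measurable]
  conv_rhs => rw [lintegral_comp_mul_Ioi hn]
  rw [← lintegral_const_mul' _ _ ENNReal.ofReal_ne_top]
  refine setLIntegral_congr_fun measurableSet_Ioi fun r hr => ?_
  have hr : 0 < r := hr
  simp only [← mul_assoc]
  congr 1
  by_cases h1 : 1 < r
  · rw [indicator_of_mem (by exact h1), indicator_of_mem
      (by exact lt_mul_of_one_lt_right hn h1), ← ENNReal.ofReal_mul (by positivity),
      ← ENNReal.ofReal_mul (by positivity)]
    congr 1
    rw [Real.mul_rpow hn.le hr.le, ← mul_assoc]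
    have : ε n ^ s * ε n * ε n ^ (-s - 1) = 1 := by
      nth_rewrite 2 [← Real.rpow_one (ε n)]
      rw [← Real.rpow_add hn, ← Real.rpow_add hn]
      have : s + 1 + (-s - 1) = 0 := by ring
      rw [this, Real.rpow_zero]
    rw [this, one_mul]
  · rw [indicator_of_notMem (by exact h1), indicator_of_notMem, mul_zero]
    simp only [mem_Ioi, not_lt] at h1 ⊢
    exact mul_le_of_le_one_right hn.le h1

end Potential

/-! ### The energy of a potential -/

section PotentialEnergy

variable {d : ℕ} {s : ℝ}

lemma truncKernel_neg (ε : ℝ) (x : Ed d) : truncKernel s ε (-x) = truncKernel s ε x :=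
  heatMix_neg x

lemma integrable_truncKernel (hs : 0 < s) {ε : ℝ} (hε : 0 < ε) :
    Integrable fun x : Ed d => (truncKernel s ε x).toReal :=
  integrable_toReal_of_lintegral_ne_top (measurable_truncKernel ε).aemeasurable
    (by rw [lintegral_truncKernel hs hε]; exact ENNReal.ofReal_ne_top)

lemma integral_truncKernel (hs : 0 < s) {ε : ℝ} (hε : 0 < ε) :
    ∫ x : Ed d, (truncKernel s ε x).toReal = ε ^ (-s) / s := by
  rw [integral_toReal (measurable_truncKernel ε).aemeasurable
    (.of_forall fun x => truncKernel_lt_top hs hε x), lintegral_truncKernel hs hε,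
    ENNReal.toReal_ofReal (by positivity)]

lemma integral_incr_mul_incr_mul_kernel {k : Ed d → ℝ} (hk : Integrable k)
    (hsym : ∀ x, k (-x) = k x) {U φ : Ed d → ℝ} (hU : Measurable U) {B : ℝ}
    (hB : ∀ x, |U x| ≤ B) (hφ : Integrable φ) :
    Integrable (fun p : Ed d × Ed d => incr U p * incr φ p * k (p.1 - p.2)) ∧
      ∫ p : Ed d × Ed d, incr U p * incr φ p * k (p.1 - p.2) =
        2 * ∫ y, φ y * (U y * (∫ x, k x) - ∫ x, k (y - x) * U x) := by
  have hA0 : Integrable (fun p : Ed d × Ed d => φ p.2 * k (p.1 - p.2)) :=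
    hφ.convolution_integrand (ContinuousLinearMap.mul ℝ ℝ) hk
  have hA : Integrable (fun p : Ed d × Ed d => φ p.2 * k (p.1 - p.2) * (U p.2 - U p.1)) := by
    refine hA0.mul_bdd (c := B + B) ?_ (.of_forall fun p => ?_)
    · exact ((hU.comp measurable_snd).sub (hU.comp measurable_fst)).aestronglyMeasurable
    · exact (norm_sub_le _ _).trans (add_le_add (hB _) (hB _))
  have hA' := hA.swap
  have heq : (fun p : Ed d × Ed d => incr U p * incr φ p * k (p.1 - p.2)) = fun p =>
      φ p.2 * k (p.1 - p.2) * (U p.2 - U p.1) +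
        ((fun p : Ed d × Ed d => φ p.2 * k (p.1 - p.2) * (U p.2 - U p.1)) ∘ Prod.swap) p := by
    ext p
    simp only [incr, Function.comp, Prod.fst_swap, Prod.snd_swap]
    rw [← neg_sub p.1 p.2, hsym]
    ring
  rw [heq]
  refine ⟨hA.add hA', ?_⟩
  rw [integral_add hA hA']
  have hsw : ∫ p : Ed d × Ed d, ((fun p : Ed d × Ed d => φ p.2 * k (p.1 - p.2) *
      (U p.2 - U p.1)) ∘ Prod.swap) p =
      ∫ p : Ed d × Ed d, φ p.2 * k (p.1 - p.2) * (U p.2 - U p.1) :=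
    integral_prod_swap (μ := (volume : Measure (Ed d))) (ν := (volume : Measure (Ed d)))
      (fun p : Ed d × Ed d => φ p.2 * k (p.1 - p.2) * (U p.2 - U p.1))
  rw [hsw, ← two_mul]
  congr 1
  rw [Measure.volume_eq_prod, integral_prod_symm _ hA]
  refine integral_congr_ae (.of_forall fun y => ?_)
  have hky : Integrable fun x => k (x - y) := hk.comp_sub_right y
  have hky2 : Integrable fun x => k (x - y) * U x :=
    hky.mul_bdd hU.aestronglyMeasurable (.of_forall hB)
  have h2 : ∀ x, k (y - x) = k (x - y) := fun x => by rw [← neg_sub, hsym]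
  calc ∫ x, φ y * k (x - y) * (U y - U x)
      = ∫ x, φ y * (U y * k (x - y) - k (x - y) * U x) := by
        refine integral_congr_ae (.of_forall fun x => ?_)
        simp only
        ring
    _ = _ := by
        rw [integral_const_mul, integral_sub (hky.const_mul _) hky2, integral_const_mul,
          integral_sub_right_eq_self (fun x => k x) y]
        simp only [h2]

variable {η : Measure (Ed d)} [IsFiniteMeasure η] {U : Ed d → ℝ} {B : ℝ}

lemma potential_defect (hs : 0 < s) (hpot : ∀ x, ENNReal.ofReal (U x) = rieszPot s η x)
    (hU : Measurable U) (hU0 : ∀ x, 0 ≤ U x) {ε : ℝ} (hε : 0 < ε) (y : Ed d) :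
    U y * (∫ x : Ed d, (truncKernel s ε x).toReal) -
      ∫ x, (truncKernel s ε (y - x)).toReal * U x =
      (∫⁻ x, defectKernel s ε (y - x) ∂η).toReal := by
  have h := lintegral_truncKernel_mul_rieszPot hs hε η y
  have hfin : ENNReal.ofReal (ε ^ (-s) / s) * rieszPot s η y < ⊤ := by
    rw [← hpot]; exact ENNReal.mul_lt_top ENNReal.ofReal_lt_top ENNReal.ofReal_lt_top
  have h1 := (le_self_add.trans h.le).trans_lt hfin
  have h2 := (le_add_self.trans h.le).trans_lt hfin
  have h3 := congrArg ENNReal.toReal h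
  rw [ENNReal.toReal_add h1.ne h2.ne, ENNReal.toReal_mul, ← hpot, ENNReal.toReal_ofReal (hU0 y),
    ENNReal.toReal_ofReal (by positivity)] at h3
  have h4 : ∫ x, (truncKernel s ε (y - x)).toReal * U x =
      (∫⁻ z, truncKernel s ε (y - z) * rieszPot s η z).toReal := by
    rw [integral_eq_lintegral_of_nonneg_ae
      (.of_forall fun x => mul_nonneg ENNReal.toReal_nonneg (hU0 x))]
    · congr 1
      refine lintegral_congr fun z => ?_
      rw [ENNReal.ofReal_mul ENNReal.toReal_nonneg, hpot,
        ENNReal.ofReal_toReal (truncKernel_lt_top hs hε _).ne]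
    · exact (((measurable_truncKernel ε).comp (measurable_id.const_sub y)).ennreal_toReal.mul
        hU).aestronglyMeasurable
  rw [h4, integral_truncKernel hs hε]
  linarith

lemma potential_truncated_energy (hs : 0 < s)
    (hpot : ∀ x, ENNReal.ofReal (U x) = rieszPot s η x)
    (hU : Measurable U) (hU0 : ∀ x, 0 ≤ U x) (hB : ∀ x, U x ≤ B) {ε : ℝ} (hε : 0 < ε)
    {φ : Ed d → ℝ} (hφ : Integrable φ) (hφm : Measurable φ) (hφ0 : ∀ x, 0 ≤ φ x) :
    Integrable (fun p : Ed d × Ed d =>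
      incr U p * incr φ p * (truncKernel s ε (p.1 - p.2)).toReal) ∧
      ∫ p : Ed d × Ed d, incr U p * incr φ p * (truncKernel s ε (p.1 - p.2)).toReal =
        2 * (∫⁻ y, (∫⁻ x, defectKernel s ε (y - x) * ENNReal.ofReal (φ x)) ∂η).toReal := by
  obtain ⟨h1, h2⟩ := integral_incr_mul_incr_mul_kernel (integrable_truncKernel (d := d) hs hε)
    (fun x => by rw [truncKernel_neg]) hU (B := B)
    (fun x => by rw [abs_of_nonneg (hU0 x)]; exact hB x) hφ
  refine ⟨h1, h2.trans ?_⟩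
  congr 1
  have hdm : Measurable fun p : Ed d × Ed d => defectKernel s ε (p.1 - p.2) :=
    (measurable_defectKernel ε).comp (measurable_fst.sub measurable_snd)
  have hDm : Measurable fun y => ∫⁻ x, defectKernel s ε (y - x) ∂η := hdm.lintegral_prod_right'
  simp only [potential_defect hs hpot hU hU0 hε]
  rw [integral_eq_lintegral_of_nonneg_ae
      (.of_forall fun x => mul_nonneg (hφ0 x) ENNReal.toReal_nonneg)]
  · congr 1
    calc _ = ∫⁻ x, ∫⁻ y, ENNReal.ofReal (φ x) * defectKernel s ε (x - y) ∂η := by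
          refine lintegral_congr fun x => ?_
          have hfin : ∫⁻ y, defectKernel s ε (x - y) ∂η < ⊤ := by
            refine (le_add_self.trans
              (lintegral_truncKernel_mul_rieszPot hs hε η x).le).trans_lt ?_
            rw [← hpot]; exact ENNReal.mul_lt_top ENNReal.ofReal_lt_top ENNReal.ofReal_lt_top
          rw [ENNReal.ofReal_mul (hφ0 x), ENNReal.ofReal_toReal hfin.ne, lintegral_const_mul]
          exact (measurable_defectKernel ε).comp (measurable_id.const_sub x)
      _ = _ := by
          rw [lintegral_lintegral_swap
            ((hφm.ennreal_ofReal.comp measurable_fst).mul hdm).aemeasurable]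
          refine lintegral_congr fun y => lintegral_congr fun x => ?_
          rw [mul_comm, show defectKernel s ε (x - y) = defectKernel s ε (y - x) from
            heatMix_sub_comm x y]
  · exact (hφm.mul hDm.ennreal_toReal).aestronglyMeasurable

lemma lintegral_defectKernel_conv_le {ε : ℝ} (hε : 0 < ε) {f : Ed d → ℝ≥0∞} {K : ℝ≥0∞}
    (hf : ∀ x, f x ≤ K) (y : Ed d) :
    ∫⁻ x, defectKernel s ε (y - x) * f x ≤ defectMass s * K := by
  refine (lintegral_mono fun x => mul_le_mul' le_rfl (hf x)).trans ?_
  rw [lintegral_mul_const]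
  · gcongr
    rw [lintegral_sub_left_eq_self (fun x => defectKernel s ε x) y, lintegral_defectKernel hε]
  · exact (measurable_defectKernel ε).comp (measurable_id.const_sub y)

/-- The ratio of the jump density to the subordinated kernel. -/
def jumpConst (d : ℕ) (s κ : ℝ) : ℝ := κ / (2 * subordConst d ((d : ℝ) / 2 + s))

/-- The constant in the identity `energy U φ = potConst * ∫ φ dη` for the potential `U` of `η`. -/
def potConst (d : ℕ) (s κ : ℝ) : ℝ := 2 * jumpConst d s κ * (defectMass s).toReal

lemma jumpConst_pos {κ : ℝ} (hs : 0 < s) (hκ : 0 < κ) : 0 < jumpConst d s κ := by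
  have := subordConst_pos (d := d) (q := (d : ℝ) / 2 + s) (by positivity)
  unfold jumpConst
  positivity

lemma defectMass_pos (hs : 0 < s) : 0 < defectMass s := lintegral_defectWeight_pos hs

lemma defectMass_lt_top (hs : 0 < s) (hs1 : s < 1) : defectMass s < ⊤ :=
  lintegral_defectWeight_lt_top hs hs1

lemma potConst_pos {κ : ℝ} (hs : 0 < s) (hs1 : s < 1) (hκ : 0 < κ) : 0 < potConst d s κ := by
  have := jumpConst_pos (d := d) hs hκ
  have := ENNReal.toReal_pos (defectMass_pos hs).ne' (defectMass_lt_top hs hs1).ne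
  unfold potConst
  positivity

lemma jumpDensity_eq {κ : ℝ} (hs : 0 < s) (hκ : 0 < κ) {x : Ed d} (hx : x ≠ 0) :
    ENNReal.ofReal ((κ / 2) / ‖x‖ ^ ((d : ℝ) + 2 * s)) =
      ENNReal.ofReal (jumpConst d s κ) * truncKernel s 0 x := by
  have := subordConst_pos (d := d) (q := (d : ℝ) / 2 + s) (by positivity)
  rw [truncKernel_zero hs hx, ← ENNReal.ofReal_mul (jumpConst_pos hs hκ).le,
    Real.rpow_neg (norm_nonneg x)]
  congr 1
  unfold jumpConst
  generalize subordConst d ((d : ℝ) / 2 + s) = q at *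
  field_simp

lemma lintegral_jumpMeasure_eq {κ : ℝ} (hs : 0 < s) (hκ : 0 < κ) {G : Ed d × Ed d → ℝ≥0∞}
    (hG : Measurable G) (h0 : ∀ x, G (x, x) = 0) :
    ∫⁻ p, G p ∂(jumpMeasure d s κ) = ENNReal.ofReal (jumpConst d s κ) *
      ∫⁻ p : Ed d × Ed d, G p * truncKernel s 0 (p.1 - p.2) := by
  rw [lintegral_jumpMeasure hG, ← lintegral_const_mul' _ _ ENNReal.ofReal_ne_top]
  refine lintegral_congr fun ⟨x, y⟩ => ?_
  by_cases hxy : x = y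
  · simp [hxy, h0]
  · simp only
    rw [jumpDensity_eq hs hκ (sub_ne_zero.2 hxy)]
    ring

lemma integral_jumpMeasure_eq {κ : ℝ} (hs : 0 < s) (hκ : 0 < κ) {F : Ed d × Ed d → ℝ}
    (h0 : ∀ x, F (x, x) = 0) :
    ∫ p, F p ∂(jumpMeasure d s κ) = jumpConst d s κ *
      ∫ p : Ed d × Ed d, F p * (truncKernel s 0 (p.1 - p.2)).toReal := by
  rw [integral_jumpMeasure hκ, ← integral_const_mul]
  refine integral_congr_ae (.of_forall fun ⟨x, y⟩ => ?_)
  by_cases hxy : x = y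
  · simp [hxy, h0]
  · simp only
    have := congrArg ENNReal.toReal (jumpDensity_eq hs hκ (sub_ne_zero.2 hxy))
    rw [ENNReal.toReal_mul, ENNReal.toReal_ofReal (by positivity),
      ENNReal.toReal_ofReal (jumpConst_pos hs hκ).le] at this
    rw [this]
    ring

lemma measurable_truncKernel_sub (ε : ℝ) :
    Measurable fun p : Ed d × Ed d => truncKernel s ε (p.1 - p.2) :=
  (measurable_truncKernel ε).comp (measurable_fst.sub measurable_snd)

private lemma tendsto_inv_nat : Tendsto (fun n : ℕ => 1 / ((n : ℝ) + 1)) atTop (𝓝 0) :=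
  tendsto_one_div_add_atTop_nhds_zero_nat

private lemma antitone_inv_nat : Antitone fun n : ℕ => 1 / ((n : ℝ) + 1) := fun a b h => by
  have : (a : ℝ) ≤ b := by exact_mod_cast h
  exact one_div_le_one_div_of_le (by positivity) (by linarith)

lemma potential_finiteEnergy {κ : ℝ} (hs : 0 < s) (hs1 : s < 1) (hκ : 0 < κ)
    (hpot : ∀ x, ENNReal.ofReal (U x) = rieszPot s η x)
    (hU : Continuous U) (hU0 : ∀ x, 0 ≤ U x) (hB : ∀ x, U x ≤ B)
    (hlim : Tendsto U (cocompact (Ed d)) (𝓝 0)) : FiniteEnergy d s κ U := by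
  have hB0 : 0 ≤ B := (hU0 0).trans (hB 0)
  refine ⟨hU.measurable, (lintegral_sq_lt_top_iff_memLp
    hU.measurable.incr.aestronglyMeasurable).1 ?_⟩
  rw [lintegral_jumpMeasure_eq hs hκ (hU.measurable.incr.pow_const 2).ennreal_ofReal
    (by simp [incr])]
  refine ENNReal.mul_lt_top ENNReal.ofReal_lt_top (lt_of_le_of_lt (b := ENNReal.ofReal
    (2 * (∫⁻ _ : Ed d, defectMass s * ENNReal.ofReal B ∂η).toReal)) ?_ ENNReal.ofReal_lt_top)
  set ε : ℕ → ℝ := fun n => 1 / ((n : ℝ) + 1) with hε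
  have hεpos : ∀ n, 0 < ε n := fun n => by simp only [hε]; positivity
  set φ : ℕ → Ed d → ℝ := fun n x => max (U x - ε n) 0 with hφ
  have hφc : ∀ n, Continuous (φ n) := fun n => (hU.sub continuous_const).max continuous_const
  have hφ0 : ∀ n x, 0 ≤ φ n x := fun n x => le_max_right _ _
  have hφB : ∀ n x, φ n x ≤ B := fun n x => max_le (by linarith [hB x, hεpos n]) hB0
  have hφi : ∀ n, Integrable (φ n) := fun n => by
    refine (hφc n).integrable_of_hasCompactSupport ?_
    have hev : ∀ᶠ x in cocompact (Ed d), U x < ε n := hlim.eventually_lt_const (hεpos n)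
    obtain ⟨K, hK, hKs⟩ := mem_cocompact.1 hev
    refine HasCompactSupport.intro hK fun x hx => max_eq_right ?_
    have : U x < ε n := hKs hx
    linarith
  refine lintegral_le_of_tendsto (F := fun n p => ENNReal.ofReal (incr (φ n) p ^ 2) *
    truncKernel s (ε n) (p.1 - p.2)) (fun n => ?_) (.of_forall fun p => ?_) fun n => ?_
  · exact (((hφc n).measurable.incr.pow_const 2).ennreal_ofReal.mul
      (measurable_truncKernel_sub _)).aemeasurable
  · have h1 : Tendsto (fun n => incr (φ n) p) atTop (𝓝 (incr U p)) := by
      have : ∀ x, Tendsto (fun n => φ n x) atTop (𝓝 (U x)) := fun x => by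
        have : Tendsto (fun n => max (U x - ε n) 0) atTop (𝓝 (max (U x - 0) 0)) :=
          (tendsto_const_nhds.sub tendsto_inv_nat).max tendsto_const_nhds
        simpa [max_eq_left (hU0 x)] using this
      exact (this _).sub (this _)
    have h2 := tendsto_truncKernel (s := s) tendsto_inv_nat antitone_inv_nat (p.1 - p.2)
    by_cases hp : p.1 = p.2
    · simp [incr, hp]
    · refine ENNReal.Tendsto.mul ((ENNReal.continuous_ofReal.tendsto _).comp (h1.pow 2)) (.inr ?_)
        h2 (.inr ENNReal.ofReal_ne_top)
      rw [truncKernel_zero hs (sub_ne_zero.2 hp)]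
      exact ENNReal.ofReal_ne_top
  · obtain ⟨hi, he⟩ := potential_truncated_energy hs hpot hU.measurable hU0 hB (hεpos n)
      (hφi n) (hφc n).measurable (hφ0 n)
    calc ∫⁻ p : Ed d × Ed d, ENNReal.ofReal (incr (φ n) p ^ 2) * truncKernel s (ε n) (p.1 - p.2)
        ≤ ∫⁻ p : Ed d × Ed d, ENNReal.ofReal
            (incr U p * incr (φ n) p * (truncKernel s (ε n) (p.1 - p.2)).toReal) := by
          refine lintegral_mono fun p => ?_
          rw [ENNReal.ofReal_mul' ENNReal.toReal_nonneg,
            ENNReal.ofReal_toReal (truncKernel_lt_top hs (hεpos n) _).ne]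
          refine mul_le_mul' (ENNReal.ofReal_le_ofReal ?_) le_rfl
          simp only [incr, hφ]
          rcases le_total (U p.1 - ε n) 0 with h1 | h1 <;>
            rcases le_total (U p.2 - ε n) 0 with h2 | h2 <;>
            simp only [max_eq_left, max_eq_right, h1, h2] <;> nlinarith
      _ = ENNReal.ofReal (∫ p : Ed d × Ed d,
            incr U p * incr (φ n) p * (truncKernel s (ε n) (p.1 - p.2)).toReal) := by
          refine (ofReal_integral_eq_lintegral_ofReal hi (.of_forall fun p => ?_)).symm
          refine mul_nonneg ?_ ENNReal.toReal_nonneg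
          simp only [incr, hφ]
          rcases le_total (U p.1 - ε n) 0 with h1 | h1 <;>
            rcases le_total (U p.2 - ε n) 0 with h2 | h2 <;>
            simp only [max_eq_left, max_eq_right, h1, h2] <;>
            nlinarith [mul_self_nonneg (U p.1 - U p.2)]
      _ ≤ _ := by
          rw [he]
          gcongr
          · rw [lintegral_const]
            exact ENNReal.mul_ne_top (ENNReal.mul_ne_top (defectMass_lt_top hs hs1).ne
              ENNReal.ofReal_ne_top) (measure_ne_top _ _)
          · exact lintegral_defectKernel_conv_le (hεpos n)
              (fun x => ENNReal.ofReal_le_ofReal (hφB n x)) _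

lemma potential_energy_of_nonneg {κ : ℝ} (hs : 0 < s) (hs1 : s < 1) (hκ : 0 < κ)
    (hpot : ∀ x, ENNReal.ofReal (U x) = rieszPot s η x)
    (hU : FiniteEnergy d s κ U) (hU0 : ∀ x, 0 ≤ U x) (hB : ∀ x, U x ≤ B)
    {φ : Ed d → ℝ} (hφ : FiniteEnergy d s κ φ) (hφc : Continuous φ) (hφi : Integrable φ)
    (hφ0 : ∀ x, 0 ≤ φ x) {M : ℝ} (hM : ∀ x, φ x ≤ M) :
    energy d s κ U φ = potConst d s κ * ∫ x, φ x ∂η := by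
  have hint := hU.integrable_mul hφ
  set ε : ℕ → ℝ := fun n => 1 / ((n : ℝ) + 1) with hε
  have hεpos : ∀ n, 0 < ε n := fun n => by simp only [hε]; positivity
  have hpt : ∀ p : Ed d × Ed d, Tendsto (fun n => incr U p * incr φ p *
      (truncKernel s (ε n) (p.1 - p.2)).toReal) atTop
      (𝓝 (incr U p * incr φ p * (truncKernel s 0 (p.1 - p.2)).toReal)) := fun p => by
    by_cases hp : p.1 = p.2
    · simp [incr, hp]
    · refine ((ENNReal.tendsto_toReal ?_).comp (tendsto_truncKernel (s := s) tendsto_inv_nat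
        antitone_inv_nat (p.1 - p.2))).const_mul _
      rw [truncKernel_zero hs (sub_ne_zero.2 hp)]
      exact ENNReal.ofReal_ne_top
  have hi0 : Integrable fun p : Ed d × Ed d =>
      incr U p * incr φ p * (truncKernel s 0 (p.1 - p.2)).toReal := by
    refine ⟨((hU.1.incr.mul hφ.1.incr).mul
      (measurable_truncKernel_sub 0).ennreal_toReal).aestronglyMeasurable, ?_⟩
    have h1 := hint.2
    rw [hasFiniteIntegral_iff_enorm, lintegral_jumpMeasure_eq hs hκ
      (by exact (hU.1.incr.mul hφ.1.incr).enorm) (by simp [incr])] at h1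
    have h2 := ENNReal.lt_top_of_mul_ne_top_right h1.ne
      (by simpa using jumpConst_pos (d := d) hs hκ)
    refine lt_of_le_of_lt (lintegral_mono fun p => ?_) h2
    rw [enorm_mul]
    refine mul_le_mul' le_rfl ?_
    rw [← ofReal_norm, Real.norm_of_nonneg ENNReal.toReal_nonneg]
    exact ENNReal.ofReal_toReal_le
  have hlimL := tendsto_integral_of_dominated_convergence
    (fun p : Ed d × Ed d => ‖incr U p * incr φ p * (truncKernel s 0 (p.1 - p.2)).toReal‖)
    (F := fun n p => incr U p * incr φ p * (truncKernel s (ε n) (p.1 - p.2)).toReal)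
    (fun n => ((hU.1.incr.mul hφ.1.incr).mul
      (measurable_truncKernel_sub _).ennreal_toReal).aestronglyMeasurable) hi0.norm
    (fun n => .of_forall fun p => by
      by_cases hp : p.1 = p.2
      · simp [incr, hp]
      · simp only [norm_mul]
        refine mul_le_mul_of_nonneg_left ?_ (by positivity)
        rw [Real.norm_of_nonneg ENNReal.toReal_nonneg, Real.norm_of_nonneg ENNReal.toReal_nonneg]
        refine ENNReal.toReal_mono ?_ (truncKernel_mono (hεpos n).le _)
        rw [truncKernel_zero hs (sub_ne_zero.2 hp)]
        exact ENNReal.ofReal_ne_top) (.of_forall hpt)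
  have hfin : ∫⁻ _ : Ed d, defectMass s * ENNReal.ofReal M ∂η < ⊤ := by
    rw [lintegral_const]
    exact ENNReal.mul_lt_top (ENNReal.mul_lt_top (defectMass_lt_top hs hs1)
      ENNReal.ofReal_lt_top) (measure_lt_top _ _)
  have hlimR : Tendsto (fun n => 2 * (∫⁻ y, (∫⁻ x, defectKernel s (ε n) (y - x) *
      ENNReal.ofReal (φ x)) ∂η).toReal) atTop
      (𝓝 (2 * (∫⁻ y, defectMass s * ENNReal.ofReal (φ y) ∂η).toReal)) := by
    refine ((ENNReal.tendsto_toReal ?_).comp (tendsto_lintegral_of_dominated_convergence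
      (fun _ => defectMass s * ENNReal.ofReal M) (fun n => ?_) (fun n => .of_forall fun y => ?_)
      hfin.ne (.of_forall fun y => ?_))).const_mul 2
    · refine (lt_of_le_of_lt (lintegral_mono fun x => ?_) hfin).ne
      exact mul_le_mul' le_rfl (ENNReal.ofReal_le_ofReal (hM x))
    · have : Measurable fun p : Ed d × Ed d =>
          defectKernel s (ε n) (p.1 - p.2) * ENNReal.ofReal (φ p.2) :=
        ((measurable_defectKernel _).comp (measurable_fst.sub measurable_snd)).mul
          (hφ.1.comp measurable_snd).ennreal_ofReal
      exact this.lintegral_prod_right'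
    · exact lintegral_defectKernel_conv_le (hεpos n)
        (fun x => ENNReal.ofReal_le_ofReal (hM x)) _
    · exact tendsto_defectKernel_conv hs hs1 (ENNReal.continuous_ofReal.comp hφc)
        (B := ENNReal.ofReal M) ENNReal.ofReal_ne_top
        (fun x => ENNReal.ofReal_le_ofReal (hM x)) hεpos tendsto_inv_nat y
  have heq := tendsto_nhds_unique hlimL (hlimR.congr fun n =>
    ((potential_truncated_energy hs hpot hU.1 hU0 hB (hεpos n) hφi hφ.1 hφ0).2).symm)
  rw [energy, integral_jumpMeasure_eq hs hκ (by simp [incr]), heq,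
    lintegral_const_mul _ hφ.1.ennreal_ofReal, ENNReal.toReal_mul,
    ← integral_eq_lintegral_of_nonneg_ae (.of_forall hφ0) hφ.1.aestronglyMeasurable, potConst]
  ring

lemma potential_energy {κ : ℝ} (hs : 0 < s) (hs1 : s < 1) (hκ : 0 < κ)
    (hpot : ∀ x, ENNReal.ofReal (U x) = rieszPot s η x)
    (hU : FiniteEnergy d s κ U) (hU0 : ∀ x, 0 ≤ U x) (hB : ∀ x, U x ≤ B)
    {φ : Ed d → ℝ} (hφ : FiniteEnergy d s κ φ) (hφc : Continuous φ) (hφi : Integrable φ)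
    {M : ℝ} (hM : ∀ x, |φ x| ≤ M) :
    energy d s κ U φ = potConst d s κ * ∫ x, φ x ∂η := by
  have hM0 : 0 ≤ M := (abs_nonneg _).trans (hM 0)
  have hint : Integrable φ η := Integrable.of_bound hφc.aestronglyMeasurable M (.of_forall hM)
  have hp : ∀ ψ : Ed d → ℝ, FiniteEnergy d s κ ψ → Continuous ψ → Integrable ψ →
      (∀ x, |ψ x| ≤ M) → FiniteEnergy d s κ (fun x => max (ψ x) 0) ∧
      energy d s κ U (fun x => max (ψ x) 0) = potConst d s κ * ∫ x, max (ψ x) 0 ∂η := by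
    intro ψ hψ hψc hψi hψM
    have hfe : FiniteEnergy d s κ (fun x => max (ψ x) 0) :=
      hψ.of_abs_incr_le (hψ.1.max measurable_const) fun x y => by
        simpa using abs_max_sub_max_le_abs (ψ x) (ψ y) 0
    exact ⟨hfe, potential_energy_of_nonneg hs hs1 hκ hpot hU hU0 hB hfe
      (hψc.max continuous_const) hψi.pos_part (fun x => le_max_right _ _)
      (fun x => max_le ((le_abs_self _).trans (hψM x)) hM0)⟩
  obtain ⟨h1, h1'⟩ := hp φ hφ hφc hφi hM
  have hneg : FiniteEnergy d s κ (fun x => -φ x) := by simpa using hφ.const_mul (-1)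
  obtain ⟨h2, h2'⟩ := hp (fun x => -φ x) hneg hφc.neg hφi.neg (by simpa using hM)
  have hdec : φ = fun x => max (φ x) 0 - max (-φ x) 0 := by
    ext x
    rcases le_total (φ x) 0 with h | h
    · rw [max_eq_right h, max_eq_left (by linarith)]; ring
    · rw [max_eq_left h, max_eq_right (by linarith)]; ring
  conv_lhs => rw [hdec]
  rw [energy_sub_right h1 h2 hU, h1', h2', ← mul_sub,
    ← integral_sub hint.pos_part (by exact hint.neg.pos_part)]
  congr 1
  exact integral_congr_ae (.of_forall fun x => (congrFun hdec x).symm)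

end PotentialEnergy

/-! ### Admissible parameters and the tail of the jump kernel -/

/-- The standing assumptions on the parameters, with two-sided bounds on the weight. -/
structure Setup (d : ℕ) (s κ γ c C : ℝ) (ρ : Ed d → ℝ) : Prop where
  s_pos : 0 < s
  s_lt_one : s < 1
  lt_dim : 2 * s < d
  κ_pos : 0 < κ
  γ_nonneg : 0 ≤ γ
  γ_lt : γ < 2 * s
  c_pos : 0 < c
  C_pos : 0 < C
  measurable : Measurable ρ
  pos : ∀ x, 0 < ρ x
  lower : ∀ᵐ x, c * (1 + ‖x‖) ^ (-γ) ≤ ρ x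
  upper : ∀ᵐ x, ρ x ≤ C * ‖x‖ ^ (-γ)

namespace Setup

variable {d : ℕ} {s κ γ c C : ℝ} {ρ : Ed d → ℝ}

lemma dim_pos (h : Setup d s κ γ c C ρ) : 0 < d := by
  have h1 := h.lt_dim
  have h2 := h.s_pos
  have : (0 : ℝ) < d := by linarith
  exact_mod_cast this

lemma locallyFinite (h : Setup d s κ γ c C ρ) (R : ℝ) :
    weightMeasure ρ (Metric.ball 0 R) < ⊤ := by
  rw [weightMeasure, withDensity_apply _ Metric.isOpen_ball.measurableSet]
  have hi := (integrableOn_ball_norm_rpow h.dim_pos (b := γ)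
    (by linarith [h.γ_lt, h.lt_dim]) R).const_mul C
  refine lt_of_le_of_lt (lintegral_mono_ae (ae_restrict_of_ae (h.upper.mono fun x hx =>
    ENNReal.ofReal_le_ofReal hx))) ?_
  exact (hasFiniteIntegral_iff_ofReal (.of_forall fun x => by
    have := h.C_pos; positivity)).1 hi.2

end Setup

/-- A weight that is quadratic near the origin and grows like a power at infinity. -/
def jumpWeight {d : ℕ} (q : ℝ) (h : Ed d) : ℝ := if ‖h‖ ≤ 1 then ‖h‖ ^ 2 else ‖h‖ ^ q

section Jump

variable {d : ℕ} {s κ : ℝ}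

lemma measurable_jumpWeight (q : ℝ) : Measurable (jumpWeight q : Ed d → ℝ) :=
  Measurable.ite (measurableSet_le measurable_norm measurable_const) (by fun_prop) (by fun_prop)

lemma lintegral_jumpWeight_lt_top (hs : 0 < s) (hs1 : s < 1) (hd : 0 < d) (hκ : 0 < κ) {q : ℝ}
    (hq : q < 2 * s) :
    ∫⁻ h : Ed d, ENNReal.ofReal ((κ / 2) / ‖h‖ ^ ((d : ℝ) + 2 * s)) *
      ENNReal.ofReal (jumpWeight q h) < ⊤ := by
  set r : ℝ := d + 2 * s - q with hr
  have hr0 : 0 < r := by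
    have : (0 : ℝ) < d := by exact_mod_cast hd
    linarith
  have h1 : Integrable (fun h : Ed d => (Metric.ball (0 : Ed d) 2).indicator
      (fun h => ‖h‖ ^ (-((d : ℝ) + 2 * s - 2))) h) :=
    (integrableOn_ball_norm_rpow hd (by linarith) 2).integrable_indicator
      Metric.isOpen_ball.measurableSet
  have h2 : Integrable (fun h : Ed d => 2 ^ r * (1 + ‖h‖) ^ (-r)) := by
    refine (integrable_one_add_norm ?_).const_mul _
    simp only [finrank_euclideanSpace, Fintype.card_fin, hr]
    linarith
  have h3 := (h1.add h2).const_mul (κ / 2)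
  refine lt_of_le_of_lt (lintegral_mono fun h => ?_)
    ((hasFiniteIntegral_iff_ofReal (.of_forall fun h => ?_)).1 h3.2)
  · rw [← ENNReal.ofReal_mul (by positivity)]
    refine ENNReal.ofReal_le_ofReal ?_
    simp only [Pi.add_apply]
    rw [div_mul_eq_mul_div, mul_div_assoc]
    refine mul_le_mul_of_nonneg_left ?_ (by positivity)
    have hA : 0 ≤ (Metric.ball (0 : Ed d) 2).indicator
      (fun h => ‖h‖ ^ (-((d : ℝ) + 2 * s - 2))) h := indicator_nonneg (fun _ _ => by positivity) _
    unfold jumpWeight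
    split_ifs with hh
    · rcases eq_or_ne h 0 with rfl | h0
      · rw [norm_zero, zero_pow two_ne_zero, zero_div]
        exact add_nonneg hA (by positivity)
      · have hn : 0 < ‖h‖ := norm_pos_iff.2 h0
        rw [indicator_of_mem (by simpa using hh.trans_lt one_lt_two)]
        refine le_add_of_le_of_nonneg (le_of_eq ?_) (by positivity)
        rw [← Real.rpow_natCast, ← Real.rpow_sub hn]
        congr 1
        push_cast
        ring
    · have hn : 1 < ‖h‖ := not_le.1 hh
      refine le_add_of_nonneg_of_le hA ?_
      rw [← Real.rpow_sub (by linarith), Real.rpow_neg (by positivity), ← div_eq_mul_inv,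
        ← Real.div_rpow (by norm_num) (by positivity)]
      have : q - (d + 2 * s) = -r := by rw [hr]; ring
      rw [this, Real.rpow_neg (by positivity), ← Real.inv_rpow (by positivity)]
      refine Real.rpow_le_rpow (by positivity) ?_ hr0.le
      rw [inv_eq_one_div, div_le_div_iff₀ (by positivity) (by positivity)]
      linarith
  · simp only [Pi.add_apply]
    have hA : 0 ≤ (Metric.ball (0 : Ed d) 2).indicator
      (fun h => ‖h‖ ^ (-((d : ℝ) + 2 * s - 2))) h := indicator_nonneg (fun _ _ => by positivity) _
    positivity

lemma lintegral_jumpMeasure_mul {F g : Ed d → ℝ≥0∞} (hF : Measurable F) (hg : Measurable g) :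
    ∫⁻ p, F p.1 * g (p.1 - p.2) ∂(jumpMeasure d s κ) = (∫⁻ x, F x) *
      ∫⁻ h : Ed d, ENNReal.ofReal ((κ / 2) / ‖h‖ ^ ((d : ℝ) + 2 * s)) * g h := by
  have hk : Measurable fun h : Ed d => ENNReal.ofReal ((κ / 2) / ‖h‖ ^ ((d : ℝ) + 2 * s)) := by
    fun_prop
  have hG : Measurable fun p : Ed d × Ed d => F p.1 * g (p.1 - p.2) :=
    (hF.comp measurable_fst).mul (hg.comp (measurable_fst.sub measurable_snd))
  rw [lintegral_jumpMeasure hG, Measure.volume_eq_prod, lintegral_prod _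
    (by exact (measurable_jumpDensity.mul hG).aemeasurable), ← lintegral_mul_const _ hF]
  refine lintegral_congr fun x => ?_
  simp only
  rw [← lintegral_sub_left_eq_self (fun h => ENNReal.ofReal ((κ / 2) / ‖h‖ ^ ((d : ℝ) + 2 * s)) *
    g h) x, ← lintegral_const_mul]
  · refine lintegral_congr fun y => ?_
    ring
  · exact (hk.mul hg).comp (measurable_id.const_sub x)

lemma lintegral_jumpMeasure_swap {G : Ed d × Ed d → ℝ≥0∞} (hG : Measurable G) :
    ∫⁻ p, G p.swap ∂(jumpMeasure d s κ) = ∫⁻ p, G p ∂(jumpMeasure d s κ) := by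
  rw [lintegral_jumpMeasure (by exact hG.comp measurable_swap), lintegral_jumpMeasure hG,
    Measure.volume_eq_prod, ← lintegral_prod_swap]
  refine lintegral_congr fun p => ?_
  simp only [Prod.fst_swap, Prod.snd_swap, Prod.swap_swap]
  rw [norm_sub_rev]

lemma finiteEnergy_of_lipschitz (hs : 0 < s) (hs1 : s < 1) (hd : 0 < d) (hκ : 0 < κ)
    {η : Ed d → ℝ} {L : ℝ≥0} (hL : LipschitzWith L η) (hc : HasCompactSupport η) :
    FiniteEnergy d s κ η := by
  have hηc : Continuous η := hL.continuous
  obtain ⟨M, hM⟩ := hc.exists_bound_of_continuous hηc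
  refine ⟨hηc.measurable, (lintegral_sq_lt_top_iff_memLp
    hηc.measurable.incr.aestronglyMeasurable).1 ?_⟩
  set S := tsupport η
  have hS : MeasurableSet S := (isClosed_tsupport η).measurableSet
  set A : ℝ := max (L ^ 2) (4 * M ^ 2)
  have hA0 : 0 ≤ A := le_max_of_le_left (by positivity)
  set F : Ed d → ℝ≥0∞ := fun x => S.indicator (fun _ => ENNReal.ofReal A) x
  set g : Ed d → ℝ≥0∞ := fun h => ENNReal.ofReal (jumpWeight 0 h)
  have hFm : Measurable F := measurable_const.indicator hS
  have hgm : Measurable g := (measurable_jumpWeight 0).ennreal_ofReal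
  have hm : Measurable fun p : Ed d × Ed d => F p.1 * g (p.1 - p.2) :=
    (hFm.comp measurable_fst).mul (hgm.comp (measurable_fst.sub measurable_snd))
  have hfin : ∫⁻ p, F p.1 * g (p.1 - p.2) ∂(jumpMeasure d s κ) < ⊤ := by
    rw [lintegral_jumpMeasure_mul hFm hgm]
    refine ENNReal.mul_lt_top ?_ (lintegral_jumpWeight_lt_top hs hs1 hd hκ (by linarith))
    rw [lintegral_indicator_const hS]
    exact ENNReal.mul_lt_top ENNReal.ofReal_lt_top hc.measure_lt_top
  refine lt_of_le_of_lt (b := ∫⁻ p, F p.1 * g (p.1 - p.2) + F p.2 * g (p.2 - p.1)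
    ∂(jumpMeasure d s κ)) (lintegral_mono fun p => ?_) ?_
  · have hkey : incr η p ^ 2 ≤ A * jumpWeight 0 (p.1 - p.2) := by
      unfold jumpWeight incr
      split_ifs with h
      · have h1 := hL.dist_le_mul p.1 p.2
        rw [Real.dist_eq, dist_eq_norm] at h1
        calc (η p.1 - η p.2) ^ 2 = |η p.1 - η p.2| ^ 2 := (sq_abs _).symm
          _ ≤ (L * ‖p.1 - p.2‖) ^ 2 := by gcongr
          _ = L ^ 2 * ‖p.1 - p.2‖ ^ 2 := by ring
          _ ≤ _ := by gcongr; exact le_max_left _ _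
      · rw [Real.rpow_zero, mul_one]
        refine le_trans ?_ (le_max_right _ _)
        have h1 := abs_le.1 (hM p.1)
        have h2 := abs_le.1 (hM p.2)
        nlinarith
    by_cases h1 : p.1 ∈ S
    · refine le_add_right ?_
      simp only [F, indicator_of_mem h1, g]
      rw [← ENNReal.ofReal_mul hA0]
      exact ENNReal.ofReal_le_ofReal hkey
    · by_cases h2 : p.2 ∈ S
      · refine le_add_left ?_
        simp only [F, indicator_of_mem h2, g]
        rw [← ENNReal.ofReal_mul hA0]
        refine ENNReal.ofReal_le_ofReal (hkey.trans (le_of_eq ?_))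
        unfold jumpWeight
        rw [norm_sub_rev]
      · simp [incr, image_eq_zero_of_notMem_tsupport h1, image_eq_zero_of_notMem_tsupport h2]
  · rw [lintegral_add_left hm]
    refine ENNReal.add_lt_top.2 ⟨hfin, ?_⟩
    have := lintegral_jumpMeasure_swap (s := s) (κ := κ) hm
    simp only [Prod.fst_swap, Prod.snd_swap] at this
    rw [this]
    exact hfin

lemma finiteEnergy_of_contDiff (hs : 0 < s) (hs1 : s < 1) (hd : 0 < d) (hκ : 0 < κ)
    {η : Ed d → ℝ} (hη : ContDiff ℝ 1 η) (hc : HasCompactSupport η) : FiniteEnergy d s κ η := by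
  obtain ⟨L, hL⟩ := ContDiff.lipschitzWith_of_hasCompactSupport hc hη one_ne_zero
  exact finiteEnergy_of_lipschitz hs hs1 hd hκ hL hc

end Jump

/-! ### Cutoff and mollification -/

section Cutoff

variable {d : ℕ} {s κ γ c C : ℝ} {ρ : Ed d → ℝ}

/-- The squared energy seminorm with values in `[0, ∞]`. -/
def energySq (d : ℕ) (s κ : ℝ) (v : Ed d → ℝ) : ℝ≥0∞ :=
  ∫⁻ p, ENNReal.ofReal (incr v p ^ 2) ∂(jumpMeasure d s κ)

lemma FiniteEnergy.ofReal_energy {v : Ed d → ℝ} (hv : FiniteEnergy d s κ v) :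
    ENNReal.ofReal (energy d s κ v v) = energySq d s κ v := by
  rw [energy, ofReal_integral_eq_lintegral_ofReal (hv.integrable_mul hv)
    (.of_forall fun p => mul_self_nonneg _)]
  simp only [energySq, sq]

lemma FiniteEnergy.energySq_lt_top {v : Ed d → ℝ} (hv : FiniteEnergy d s κ v) :
    energySq d s κ v < ⊤ := by
  rw [← hv.ofReal_energy]
  exact ENNReal.ofReal_lt_top

lemma finiteEnergy_of_energySq_lt_top {v : Ed d → ℝ} (hv : Measurable v)
    (h : energySq d s κ v < ⊤) : FiniteEnergy d s κ v :=
  ⟨hv, (lintegral_sq_lt_top_iff_memLp hv.incr.aestronglyMeasurable).1 h⟩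

/-- A radial cutoff function. -/
def cutoff {d : ℕ} (R : ℝ) (x : Ed d) : ℝ := max 0 (min 1 (2 - ‖x‖ / R))

lemma continuous_cutoff (R : ℝ) : Continuous (cutoff R : Ed d → ℝ) := by
  unfold cutoff
  fun_prop

lemma cutoff_nonneg (R : ℝ) (x : Ed d) : 0 ≤ cutoff R x := le_max_left _ _

lemma cutoff_le_one (R : ℝ) (x : Ed d) : cutoff R x ≤ 1 := max_le zero_le_one (min_le_left _ _)

lemma cutoff_eq_zero {R : ℝ} (hR : 0 < R) {x : Ed d} (hx : 2 * R ≤ ‖x‖) : cutoff R x = 0 := by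
  refine max_eq_left ((min_le_right _ _).trans ?_)
  rw [sub_nonpos, le_div_iff₀ hR]
  exact hx

lemma cutoff_eq_one {R : ℝ} (hR : 0 < R) {x : Ed d} (hx : ‖x‖ ≤ R) : cutoff R x = 1 := by
  have : ‖x‖ / R ≤ 1 := (div_le_one hR).2 hx
  unfold cutoff
  rw [min_eq_left (by linarith), max_eq_right zero_le_one]

lemma cutoff_sub_sq_le {R : ℝ} (hR : 0 < R) (x y : Ed d) :
    (cutoff R x - cutoff R y) ^ 2 ≤ min 1 (‖x - y‖ ^ 2 / R ^ 2) := by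
  refine le_min ?_ ?_
  · have := cutoff_nonneg R x
    have := cutoff_nonneg R y
    have := cutoff_le_one R x
    have := cutoff_le_one R y
    rw [sq_le_one_iff_abs_le_one, abs_le]
    constructor <;> linarith
  · have h1 : |cutoff R x - cutoff R y| ≤ ‖x - y‖ / R := by
      calc |cutoff R x - cutoff R y| ≤ |(2 - ‖x‖ / R) - (2 - ‖y‖ / R)| := by
            unfold cutoff
            refine (abs_max_sub_max_le_max _ _ _ _).trans (max_le (by simp) ?_)
            refine (abs_min_sub_min_le_max _ _ _ _).trans (max_le (by simp) le_rfl)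
        _ = |‖y‖ - ‖x‖| / R := by
            rw [← abs_of_pos hR, ← abs_div, abs_of_pos hR]
            congr 1
            ring
        _ ≤ _ := by
            gcongr
            rw [norm_sub_rev]
            exact abs_norm_sub_norm_le _ _
    rw [← sq_abs, ← div_pow]
    gcongr

lemma tendsto_cutoff (x : Ed d) :
    Tendsto (fun n : ℕ => cutoff ((n : ℝ) + 1) x) atTop (𝓝 1) := by
  refine tendsto_const_nhds.congr' ?_
  filter_upwards [eventually_ge_atTop ⌈‖x‖⌉₊] with n hn
  refine (cutoff_eq_one (by positivity) ?_).symm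
  have : (⌈‖x‖⌉₊ : ℝ) ≤ n := by exact_mod_cast hn
  linarith [Nat.le_ceil ‖x‖]

lemma cutoff_kernel_bound (hγ : 0 ≤ γ) (hγ2 : γ ≤ 2) {R : ℝ} (hR : 1 ≤ R) (h : Ed d) :
    (1 + 2 * R + ‖h‖) ^ γ * min 1 (‖h‖ ^ 2 / R ^ 2) ≤ 4 ^ γ * jumpWeight γ h := by
  have hR0 : 0 < R := by linarith
  have hmin : 0 ≤ min 1 (‖h‖ ^ 2 / R ^ 2) := le_min zero_le_one (by positivity)
  rcases le_total ‖h‖ R with h1 | h1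
  · have hb : (1 + 2 * R + ‖h‖) ^ γ ≤ 4 ^ γ * R ^ γ := by
      rw [← Real.mul_rpow (by norm_num) hR0.le]
      exact Real.rpow_le_rpow (by positivity) (by linarith) hγ
    refine (mul_le_mul hb (min_le_right _ _) hmin (by positivity)).trans ?_
    rw [mul_assoc]
    refine mul_le_mul_of_nonneg_left ?_ (by positivity)
    have hR2 : R ^ γ ≤ R ^ 2 := by
      rw [← Real.rpow_natCast]
      exact Real.rpow_le_rpow_of_exponent_le hR (by exact_mod_cast hγ2)
    unfold jumpWeight
    split_ifs with h2
    · rw [mul_div_assoc', div_le_iff₀ (by positivity), mul_comm]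
      gcongr
    · have hh : 0 < ‖h‖ := by linarith [not_le.1 h2]
      have h3 : R ^ (γ - 2) ≤ ‖h‖ ^ (γ - 2) := Real.rpow_le_rpow_of_nonpos hh h1 (by linarith)
      rw [Real.rpow_sub hR0, Real.rpow_sub hh, Real.rpow_two, Real.rpow_two] at h3
      calc R ^ γ * (‖h‖ ^ 2 / R ^ 2) = R ^ γ / R ^ 2 * ‖h‖ ^ 2 := by ring
        _ ≤ ‖h‖ ^ γ / ‖h‖ ^ 2 * ‖h‖ ^ 2 := by gcongr
        _ = ‖h‖ ^ γ := by field_simp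
  · have hb : (1 + 2 * R + ‖h‖) ^ γ ≤ 4 ^ γ * ‖h‖ ^ γ := by
      rw [← Real.mul_rpow (by norm_num) (norm_nonneg _)]
      exact Real.rpow_le_rpow (by positivity) (by linarith) hγ
    refine (mul_le_mul hb (min_le_left _ _) hmin (by positivity)).trans ?_
    rw [mul_one]
    refine mul_le_mul_of_nonneg_left ?_ (by positivity)
    unfold jumpWeight
    split_ifs with h2
    · have : ‖h‖ = 1 := le_antisymm h2 (by linarith)
      simp [this]
    · exact le_rfl

lemma tendsto_cutoff_kernel (hs1 : s < 1) (hs : 0 < s) (hd : 0 < d) (hκ : 0 < κ) (hγ : 0 ≤ γ)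
    (hγs : γ < 2 * s) :
    Tendsto (fun n : ℕ => ∫⁻ h : Ed d, ENNReal.ofReal ((κ / 2) / ‖h‖ ^ ((d : ℝ) + 2 * s)) *
      ENNReal.ofReal ((1 + 2 * ((n : ℝ) + 1) + ‖h‖) ^ γ * min 1 (‖h‖ ^ 2 / ((n : ℝ) + 1) ^ 2)))
      atTop (𝓝 0) := by
  have hfin := lintegral_jumpWeight_lt_top hs hs1 hd hκ hγs
  rw [show (0 : ℝ≥0∞) = ∫⁻ _ : Ed d, 0 by simp]
  refine tendsto_lintegral_of_dominated_convergence (fun h => ENNReal.ofReal (4 ^ γ) *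
    (ENNReal.ofReal ((κ / 2) / ‖h‖ ^ ((d : ℝ) + 2 * s)) * ENNReal.ofReal (jumpWeight γ h)))
    (fun n => by fun_prop) (fun n => .of_forall fun h => ?_) ?_ (.of_forall fun h => ?_)
  · have := cutoff_kernel_bound hγ (by linarith) (R := (n : ℝ) + 1)
      (le_add_of_nonneg_left (Nat.cast_nonneg n)) h
    calc _ ≤ ENNReal.ofReal ((κ / 2) / ‖h‖ ^ ((d : ℝ) + 2 * s)) *
          ENNReal.ofReal (4 ^ γ * jumpWeight γ h) :=
          mul_le_mul' le_rfl (ENNReal.ofReal_le_ofReal this)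
      _ = _ := by
          rw [ENNReal.ofReal_mul (by positivity)]
          ring
  · rw [lintegral_const_mul' _ _ ENNReal.ofReal_ne_top]
    exact (ENNReal.mul_lt_top ENNReal.ofReal_lt_top hfin).ne
  · rw [show (0 : ℝ≥0∞) = ENNReal.ofReal ((κ / 2) / ‖h‖ ^ ((d : ℝ) + 2 * s)) * ENNReal.ofReal 0 by
      simp]
    refine ENNReal.Tendsto.const_mul ((ENNReal.continuous_ofReal.tendsto _).comp ?_)
      (.inr ENNReal.ofReal_ne_top)
    set A : ℝ := (3 + ‖h‖) ^ γ * ‖h‖ ^ 2 with hA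
    have hlim : Tendsto (fun n : ℕ => A * ((n : ℝ) + 1) ^ (γ - 2)) atTop (𝓝 (A * 0)) := by
      refine Tendsto.const_mul _ ?_
      have := (tendsto_rpow_neg_atTop (y := 2 - γ) (by linarith)).comp
        (tendsto_atTop_add_const_right _ (1 : ℝ) tendsto_natCast_atTop_atTop)
      refine this.congr fun n => ?_
      simp only [Function.comp, neg_sub]
    rw [mul_zero] at hlim
    refine squeeze_zero (fun n => mul_nonneg (by positivity)
      (le_min zero_le_one (by positivity))) (fun n => ?_) hlim
    have hn : (1 : ℝ) ≤ (n : ℝ) + 1 := le_add_of_nonneg_left (Nat.cast_nonneg n)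
    calc (1 + 2 * ((n : ℝ) + 1) + ‖h‖) ^ γ * min 1 (‖h‖ ^ 2 / ((n : ℝ) + 1) ^ 2)
        ≤ ((3 + ‖h‖) * ((n : ℝ) + 1)) ^ γ * (‖h‖ ^ 2 / ((n : ℝ) + 1) ^ 2) := by
          refine mul_le_mul (Real.rpow_le_rpow (by positivity) ?_ hγ) (min_le_right _ _)
            (le_min zero_le_one (by positivity)) (by positivity)
          nlinarith [norm_nonneg h]
      _ = A * ((n : ℝ) + 1) ^ (γ - 2) := by
          rw [Real.mul_rpow (by positivity) (by positivity), Real.rpow_sub (by positivity),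
            Real.rpow_two, hA]
          ring

lemma tendsto_energySq_cutoff (h : Setup d s κ γ c C ρ) {φ : Ed d → ℝ}
    (hφ : EnergyTest d s κ ρ φ) :
    Tendsto (fun n : ℕ => energySq d s κ (fun x => φ x - cutoff ((n : ℝ) + 1) x * φ x)) atTop
      (𝓝 0) := by
  obtain ⟨B, hB⟩ := hφ.bdd
  have hB0 : 0 ≤ B := (abs_nonneg _).trans (hB 0)
  set F : Ed d → ℝ≥0∞ := fun x => ENNReal.ofReal (φ x ^ 2 * (1 + ‖x‖) ^ (-γ)) with hF
  have hφm := hφ.measurable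
  have hFm : Measurable F := by fun_prop
  have hFfin : ∫⁻ x, F x < ⊤ := by
    have hi := ((integrable_weightMeasure_iff h.measurable h.pos φ).1 hφ.integrable).norm.const_mul
      (B / c)
    refine lt_of_le_of_lt (lintegral_mono_ae (h.lower.mono fun x hx => ?_))
      ((hasFiniteIntegral_iff_ofReal (.of_forall fun x => ?_)).1 hi.2)
    · refine ENNReal.ofReal_le_ofReal ?_
      have hc := h.c_pos
      have h1 : φ x ^ 2 ≤ B * |φ x| := by
        rw [← sq_abs, sq]
        exact mul_le_mul_of_nonneg_right (hB x) (abs_nonneg _)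
      have h2 : (1 + ‖x‖) ^ (-γ) ≤ ρ x / c := by
        rw [le_div_iff₀ hc]
        linarith
      calc φ x ^ 2 * (1 + ‖x‖) ^ (-γ) ≤ B * |φ x| * (ρ x / c) :=
            mul_le_mul h1 h2 (by positivity) (by positivity)
        _ = _ := by
            rw [Real.norm_eq_abs, abs_mul, abs_of_pos (h.pos x)]
            ring
    · have := h.c_pos
      positivity
  set g : ℕ → Ed d → ℝ≥0∞ := fun n z => ENNReal.ofReal ((1 + 2 * ((n : ℝ) + 1) + ‖z‖) ^ γ *
    min 1 (‖z‖ ^ 2 / ((n : ℝ) + 1) ^ 2)) with hg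
  have hgm : ∀ n, Measurable (g n) := fun n => by fun_prop
  have h2 : Tendsto (fun n => ∫⁻ p, F p.1 * g n (p.1 - p.2) ∂(jumpMeasure d s κ)) atTop (𝓝 0) := by
    simp only [lintegral_jumpMeasure_mul hFm (hgm _)]
    have := ENNReal.Tendsto.const_mul (tendsto_cutoff_kernel (d := d) (γ := γ) h.s_lt_one h.s_pos
      h.dim_pos h.κ_pos h.γ_nonneg h.γ_lt) (a := ∫⁻ x, F x) (.inr hFfin.ne)
    rwa [mul_zero] at this
  set G : ℕ → Ed d × Ed d → ℝ≥0∞ := fun n p =>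
    ENNReal.ofReal ((1 - cutoff ((n : ℝ) + 1) p.2) ^ 2 * incr φ p ^ 2) with hG
  have hGm : ∀ n, Measurable (G n) := fun n => by
    have h1 := (continuous_cutoff (d := d) ((n : ℝ) + 1)).measurable
    have h2 := hφm.incr
    exact (((measurable_const.sub (h1.comp measurable_snd)).pow_const 2).mul
      (h2.pow_const 2)).ennreal_ofReal
  have h1 : Tendsto (fun n => ∫⁻ p, G n p ∂(jumpMeasure d s κ)) atTop (𝓝 0) := by
    rw [show (0 : ℝ≥0∞) = ∫⁻ _ : Ed d × Ed d, 0 ∂(jumpMeasure d s κ) by simp]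
    refine tendsto_lintegral_of_dominated_convergence (fun p => ENNReal.ofReal (incr φ p ^ 2)) hGm
      (fun n => .of_forall fun p => ENNReal.ofReal_le_ofReal ?_)
      hφ.toFiniteEnergy.energySq_lt_top.ne (.of_forall fun p => ?_)
    · have h3 := cutoff_nonneg ((n : ℝ) + 1) p.2
      have h4 := cutoff_le_one ((n : ℝ) + 1) p.2
      exact mul_le_of_le_one_left (sq_nonneg _) (by nlinarith)
    · have := ((tendsto_const_nhds (x := (1 : ℝ))).sub (tendsto_cutoff p.2)).pow 2 |>.mul_const
        (incr φ p ^ 2)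
      have h5 := (ENNReal.continuous_ofReal.tendsto _).comp this
      rw [sub_self, zero_pow two_ne_zero, zero_mul, ENNReal.ofReal_zero] at h5
      exact h5
  have h12 := ENNReal.Tendsto.const_mul (a := 2) (h1.add h2) (.inr ENNReal.ofNat_ne_top)
  rw [add_zero, mul_zero] at h12
  refine tendsto_of_tendsto_of_tendsto_of_le_of_le tendsto_const_nhds h12 (fun n => zero_le)
    fun n => ?_
  simp only
  rw [← lintegral_add_left (hGm n), ← lintegral_const_mul' _ _ ENNReal.ofNat_ne_top]
  refine lintegral_mono fun p => ?_
  set R : ℝ := (n : ℝ) + 1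
  have hR : 0 < R := by positivity
  have hle : (cutoff R p.1 - cutoff R p.2) ^ 2 ≤ (1 + ‖p.1‖) ^ (-γ) *
      ((1 + 2 * R + ‖p.1 - p.2‖) ^ γ * min 1 (‖p.1 - p.2‖ ^ 2 / R ^ 2)) := by
    have hmin : 0 ≤ min 1 (‖p.1 - p.2‖ ^ 2 / R ^ 2) := le_min zero_le_one (by positivity)
    by_cases hfar : 2 * R ≤ ‖p.1‖ ∧ 2 * R ≤ ‖p.2‖
    · rw [cutoff_eq_zero hR hfar.1, cutoff_eq_zero hR hfar.2, sub_zero, zero_pow two_ne_zero]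
      positivity
    · have hn : 1 + ‖p.1‖ ≤ 1 + 2 * R + ‖p.1 - p.2‖ := by
        by_cases h1 : 2 * R ≤ ‖p.1‖
        · have h2 := not_le.1 fun h2 => hfar ⟨h1, h2⟩
          have := norm_sub_norm_le p.1 p.2
          linarith
        · have := norm_nonneg (p.1 - p.2)
          linarith [not_le.1 h1]
      have h1 : (1 + ‖p.1‖) ^ γ ≤ (1 + 2 * R + ‖p.1 - p.2‖) ^ γ :=
        Real.rpow_le_rpow (by positivity) hn h.γ_nonneg
      have h2 : 1 ≤ (1 + ‖p.1‖) ^ (-γ) * (1 + 2 * R + ‖p.1 - p.2‖) ^ γ := by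
        rw [Real.rpow_neg (by positivity), ← div_eq_inv_mul, one_le_div (by positivity)]
        exact h1
      calc _ ≤ min 1 (‖p.1 - p.2‖ ^ 2 / R ^ 2) := cutoff_sub_sq_le hR _ _
        _ ≤ (1 + ‖p.1‖) ^ (-γ) * (1 + 2 * R + ‖p.1 - p.2‖) ^ γ *
            min 1 (‖p.1 - p.2‖ ^ 2 / R ^ 2) := le_mul_of_one_le_left hmin h2
        _ = _ := by ring
  have hreal : incr (fun x => φ x - cutoff R x * φ x) p ^ 2 ≤
      2 * ((1 - cutoff R p.2) ^ 2 * incr φ p ^ 2 + φ p.1 ^ 2 * (1 + ‖p.1‖) ^ (-γ) *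
      ((1 + 2 * R + ‖p.1 - p.2‖) ^ γ * min 1 (‖p.1 - p.2‖ ^ 2 / R ^ 2))) := by
    have h3 := mul_le_mul_of_nonneg_left hle (sq_nonneg (φ p.1))
    have h4 : incr (fun x => φ x - cutoff R x * φ x) p =
        (1 - cutoff R p.2) * incr φ p - φ p.1 * (cutoff R p.1 - cutoff R p.2) := by
      simp only [incr]
      ring
    rw [h4]
    nlinarith [sq_nonneg ((1 - cutoff R p.2) * incr φ p + φ p.1 * (cutoff R p.1 - cutoff R p.2))]
  refine (ENNReal.ofReal_le_ofReal hreal).trans (le_of_eq ?_)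
  have hmin : 0 ≤ min 1 (‖p.1 - p.2‖ ^ 2 / R ^ 2) := le_min zero_le_one (by positivity)
  rw [ENNReal.ofReal_mul (by norm_num), ENNReal.ofReal_add (by positivity) (by positivity),
    ENNReal.ofReal_mul (p := φ p.1 ^ 2 * (1 + ‖p.1‖) ^ (-γ)) (by positivity), ENNReal.ofReal_ofNat]

lemma tendsto_integral_cutoff {φ : Ed d → ℝ}
    (hφ : EnergyTest d s κ ρ φ) :
    Tendsto (fun n : ℕ => ∫ x, |φ x - cutoff ((n : ℝ) + 1) x * φ x| ∂(weightMeasure ρ)) atTop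
      (𝓝 0) := by
  rw [show (0 : ℝ) = ∫ _ : Ed d, 0 ∂(weightMeasure ρ) by simp]
  have hφm := hφ.measurable
  refine tendsto_integral_of_dominated_convergence (fun x => ‖φ x‖) (fun n => ?_)
    hφ.integrable.norm (fun n => .of_forall fun x => ?_) (.of_forall fun x => ?_)
  · have := (continuous_cutoff (d := d) ((n : ℝ) + 1)).measurable
    exact (by fun_prop : Measurable _).aestronglyMeasurable
  · have h3 := cutoff_nonneg ((n : ℝ) + 1) x
    have h4 := cutoff_le_one ((n : ℝ) + 1) x
    rw [norm_abs_eq_norm, show φ x - cutoff ((n : ℝ) + 1) x * φ x =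
      (1 - cutoff ((n : ℝ) + 1) x) * φ x by ring, norm_mul]
    refine mul_le_of_le_one_left (norm_nonneg _) ?_
    rw [Real.norm_eq_abs, abs_le]
    constructor <;> linarith
  · have := ((tendsto_const_nhds (x := φ x)).sub ((tendsto_cutoff x).mul_const (φ x))).abs
    simpa using this

end Cutoff

/-! ### Mollification and density of smooth compactly supported functions -/

section Density

variable {d : ℕ} {s κ γ c C : ℝ} {ρ : Ed d → ℝ}

lemma tendsto_lintegral_sq_sub_of_le {α : Type*} [MeasurableSpace α] {μ : Measure α}
    {f : ℕ → α → ℝ} {g : α → ℝ} (hf : ∀ n, Measurable (f n)) (hg : Measurable g)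
    (hfin : ∫⁻ a, ENNReal.ofReal (g a ^ 2) ∂μ ≠ ⊤)
    (hle : ∀ n, ∫⁻ a, ENNReal.ofReal (f n a ^ 2) ∂μ ≤ ∫⁻ a, ENNReal.ofReal (g a ^ 2) ∂μ)
    (hlim : ∀ᵐ a ∂μ, Tendsto (fun n => f n a) atTop (𝓝 (g a))) :
    Tendsto (fun n => ∫⁻ a, ENNReal.ofReal ((g a - f n a) ^ 2) ∂μ) atTop (𝓝 0) := by
  set A := ∫⁻ a, ENNReal.ofReal (g a ^ 2) ∂μ
  set p : ℕ → ℝ≥0∞ := fun n => ∫⁻ a, ENNReal.ofReal ((g a + f n a) ^ 2) ∂μ with hp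
  set q : ℕ → ℝ≥0∞ := fun n => ∫⁻ a, ENNReal.ofReal ((g a - f n a) ^ 2) ∂μ with hq
  have hpq : ∀ n, p n + q n ≤ 4 * A := fun n => by
    have hm : Measurable fun a => ENNReal.ofReal ((g a + f n a) ^ 2) := by
      have := hf n
      fun_prop
    have hm2 : Measurable fun a => 2 * ENNReal.ofReal (g a ^ 2) := by fun_prop
    calc p n + q n = ∫⁻ a, (2 * ENNReal.ofReal (g a ^ 2) + 2 * ENNReal.ofReal (f n a ^ 2)) ∂μ := by
          rw [hp, hq]
          simp only
          rw [← lintegral_add_left hm]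
          refine lintegral_congr fun a => ?_
          rw [← ENNReal.ofReal_add (by positivity) (by positivity), ← ENNReal.ofReal_ofNat,
            ← ENNReal.ofReal_mul (by positivity), ← ENNReal.ofReal_mul (by positivity),
            ← ENNReal.ofReal_add (by positivity) (by positivity)]
          congr 1
          ring
      _ = 2 * A + 2 * ∫⁻ a, ENNReal.ofReal (f n a ^ 2) ∂μ := by
          rw [lintegral_add_left hm2, lintegral_const_mul' _ _ ENNReal.ofNat_ne_top,
            lintegral_const_mul' _ _ ENNReal.ofNat_ne_top]
      _ ≤ 2 * A + 2 * A := by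
          gcongr
          exact hle n
      _ = 4 * A := by ring
  have hA : 4 * A ≠ ⊤ := ENNReal.mul_ne_top ENNReal.ofNat_ne_top hfin
  have hlow : 4 * A ≤ liminf p atTop := by
    refine le_trans ?_ (lintegral_liminf_le fun n => ?_)
    · rw [← lintegral_const_mul' _ _ ENNReal.ofNat_ne_top]
      refine lintegral_mono_ae (hlim.mono fun a ha => ?_)
      have h1 : Tendsto (fun n => ENNReal.ofReal ((g a + f n a) ^ 2)) atTop
          (𝓝 (ENNReal.ofReal ((g a + g a) ^ 2))) :=
        (ENNReal.continuous_ofReal.tendsto _).comp ((ha.const_add _).pow 2)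
      rw [h1.liminf_eq, ← ENNReal.ofReal_ofNat, ← ENNReal.ofReal_mul (by positivity)]
      exact ENNReal.ofReal_le_ofReal (by nlinarith)
    · have := hf n
      fun_prop
  have hp' : Tendsto p atTop (𝓝 (4 * A)) :=
    tendsto_of_le_liminf_of_limsup_le hlow
      (limsup_le_of_le (h := .of_forall fun n => le_self_add.trans (hpq n)))
  have hs : Tendsto (fun n => 4 * A - p n) atTop (𝓝 0) := by
    have := ENNReal.Tendsto.sub (tendsto_const_nhds (x := 4 * A) (f := atTop)) hp' (.inl hA)
    rwa [tsub_self] at this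
  refine tendsto_of_tendsto_of_tendsto_of_le_of_le tendsto_const_nhds hs (fun n => zero_le)
    fun n => ?_
  refine ENNReal.le_sub_of_add_le_left ?_ (hpq n)
  exact ((le_self_add.trans (hpq n)).trans_lt hA.lt_top).ne

lemma sq_integral_mul_le {α : Type*} [MeasurableSpace α] {μ : Measure α} {β f : α → ℝ}
    (hβ0 : ∀ a, 0 ≤ β a) (hβ : Integrable β μ) (h1 : ∫ a, β a ∂μ = 1) (hf : Measurable f)
    {B : ℝ} (hB : ∀ a, |f a| ≤ B) :
    (∫ a, β a * f a ∂μ) ^ 2 ≤ ∫ a, β a * f a ^ 2 ∂μ := by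
  have i1 : Integrable (fun a => β a * f a) μ :=
    hβ.mul_bdd hf.aestronglyMeasurable (.of_forall hB)
  have i2 : Integrable (fun a => β a * f a ^ 2) μ :=
    hβ.mul_bdd (c := B ^ 2) (hf.pow_const 2).aestronglyMeasurable (.of_forall fun a => by
      rw [norm_pow]
      exact pow_le_pow_left₀ (norm_nonneg _) (hB a) 2)
  set m := ∫ a, β a * f a ∂μ with hm
  have h : 0 ≤ ∫ a, β a * (f a - m) ^ 2 ∂μ :=
    integral_nonneg fun a => mul_nonneg (hβ0 a) (sq_nonneg _)
  have h2 : ∫ a, β a * (f a - m) ^ 2 ∂μ = ∫ a, β a * f a ^ 2 ∂μ - 2 * m * m + m ^ 2 * 1 := by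
    have e : ∀ a, β a * (f a - m) ^ 2 = β a * f a ^ 2 - 2 * m * (β a * f a) + m ^ 2 * β a :=
      fun a => by ring
    have i3 : Integrable (fun a => β a * f a ^ 2 - 2 * m * (β a * f a)) μ :=
      i2.sub (i1.const_mul _)
    simp only [e]
    rw [integral_add i3 (hβ.const_mul _), integral_sub i2 (i1.const_mul _),
      integral_const_mul, integral_const_mul, h1]
  nlinarith

lemma lintegral_jumpMeasure_translate {G : Ed d × Ed d → ℝ≥0∞} (hG : Measurable G) (t : Ed d) :
    ∫⁻ p, G (p - (t, t)) ∂(jumpMeasure d s κ) = ∫⁻ p, G p ∂(jumpMeasure d s κ) := by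
  have hG' : Measurable fun p => G (p - (t, t)) := hG.comp (measurable_id.sub_const _)
  rw [lintegral_jumpMeasure hG', lintegral_jumpMeasure hG]
  have : (volume : Measure (Ed d × Ed d)).IsAddHaarMeasure :=
    Measure.prod.instIsAddHaarMeasure _ _
  rw [← lintegral_sub_right_eq_self (fun p : Ed d × Ed d =>
    ENNReal.ofReal ((κ / 2) / ‖p.1 - p.2‖ ^ ((d : ℝ) + 2 * s)) * G p) ((t, t) : Ed d × Ed d)]
  refine lintegral_congr fun p => ?_
  simp

/-- Averaging of a function against a density. -/
def mollify {d : ℕ} (β φ : Ed d → ℝ) (x : Ed d) : ℝ := ∫ t, β t * φ (x - t)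

lemma measurable_mollify {β φ : Ed d → ℝ} (hβ : Measurable β) (hφ : Measurable φ) :
    Measurable (mollify β φ) := by
  refine StronglyMeasurable.measurable ?_
  refine StronglyMeasurable.integral_prod_right (f := fun x t : Ed d => β t * φ (x - t)) ?_
  exact Measurable.stronglyMeasurable (by fun_prop)

lemma energySq_mollify_le {β φ : Ed d → ℝ} (hβm : Measurable β) (hβ0 : ∀ a, 0 ≤ β a)
    (hβ : Integrable β) (h1 : ∫ a, β a = 1) (hφ : Measurable φ) {B : ℝ} (hB : ∀ x, |φ x| ≤ B) :
    energySq d s κ (mollify β φ) ≤ energySq d s κ φ := by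
  have hφi := hφ.incr
  have hint : ∀ x, Integrable fun t => β t * φ (x - t) := fun x =>
    hβ.mul_bdd (hφ.comp (measurable_const.sub measurable_id)).aestronglyMeasurable
      (.of_forall fun t => hB _)
  have hB2 : ∀ p, |incr φ p| ≤ B + B := fun p =>
    (abs_sub _ _).trans (add_le_add (hB _) (hB _))
  have hpt : ∀ p, ENNReal.ofReal (incr (mollify β φ) p ^ 2) ≤
      ∫⁻ t, ENNReal.ofReal (β t) * ENNReal.ofReal (incr φ (p - (t, t)) ^ 2) := fun p => by
    have e : incr (mollify β φ) p = ∫ t, β t * incr φ (p - (t, t)) := by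
      simp only [incr, mollify]
      rw [← integral_sub (hint _) (hint _)]
      simp only [Prod.fst_sub, Prod.snd_sub, mul_sub]
    have hm : Measurable fun t : Ed d => incr φ (p - (t, t)) :=
      hφi.comp (measurable_const.sub (measurable_id.prodMk measurable_id))
    rw [e]
    refine (ENNReal.ofReal_le_ofReal (sq_integral_mul_le hβ0 hβ h1 hm fun t => hB2 _)).trans ?_
    rw [ofReal_integral_eq_lintegral_ofReal]
    · refine lintegral_mono fun t => ?_
      simp only
      rw [ENNReal.ofReal_mul (hβ0 t)]
    · exact hβ.mul_bdd (c := (B + B) ^ 2) (hm.pow_const 2).aestronglyMeasurable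
        (.of_forall fun a => by
          rw [norm_pow]
          exact pow_le_pow_left₀ (norm_nonneg _) (hB2 _) 2)
    · exact .of_forall fun t => mul_nonneg (hβ0 t) (sq_nonneg _)
  have hGm : Measurable fun p => ENNReal.ofReal (incr φ p ^ 2) := by fun_prop
  calc energySq d s κ (mollify β φ)
      ≤ ∫⁻ p, (∫⁻ t, ENNReal.ofReal (β t) * ENNReal.ofReal (incr φ (p - (t, t)) ^ 2))
        ∂(jumpMeasure d s κ) := lintegral_mono hpt
    _ = ∫⁻ t, (∫⁻ p, ENNReal.ofReal (β t) * ENNReal.ofReal (incr φ (p - (t, t)) ^ 2)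
        ∂(jumpMeasure d s κ)) := by
        refine lintegral_lintegral_swap (Measurable.aemeasurable ?_)
        refine Measurable.mul (by fun_prop) (hGm.comp ?_)
        exact measurable_fst.sub (measurable_snd.prodMk measurable_snd)
    _ = ∫⁻ t, ENNReal.ofReal (β t) * energySq d s κ φ := by
        refine lintegral_congr fun t => ?_
        rw [lintegral_const_mul' _ _ ENNReal.ofReal_ne_top, lintegral_jumpMeasure_translate hGm,
          energySq]
    _ = energySq d s κ φ := by
        rw [lintegral_mul_const _ hβm.ennreal_ofReal,
          ← ofReal_integral_eq_lintegral_ofReal hβ (.of_forall hβ0), h1]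
        simp

lemma exists_smooth_approx_of_support (h : Setup d s κ γ c C ρ) {φ : Ed d → ℝ}
    (hφ : EnergyTest d s κ ρ φ) {R : ℝ} (hR : ∀ x, R ≤ ‖x‖ → φ x = 0) {ε : ℝ≥0∞} (hε : 0 < ε) :
    ∃ η : Ed d → ℝ, ContDiff ℝ (⊤ : ℕ∞) η ∧ HasCompactSupport η ∧
      energySq d s κ (fun x => φ x - η x) < ε ∧
      ∫⁻ x, ENNReal.ofReal |φ x - η x| ∂(weightMeasure ρ) < ε := by
  obtain ⟨B, hB⟩ := hφ.bdd
  have hφm := hφ.measurable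
  have hloc : LocallyIntegrable φ := by
    refine (locallyIntegrable_const (μ := volume) B).mono hφm.aestronglyMeasurable
      (.of_forall fun x => ?_)
    exact (hB x).trans (le_abs_self B)
  let b : ℕ → ContDiffBump (0 : Ed d) := fun n =>
    ⟨1 / ((n : ℝ) + 2), 1 / ((n : ℝ) + 1), by positivity,
      one_div_lt_one_div_of_lt (by positivity) (by linarith)⟩
  have hb1 : ∀ n, (b n).rOut ≤ 1 := fun n => by
    change 1 / ((n : ℝ) + 1) ≤ 1
    rw [div_le_one (by positivity)]
    linarith [(Nat.cast_nonneg n : (0 : ℝ) ≤ n)]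
  let β : ℕ → Ed d → ℝ := fun n => (b n).normed volume
  have hβc : ∀ n, Continuous (β n) := fun n => (b n).continuous_normed
  have hconv : ∀ n, mollify (β n) φ =
      MeasureTheory.convolution (β n) φ (ContinuousLinearMap.lsmul ℝ ℝ) volume := fun n => by
    ext x
    simp only [mollify, MeasureTheory.convolution, ContinuousLinearMap.lsmul_apply, smul_eq_mul]
  have hlim : ∀ᵐ x, Tendsto (fun n => mollify (β n) φ x) atTop (𝓝 (φ x)) := by
    simp only [hconv]
    refine ContDiffBump.ae_convolution_tendsto_right_of_locallyIntegrable (K := 2) ?_ ?_ hloc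
    · exact tendsto_one_div_add_atTop_nhds_zero_nat
    · refine .of_forall fun n => ?_
      change 1 / ((n : ℝ) + 1) ≤ 2 * (1 / ((n : ℝ) + 2))
      rw [← mul_div_assoc, mul_one, div_le_div_iff₀ (by positivity) (by positivity)]
      linarith [(Nat.cast_nonneg n : (0 : ℝ) ≤ n)]
  have hmm : ∀ n, Measurable (mollify (β n) φ) := fun n =>
    measurable_mollify (hβc n).measurable hφm
  have hE : Tendsto (fun n => energySq d s κ (fun x => φ x - mollify (β n) φ x)) atTop (𝓝 0) := by
    have := tendsto_lintegral_sq_sub_of_le (μ := jumpMeasure d s κ) (fun n => (hmm n).incr)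
      hφm.incr hφ.toFiniteEnergy.energySq_lt_top.ne
      (fun n => energySq_mollify_le (hβc n).measurable (b n).nonneg_normed (b n).integrable_normed
        (b n).integral_normed hφm hB) ?_
    · refine this.congr fun n => ?_
      refine lintegral_congr fun p => ?_
      simp only [incr]
      congr 2
      ring
    · refine jumpMeasure_absolutelyContinuous.ae_le ?_
      filter_upwards [Measure.quasiMeasurePreserving_fst.ae hlim,
        Measure.quasiMeasurePreserving_snd.ae hlim] with p h1 h2
      exact h1.sub h2
  have hsupp : ∀ n x, R + 1 ≤ ‖x‖ → mollify (β n) φ x = 0 := fun n x hx => by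
    rw [mollify, integral_eq_zero_of_ae (.of_forall fun t => ?_)]
    by_cases ht : t ∈ Function.support (β n)
    · have h1 : ‖t‖ < 1 := by
        rw [show Function.support (β n) = _ from (b n).support_normed_eq] at ht
        exact (mem_ball_zero_iff.1 ht).trans_le (hb1 n)
      have h2 := norm_sub_norm_le x t
      simp only [Pi.zero_apply]
      rw [hR _ (by linarith), mul_zero]
    · simp only [Pi.zero_apply]
      rw [Function.notMem_support.1 ht, zero_mul]
  have hbd : ∀ n x, |mollify (β n) φ x| ≤ B := fun n x => by
    refine (norm_integral_le_integral_norm (fun t => β n t * φ (x - t))).trans ?_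
    calc ∫ t, ‖β n t * φ (x - t)‖ ≤ ∫ t, β n t * B := by
          refine integral_mono_of_nonneg (.of_forall fun t => norm_nonneg _)
            (((b n).integrable_normed (μ := volume)).mul_const B) (.of_forall fun t => ?_)
          simp only
          rw [norm_mul, Real.norm_of_nonneg ((b n).nonneg_normed t)]
          exact mul_le_mul_of_nonneg_left (hB _) ((b n).nonneg_normed t)
      _ = B := by rw [integral_mul_const, (b n).integral_normed (μ := volume), one_mul]
  have hL : Tendsto (fun n => ∫⁻ x, ENNReal.ofReal |φ x - mollify (β n) φ x| ∂(weightMeasure ρ))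
      atTop (𝓝 0) := by
    rw [show (0 : ℝ≥0∞) = ∫⁻ _ : Ed d, 0 ∂(weightMeasure ρ) by simp]
    refine tendsto_lintegral_of_dominated_convergence
      ((Metric.ball (0 : Ed d) (R + 1)).indicator fun _ => ENNReal.ofReal (B + B))
      (fun n => ?_) (fun n => .of_forall fun x => ?_) ?_ ?_
    · exact (measurable_norm.comp (hφm.sub (hmm n))).ennreal_ofReal
    · by_cases hx : x ∈ Metric.ball (0 : Ed d) (R + 1)
      · rw [indicator_of_mem hx]
        exact ENNReal.ofReal_le_ofReal ((abs_sub _ _).trans (add_le_add (hB x) (hbd n x)))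
      · rw [mem_ball_zero_iff, not_lt] at hx
        simp only [hsupp n x hx, hR x (by linarith), sub_zero, abs_zero, ENNReal.ofReal_zero,
          zero_le]
    · rw [lintegral_indicator Metric.isOpen_ball.measurableSet, setLIntegral_const]
      exact ENNReal.mul_ne_top ENNReal.ofReal_ne_top (h.locallyFinite _).ne
    · refine (weightMeasure_absolutelyContinuous ρ).ae_le (hlim.mono fun x hx => ?_)
      have := (ENNReal.continuous_ofReal.tendsto _).comp ((hx.const_sub (φ x)).abs)
      rw [sub_self, abs_zero, ENNReal.ofReal_zero] at this
      exact this
  obtain ⟨n, hn1, hn2⟩ := ((hE.eventually_lt_const hε).and (hL.eventually_lt_const hε)).exists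
  refine ⟨mollify (β n) φ, ?_, ?_, hn1, hn2⟩
  · rw [hconv]
    exact (b n).hasCompactSupport_normed.contDiff_convolution_left _ (b n).contDiff_normed hloc
  · refine HasCompactSupport.intro (isCompact_closedBall (0 : Ed d) (R + 1)) fun x hx => ?_
    rw [mem_closedBall_zero_iff, not_le] at hx
    exact hsupp n x hx.le

lemma energySq_sub_le {u v w : Ed d → ℝ} (hu : Measurable u) (hv : Measurable v) :
    energySq d s κ (fun x => u x - w x) ≤
      2 * energySq d s κ (fun x => u x - v x) + 2 * energySq d s κ (fun x => v x - w x) := by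
  have h2 : Measurable (incr fun x => u x - v x) := (hu.sub hv).incr
  simp only [energySq]
  rw [← lintegral_const_mul' _ _ ENNReal.ofNat_ne_top, ← lintegral_const_mul' _ _
    ENNReal.ofNat_ne_top, ← lintegral_add_left (by fun_prop)]
  refine lintegral_mono fun p => ?_
  rw [← ENNReal.ofReal_ofNat, ← ENNReal.ofReal_mul (by positivity),
    ← ENNReal.ofReal_mul (by positivity), ← ENNReal.ofReal_add (by positivity) (by positivity)]
  refine ENNReal.ofReal_le_ofReal ?_
  have : incr (fun x => u x - w x) p =
      incr (fun x => u x - v x) p + incr (fun x => v x - w x) p := by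
    simp only [incr]
    ring
  rw [this]
  nlinarith [sq_nonneg (incr (fun x => u x - v x) p - incr (fun x => v x - w x) p)]

lemma EnergyTest.cutoff_mul (h : Setup d s κ γ c C ρ) {φ : Ed d → ℝ}
    (hφ : EnergyTest d s κ ρ φ) :
    ∀ᶠ n : ℕ in atTop, EnergyTest d s κ ρ (fun x => cutoff ((n : ℝ) + 1) x * φ x) := by
  obtain ⟨B, hB⟩ := hφ.bdd
  have hle : ∀ (n : ℕ) x, |cutoff ((n : ℝ) + 1) x * φ x| ≤ |φ x| := fun n x => by
    rw [abs_mul, abs_of_nonneg (cutoff_nonneg _ _)]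
    exact mul_le_of_le_one_left (abs_nonneg _) (cutoff_le_one _ _)
  have hm : ∀ n : ℕ, Measurable (fun x => cutoff ((n : ℝ) + 1) x * φ x) := fun n =>
    (continuous_cutoff _).measurable.mul hφ.measurable
  filter_upwards [(tendsto_energySq_cutoff h hφ).eventually_lt_const zero_lt_one] with n hn
  have h1 := finiteEnergy_of_energySq_lt_top (hφ.measurable.sub (hm n))
    (hn.trans ENNReal.one_lt_top)
  have h2 := hφ.toFiniteEnergy.sub h1
  refine ⟨?_, ⟨B, fun x => (hle n x).trans (hB x)⟩, ?_⟩
  · convert h2 using 2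
    simp
  · exact hφ.integrable.mono (hm n).aestronglyMeasurable (.of_forall fun x => hle n x)

/-- Smooth compactly supported functions are dense among energy test functions. -/
lemma exists_smooth_approx (h : Setup d s κ γ c C ρ) {φ : Ed d → ℝ}
    (hφ : EnergyTest d s κ ρ φ) {ε : ℝ≥0∞} (hε : 0 < ε) :
    ∃ η : Ed d → ℝ, ContDiff ℝ (⊤ : ℕ∞) η ∧ HasCompactSupport η ∧
      energySq d s κ (fun x => φ x - η x) < ε ∧
      ∫⁻ x, ENNReal.ofReal |φ x - η x| ∂(weightMeasure ρ) < ε := by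
  have h4 : 0 < ε / 4 := ENNReal.div_pos hε.ne' ENNReal.ofNat_ne_top
  have hI : Tendsto (fun n : ℕ => ∫⁻ x, ENNReal.ofReal |φ x - cutoff ((n : ℝ) + 1) x * φ x|
      ∂(weightMeasure ρ)) atTop (𝓝 0) := by
    have := (ENNReal.continuous_ofReal.tendsto _).comp (tendsto_integral_cutoff hφ)
    rw [ENNReal.ofReal_zero] at this
    refine this.congr' ?_
    filter_upwards [hφ.cutoff_mul h] with n hn
    simp only [Function.comp_apply]
    exact ofReal_integral_eq_lintegral_ofReal (hφ.integrable.sub hn.integrable).abs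
      (.of_forall fun x => abs_nonneg _)
  obtain ⟨n, ⟨hn1, hn2⟩, hn3⟩ := (((tendsto_energySq_cutoff h hφ).eventually_lt_const h4).and
    (hI.eventually_lt_const h4)).and (hφ.cutoff_mul h) |>.exists
  obtain ⟨η, h1, h2, h3, h5⟩ := exists_smooth_approx_of_support h hn3 (R := 2 * ((n : ℝ) + 1))
    (fun x hx => by rw [cutoff_eq_zero (by positivity) hx, zero_mul]) h4
  refine ⟨η, h1, h2, ?_, ?_⟩
  · refine (energySq_sub_le hφ.measurable hn3.measurable).trans_lt ?_
    calc _ < 2 * (ε / 4) + 2 * (ε / 4) := by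
          refine ENNReal.add_lt_add ?_ ?_ <;>
          refine (ENNReal.mul_lt_mul_iff_right ?_ ?_).2 ?_ <;> first | assumption | simp
      _ = ε := by
          rw [← two_mul, ← mul_assoc, show (2 : ℝ≥0∞) * 2 = 4 by norm_num]
          exact ENNReal.mul_div_cancel (by simp) (by simp)
  · calc _ ≤ ∫⁻ x, (ENNReal.ofReal |φ x - cutoff ((n : ℝ) + 1) x * φ x| +
          ENNReal.ofReal |cutoff ((n : ℝ) + 1) x * φ x - η x|) ∂(weightMeasure ρ) := by
          refine lintegral_mono fun x => ?_
          rw [← ENNReal.ofReal_add (abs_nonneg _) (abs_nonneg _)]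
          exact ENNReal.ofReal_le_ofReal (abs_sub_le _ _ _)
      _ < ε / 4 + ε / 4 := by
          have hm : Measurable fun x => ENNReal.ofReal |φ x - cutoff ((n : ℝ) + 1) x * φ x| :=
            (measurable_norm.comp (hφ.measurable.sub hn3.measurable)).ennreal_ofReal
          rw [lintegral_add_left hm]
          exact ENNReal.add_lt_add hn2 h5
      _ ≤ ε := by
          rw [← two_mul, ← mul_div_assoc]
          refine ENNReal.div_le_of_le_mul ?_
          rw [mul_comm]
          gcongr
          norm_num

end Density

/-! ### Normalised potentials of bounded integrable densities -/

section Potentials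

variable {d : ℕ} {s κ γ c C : ℝ} {ρ : Ed d → ℝ}

lemma energyTest_of_contDiff (h : Setup d s κ γ c C ρ) {η : Ed d → ℝ}
    (hη : ContDiff ℝ (⊤ : ℕ∞) η) (hc : HasCompactSupport η) : EnergyTest d s κ ρ η := by
  have hfe := finiteEnergy_of_contDiff h.s_pos h.s_lt_one h.dim_pos h.κ_pos
    (hη.of_le (by exact_mod_cast le_top)) hc
  obtain ⟨B, hB⟩ := hη.continuous.bounded_above_of_compact_support hc
  obtain ⟨R, hR⟩ := hc.isCompact.isBounded.subset_ball 0
  refine ⟨hfe, ⟨B, hB⟩, ?_⟩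
  have h1 : IntegrableOn η (Metric.ball 0 R) (weightMeasure ρ) :=
    Measure.integrableOn_of_bounded (M := B) (h.locallyFinite R).ne
      hη.continuous.aestronglyMeasurable (.of_forall hB)
  exact (integrableOn_iff_integrable_of_support_subset ((subset_tsupport η).trans hR)).1 h1

/-- Identities against smooth test functions extend to all energy test functions. -/
lemma energy_eq_of_smooth (h : Setup d s κ γ c C ρ) {V g : Ed d → ℝ}
    (hV : FiniteEnergy d s κ V) (hg : Measurable g) {B : ℝ} (hB : ∀ x, |g x| ≤ B)
    (hid : ∀ η : Ed d → ℝ, ContDiff ℝ (⊤ : ℕ∞) η → HasCompactSupport η →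
      energy d s κ V η = ∫ x, g x * η x ∂(weightMeasure ρ))
    {φ : Ed d → ℝ} (hφ : EnergyTest d s κ ρ φ) :
    energy d s κ V φ = ∫ x, g x * φ x ∂(weightMeasure ρ) := by
  have hgi : ∀ {ψ : Ed d → ℝ}, Integrable ψ (weightMeasure ρ) →
      Integrable (fun x => g x * ψ x) (weightMeasure ρ) := fun hψ =>
    hψ.bdd_mul hg.aestronglyMeasurable (.of_forall hB)
  have hB0 : 0 ≤ B := (abs_nonneg _).trans (hB 0)
  have key : ∀ ε : ℝ, 0 < ε → |energy d s κ V φ - ∫ x, g x * φ x ∂(weightMeasure ρ)| ≤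
      √(energy d s κ V V * ε) + B * ε := by
    intro ε hε
    obtain ⟨η, h1, h2, h3, h4⟩ := exists_smooth_approx h hφ (ENNReal.ofReal_pos.2 hε)
    have hη := energyTest_of_contDiff h h1 h2
    have hsub := hφ.sub hη
    rw [← hsub.toFiniteEnergy.ofReal_energy, ENNReal.ofReal_lt_ofReal_iff hε] at h3
    rw [← ofReal_integral_eq_lintegral_ofReal hsub.integrable.abs
      (.of_forall fun x => abs_nonneg _), ENNReal.ofReal_lt_ofReal_iff hε] at h4
    have e : energy d s κ V φ - ∫ x, g x * φ x ∂(weightMeasure ρ) =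
        energy d s κ V (fun x => φ x - η x) - ∫ x, g x * (φ x - η x) ∂(weightMeasure ρ) := by
      rw [energy_sub_right hφ.toFiniteEnergy hη.toFiniteEnergy hV, hid η h1 h2]
      simp only [mul_sub]
      rw [integral_sub (hgi hφ.integrable) (hgi hη.integrable)]
      ring
    rw [e]
    refine (abs_sub _ _).trans (add_le_add ?_ ?_)
    · refine Real.abs_le_sqrt ((energy_sq_le hV hsub.toFiniteEnergy).trans ?_)
      exact mul_le_mul_of_nonneg_left h3.le (energy_self_nonneg V)
    · calc |∫ x, g x * (φ x - η x) ∂(weightMeasure ρ)|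
          ≤ ∫ x, B * |φ x - η x| ∂(weightMeasure ρ) := by
            refine norm_integral_le_of_norm_le (f := fun x => g x * (φ x - η x))
              (hsub.integrable.abs.const_mul B)
              (.of_forall fun x => ?_)
            rw [norm_mul]
            exact mul_le_mul_of_nonneg_right (hB x) (abs_nonneg _)
        _ ≤ B * ε := by
            rw [integral_const_mul]
            exact mul_le_mul_of_nonneg_left h4.le hB0
  have hlim : Tendsto (fun n : ℕ => √(energy d s κ V V * (1 / ((n : ℝ) + 1))) +
      B * (1 / ((n : ℝ) + 1))) atTop (𝓝 0) := by
    have h0 := tendsto_one_div_add_atTop_nhds_zero_nat (𝕜 := ℝ)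
    have h1 := (Real.continuous_sqrt.tendsto _).comp (h0.const_mul (energy d s κ V V))
    have h2 := h1.add (h0.const_mul B)
    simpa using h2
  have h0 := ge_of_tendsto' hlim fun n : ℕ => key (1 / ((n : ℝ) + 1)) (by positivity)
  exact sub_eq_zero.1 (abs_eq_zero.1 (le_antisymm h0 (abs_nonneg _)))

/-- Nonnegative bounded functions that are integrable for the weighted measure. -/
structure IsSource {d : ℕ} (ρ f : Ed d → ℝ) : Prop where
  measurable : Measurable f
  nonneg : ∀ x, 0 ≤ f x
  bdd : ∃ B, ∀ x, f x ≤ B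
  integrable : Integrable f (weightMeasure ρ)

/-- `U` is the potential of the density `f ρ`. -/
structure IsPotential (d : ℕ) (s κ : ℝ) (ρ f U : Ed d → ℝ) : Prop
    extends EnergyDecaying d s κ ρ U where
  continuous : Continuous U
  nonneg : ∀ x, 0 ≤ U x
  tendsto_zero : Tendsto U (cocompact (Ed d)) (𝓝 0)
  energy_eq : ∀ φ, EnergyTest d s κ ρ φ → energy d s κ U φ = ∫ x, f x * φ x ∂(weightMeasure ρ)
  ofReal_eq : ∀ x, ENNReal.ofReal (U x) = ENNReal.ofReal (1 / potConst d s κ) *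
    ∫⁻ y, rieszKernel s (x - y) * ENNReal.ofReal (f y) ∂(weightMeasure ρ)
  average_le : ∀ r : ℝ, 0 < r → ∀ x, ENNReal.ofReal (s * r ^ s) *
    ∫⁻ y, truncKernel s r (x - y) * ENNReal.ofReal (U y) ≤ ENNReal.ofReal (U x)

lemma exists_isPotential (h : Setup d s κ γ c C ρ) {f : Ed d → ℝ} (hf : IsSource ρ f) :
    ∃ U, IsPotential d s κ ρ f U := by
  obtain ⟨B, hB⟩ := hf.bdd
  have hfm := hf.measurable
  have hρm := h.measurable
  have hB0 : 0 ≤ B := (hf.nonneg 0).trans (hB 0)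
  have hs := h.s_pos
  have hs1 := h.s_lt_one
  have hκ := h.κ_pos
  have hd0 := h.dim_pos
  have hP := potConst_pos (d := d) hs hs1 hκ
  set N : ℝ := 1 / potConst d s κ with hN
  have hN0 : 0 < N := by positivity
  set K : ℝ := subordConst d ((d : ℝ) / 2 - s) with hK
  have hK0 : 0 < K := subordConst_pos (by linarith [h.lt_dim])
  set g : Ed d → ℝ := fun y => K * (N * f y) * ρ y with hg
  have hgm : Measurable g := by fun_prop
  have hg0 : ∀ y, 0 ≤ g y := fun y => by
    have := hf.nonneg y
    have := h.pos y
    positivity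
  have hgi : Integrable g := by
    have := ((integrable_weightMeasure_iff h.measurable h.pos f).1 hf.integrable).const_mul (K * N)
    refine this.congr (.of_forall fun x => ?_)
    simp only [hg]
    ring
  have hgM : ∀ᵐ y, g y ≤ (K * (N * B) * C) * ‖y‖ ^ (-γ) := h.upper.mono fun y hy => by
    have h1 : K * (N * f y) ≤ K * (N * B) := by
      have := hB y
      gcongr
    calc g y ≤ K * (N * B) * (C * ‖y‖ ^ (-γ)) :=
          mul_le_mul h1 hy (h.pos y).le (by positivity)
      _ = _ := by ring
  set a : ℝ := (d : ℝ) - 2 * s with ha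
  have ha0 : 0 < a := by linarith [h.lt_dim]
  have haγ : a + γ < d := by linarith [h.γ_lt]
  set U : Ed d → ℝ := fun x => ∫ y, ‖x - y‖ ^ (-a) * g y with hU
  have hUc : Continuous U := continuous_potential hd0 ha0 h.γ_nonneg haγ hgi hg0 hgM
  have hUlim : Tendsto U (cocompact (Ed d)) (𝓝 0) :=
    tendsto_potential_cocompact hd0 ha0 h.γ_nonneg haγ hgi hg0 hgM
  have hU0 : ∀ x, 0 ≤ U x := fun x => integral_nonneg fun y => by
    have := hg0 y
    positivity
  have hmker : ∀ x : Ed d, Measurable fun y => rieszKernel s (x - y) := fun x =>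
    measurable_rieszKernel.comp (measurable_const.sub measurable_id)
  have hform : ∀ x, ENNReal.ofReal (U x) = ENNReal.ofReal N *
      ∫⁻ y, rieszKernel s (x - y) * ENNReal.ofReal (f y) ∂(weightMeasure ρ) := fun x => by
    have hm : Measurable fun y => rieszKernel s (x - y) * ENNReal.ofReal (f y) :=
      (hmker x).mul hfm.ennreal_ofReal
    rw [weightMeasure, lintegral_withDensity_eq_lintegral_mul _ hρm.ennreal_ofReal hm,
      ← lintegral_const_mul' _ _ ENNReal.ofReal_ne_top,
      hU, ofReal_integral_eq_lintegral_ofReal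
        (integrable_norm_sub_rpow_mul hd0 ha0 h.γ_nonneg haγ hgi hg0 hgM x)
        (.of_forall fun y => by
          have := hg0 y
          simp only [Pi.zero_apply]
          positivity)]
    refine lintegral_congr_ae ((ae_ne_of_pos hd0 x).mono fun y hy => ?_)
    simp only [Pi.mul_apply]
    rw [rieszKernel_eq h.lt_dim (sub_ne_zero.2 hy.symm), ← ENNReal.ofReal_mul (by positivity),
      ← ENNReal.ofReal_mul (h.pos y).le, ← ENNReal.ofReal_mul hN0.le]
    congr 1
    simp only [hg, hK]
    ring
  obtain ⟨A, hA⟩ : ∃ A, ∀ x, U x ≤ A := by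
    obtain ⟨S, hS, hS2⟩ := mem_cocompact.1 (hUlim.eventually_lt_const zero_lt_one)
    obtain ⟨A, hA⟩ := hS.bddAbove_image hUc.continuousOn
    refine ⟨max 1 A, fun x => ?_⟩
    by_cases hx : x ∈ S
    · exact (hA ⟨x, hx, rfl⟩).trans (le_max_right _ _)
    · exact (show U x < 1 from hS2 hx).le.trans (le_max_left _ _)
  set η : Measure (Ed d) := (weightMeasure ρ).withDensity fun y => ENNReal.ofReal (N * f y) with hη
  have hηm : Measurable fun y => ENNReal.ofReal (N * f y) := by fun_prop
  have hfin : IsFiniteMeasure η :=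
    isFiniteMeasure_withDensity_ofReal (hf.integrable.const_mul N).2
  have hpot : ∀ x, ENNReal.ofReal (U x) = rieszPot s η x := fun x => by
    rw [hform, rieszPot, hη, lintegral_withDensity_eq_lintegral_mul _ hηm (hmker x),
      ← lintegral_const_mul' _ _ ENNReal.ofReal_ne_top]
    refine lintegral_congr fun y => ?_
    simp only [Pi.mul_apply]
    rw [ENNReal.ofReal_mul hN0.le]
    ring
  have hUfe := potential_finiteEnergy hs hs1 hκ hpot hUc hU0 hA hUlim
  refine ⟨U, ⟨⟨hUfe, ⟨A, fun x => by rw [abs_of_nonneg (hU0 x)]; exact hA x⟩, fun ε hε => ?_⟩,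
    hUc, hU0, hUlim, fun φ hφ => ?_, hform, fun r hr x => ?_⟩⟩
  · have h1 : ∀ᶠ x in cocompact (Ed d), U x < ε := hUlim.eventually_lt_const hε
    obtain ⟨S, hS, hS2⟩ := mem_cocompact.1 h1
    obtain ⟨R, hR⟩ := hS.isBounded.subset_ball 0
    refine (measure_mono fun x hx => hR ?_).trans_lt (h.locallyFinite R)
    by_contra hcon
    have h2 : U x < ε := hS2 hcon
    simp only [mem_ofPred_eq, abs_of_nonneg (hU0 x)] at hx
    linarith
  · refine energy_eq_of_smooth h hUfe hfm (B := B)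
      (fun x => by rw [abs_of_nonneg (hf.nonneg x)]; exact hB x) (fun ζ h1 h2 => ?_) hφ
    have hζ := energyTest_of_contDiff h h1 h2
    obtain ⟨M, hM⟩ := hζ.bdd
    rw [potential_energy hs hs1 hκ hpot hUfe hU0 hA hζ.toFiniteEnergy h1.continuous
      (h1.continuous.integrable_of_hasCompactSupport h2) hM, hη,
      integral_withDensity_eq_integral_toReal_smul hηm (by simp), ← integral_const_mul]
    refine integral_congr_ae (.of_forall fun x => ?_)
    simp only [smul_eq_mul]
    rw [ENNReal.toReal_ofReal (by have := hf.nonneg x; positivity), hN]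
    field_simp
  · have h1 := lintegral_truncKernel_mul_rieszPot hs hr η x
    simp only [← hpot] at h1
    have h2 : ∫⁻ y, truncKernel s r (x - y) * ENNReal.ofReal (U y) ≤
        ENNReal.ofReal (r ^ (-s) / s) * ENNReal.ofReal (U x) := h1 ▸ le_self_add
    refine (mul_le_mul' le_rfl h2).trans (le_of_eq ?_)
    rw [← mul_assoc, ← ENNReal.ofReal_mul (by positivity), Real.rpow_neg hr.le]
    have : 0 < r ^ s := Real.rpow_pos_of_pos hr s
    rw [show s * r ^ s * ((r ^ s)⁻¹ / s) = 1 by field_simp]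
    simp

end Potentials

/-! ### Minimisation of convex perturbations of the energy -/

section Minimisation

variable {d : ℕ} {s κ : ℝ}

lemma measurable_energySq_integrand {v : Ed d → ℝ} (hv : Measurable v) :
    Measurable fun p => ENNReal.ofReal (incr v p ^ 2) :=
  (hv.incr.pow_const 2).ennreal_ofReal

lemma energySq_parallelogram {a b : Ed d → ℝ} (ha : Measurable a) (hb : Measurable b) :
    4 * energySq d s κ (fun x => (a x + b x) / 2) + energySq d s κ (fun x => a x - b x) =
      2 * energySq d s κ a + 2 * energySq d s κ b := by
  have h1 := measurable_energySq_integrand ha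
  have h2 := measurable_energySq_integrand hb
  have h3 := measurable_energySq_integrand (v := fun x => (a x + b x) / 2) (by fun_prop)
  have h4 := measurable_energySq_integrand (v := fun x => a x - b x) (by fun_prop)
  have e4 : (4 : ℝ≥0∞) = ENNReal.ofReal 4 := by simp
  have e2 : (2 : ℝ≥0∞) = ENNReal.ofReal 2 := by simp
  simp only [energySq]
  rw [← lintegral_const_mul _ h1, ← lintegral_const_mul _ h2, ← lintegral_const_mul _ h3,
    ← lintegral_add_left (h3.const_mul _), ← lintegral_add_left (h1.const_mul _)]
  refine lintegral_congr fun p => ?_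
  rw [e4, e2, ← ENNReal.ofReal_mul (by norm_num), ← ENNReal.ofReal_mul (by norm_num),
    ← ENNReal.ofReal_mul (by norm_num), ← ENNReal.ofReal_add (by positivity) (by positivity),
    ← ENNReal.ofReal_add (by positivity) (by positivity)]
  congr 1
  simp only [incr]
  ring

lemma eLpNorm_incr_lt {v : Ed d → ℝ} {b : ℝ≥0}
    (h : energySq d s κ v < (b : ℝ≥0∞) ^ 2) :
    eLpNorm (incr v) 2 (jumpMeasure d s κ) < b := by
  have e : eLpNorm (incr v) 2 (jumpMeasure d s κ) ^ 2 = energySq d s κ v := by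
    rw [eLpNorm_eq_lintegral_rpow_enorm_toReal (by norm_num) (by norm_num), ← ENNReal.rpow_natCast,
      ← ENNReal.rpow_mul]
    norm_num
    refine lintegral_congr fun p => ?_
    rw [← ofReal_norm, ← ENNReal.ofReal_pow (norm_nonneg _), Real.norm_eq_abs, sq_abs]
  rw [← e] at h
  by_contra! hcon
  exact absurd h (not_lt.2 (pow_le_pow_left' hcon 2))

lemma liminf_add_liminf_le (a b : ℕ → ℝ≥0∞) :
    liminf a atTop + liminf b atTop ≤ liminf (fun n => a n + b n) atTop := by
  simp only [liminf_eq_iSup_iInf_of_nat']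
  refine ENNReal.iSup_add_iSup_le fun i j => le_iSup_of_le (i + j) (le_iInf fun k => ?_)
  refine add_le_add ((iInf_le _ (k + j)).trans_eq ?_) ((iInf_le _ (k + i)).trans_eq ?_)
  · congr 1; ring
  · congr 1; ring

/-- A bounded sequence whose increments converge almost everywhere has an almost everywhere
convergent subsequence. -/
lemma exists_subseq_tendsto_of_incr (hd : 0 < d) (hκ : 0 < κ) {A : ℝ} {v : ℕ → Ed d → ℝ}
    (h01 : ∀ n x, v n x ∈ Icc 0 A)
    (h : ∀ᵐ p ∂(jumpMeasure d s κ), ∃ l, Tendsto (fun n => incr (v n) p) atTop (𝓝 l)) :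
    ∃ σ : ℕ → ℕ, StrictMono σ ∧
      ∀ᵐ x : Ed d, ∃ l, Tendsto (fun n => v (σ n) x) atTop (𝓝 l) := by
  rw [jumpMeasure, ae_withDensity_iff measurable_jumpDensity] at h
  have h' := Measure.ae_ae_of_ae_prod (μ := (volume : Measure (Ed d)))
    (ν := (volume : Measure (Ed d))) h
  obtain ⟨x, hx⟩ := h'.exists
  obtain ⟨l, -, σ, hσ, hl⟩ := isCompact_Icc.tendsto_subseq (fun n => h01 n x)
  refine ⟨σ, hσ, ?_⟩
  filter_upwards [hx, ae_ne_of_pos hd x] with y hy hne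
  have hpos : 0 < ‖x - y‖ := norm_pos_iff.2 (sub_ne_zero.2 hne.symm)
  obtain ⟨k, hk⟩ := hy (ENNReal.ofReal_pos.2 (by positivity)).ne'
  refine ⟨l - k, ?_⟩
  have := hl.sub (hk.comp hσ.tendsto_atTop)
  refine this.congr fun n => ?_
  simp only [incr, Function.comp]
  ring

/-- The direct method for the energy plus a convex integral functional, over functions with
values in `[0, A]`. -/
lemma exists_minimizer (hd : 0 < d) (hκ : 0 < κ) {ν : Measure (Ed d)}
    (hν : ν ≪ (volume : Measure (Ed d))) {A lam : ℝ} (hA : 0 ≤ A) (hlam : 0 < lam)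
    {j : Ed d → ℝ → ℝ} (hjm : Measurable (Function.uncurry j)) (hjc : ∀ x, Continuous (j x))
    (hj0 : ∀ x, ∀ a ∈ Icc 0 A, 0 ≤ j x a)
    (hconv : ∀ x, ∀ a ∈ Icc 0 A, ∀ b ∈ Icc 0 A, 2 * j x ((a + b) / 2) ≤ j x a + j x b)
    (hfin : ∫⁻ x, ENNReal.ofReal (j x 0) ∂ν ≠ ⊤) :
    ∃ v : Ed d → ℝ, Measurable v ∧ (∀ x, v x ∈ Icc 0 A) ∧ energySq d s κ v < ⊤ ∧
      ∫⁻ x, ENNReal.ofReal (j x (v x)) ∂ν < ⊤ ∧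
      ∀ w : Ed d → ℝ, Measurable w → (∀ x, w x ∈ Icc 0 A) →
        ENNReal.ofReal lam * energySq d s κ v + ∫⁻ x, ENNReal.ofReal (j x (v x)) ∂ν ≤
        ENNReal.ofReal lam * energySq d s κ w + ∫⁻ x, ENNReal.ofReal (j x (w x)) ∂ν := by
  set G : (Ed d → ℝ) → ℝ≥0∞ := fun v => ∫⁻ x, ENNReal.ofReal (j x (v x)) ∂ν with hG
  set J : (Ed d → ℝ) → ℝ≥0∞ := fun v => ENNReal.ofReal lam * energySq d s κ v + G v with hJ
  set K : Set (Ed d → ℝ) := {v | Measurable v ∧ ∀ x, v x ∈ Icc 0 A} with hK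
  have hgm : ∀ {v : Ed d → ℝ}, Measurable v → Measurable fun x => ENNReal.ofReal (j x (v x)) :=
    fun hv => (hjm.comp (measurable_id.prodMk hv)).ennreal_ofReal
  have hl0 : ENNReal.ofReal lam ≠ 0 := (ENNReal.ofReal_pos.2 hlam).ne'
  have h0K : (fun _ => 0) ∈ K := ⟨measurable_const, fun x => ⟨le_rfl, hA⟩⟩
  have hJ0 : J (fun _ => 0) < ⊤ :=
    ENNReal.add_lt_top.2 ⟨ENNReal.mul_lt_top ENNReal.ofReal_lt_top
      FiniteEnergy.zero.energySq_lt_top, hfin.lt_top⟩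
  set ι : ℝ≥0∞ := ⨅ v ∈ K, J v with hι
  have hιJ : ∀ v ∈ K, ι ≤ J v := fun v hv => iInf₂_le v hv
  have hιtop : ι ≠ ⊤ := ((hιJ _ h0K).trans_lt hJ0).ne
  set ε : ℕ → ℝ≥0∞ := fun n => ENNReal.ofReal (lam / 8 * ((1 / 2) ^ n) ^ 2) with hε
  have hε0 : ∀ n, 0 < ε n := fun n => ENNReal.ofReal_pos.2 (by positivity)
  have hex : ∀ n, ∃ v ∈ K, J v < ι + ε n := fun n => by
    have : ι < ι + ε n := ENNReal.lt_add_right hιtop (hε0 n).ne'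
    simpa only [hι, iInf_lt_iff, exists_prop] using this
  choose v hvK hvJ using hex
  have hanti : ∀ {N n}, N ≤ n → ε n ≤ ε N := fun {N n} hn => by
    refine ENNReal.ofReal_le_ofReal ?_
    have : ((1 : ℝ) / 2) ^ n ≤ (1 / 2) ^ N := pow_le_pow_of_le_one (by norm_num) (by norm_num) hn
    gcongr
  have hmid : ∀ a ∈ K, ∀ b ∈ K, 2 * J (fun x => (a x + b x) / 2) +
      ENNReal.ofReal lam / 2 * energySq d s κ (fun x => a x - b x) ≤ J a + J b := by
    rintro a ⟨ham, ha⟩ b ⟨hbm, hb⟩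
    have e1 : 2 * G (fun x => (a x + b x) / 2) ≤ G a + G b := by
      simp only [hG]
      rw [← lintegral_const_mul _ (hgm (by fun_prop)), ← lintegral_add_left (hgm ham)]
      refine lintegral_mono fun x => ?_
      rw [← ENNReal.ofReal_add (hj0 x _ (ha x)) (hj0 x _ (hb x))]
      calc 2 * ENNReal.ofReal (j x ((a x + b x) / 2))
          = ENNReal.ofReal (2 * j x ((a x + b x) / 2)) := by
            rw [ENNReal.ofReal_mul (by norm_num)]; simp
        _ ≤ _ := ENNReal.ofReal_le_ofReal (hconv x _ (ha x) _ (hb x))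
    have e2 := energySq_parallelogram (s := s) (κ := κ) ham hbm
    have hh : ENNReal.ofReal lam = 2 * (ENNReal.ofReal lam / 2) := by
      rw [ENNReal.mul_div_cancel (by norm_num) (by norm_num)]
    calc 2 * J (fun x => (a x + b x) / 2) +
        ENNReal.ofReal lam / 2 * energySq d s κ (fun x => a x - b x)
        = ENNReal.ofReal lam / 2 * (4 * energySq d s κ (fun x => (a x + b x) / 2) +
            energySq d s κ (fun x => a x - b x)) + 2 * G (fun x => (a x + b x) / 2) := by
          simp only [hJ]
          nth_rewrite 1 [hh]
          ring
      _ ≤ ENNReal.ofReal lam / 2 * (2 * energySq d s κ a + 2 * energySq d s κ b) +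
            (G a + G b) := by
          rw [e2]
          gcongr
      _ = J a + J b := by
          simp only [hJ]
          nth_rewrite 2 3 [hh]
          ring
  have hcau : ∀ N n k : ℕ, N ≤ n → N ≤ k →
      eLpNorm (incr (v n) - incr (v k)) 2 (jumpMeasure d s κ) < ((1 / 2 : ℝ≥0∞) ^ N) := by
    intro N n k hn hk
    have hK2 : (fun x => (v n x + v k x) / 2) ∈ K := by
      refine ⟨by have := (hvK n).1; have := (hvK k).1; fun_prop, fun x => ?_⟩
      have h1 := (hvK n).2 x
      have h2 := (hvK k).2 x
      constructor <;> linarith [h1.1, h1.2, h2.1, h2.2]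
    have h1 := hmid _ (hvK n) _ (hvK k)
    have h2 : J (v n) + J (v k) ≤ 2 * ι + 2 * ε N := by
      calc J (v n) + J (v k) ≤ (ι + ε N) + (ι + ε N) :=
            add_le_add ((hvJ n).le.trans (add_le_add le_rfl (hanti hn)))
              ((hvJ k).le.trans (add_le_add le_rfl (hanti hk)))
        _ = _ := by ring
    have h3 : ENNReal.ofReal lam / 2 * energySq d s κ (fun x => v n x - v k x) ≤ 2 * ε N := by
      refine (ENNReal.add_le_add_iff_left (a := 2 * ι) (ENNReal.mul_ne_top (by norm_num) hιtop)).1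
        (le_trans ?_ (h1.trans h2))
      have := hιJ _ hK2
      gcongr
    have e : incr (v n) - incr (v k) = incr (fun x => v n x - v k x) := by
      ext p
      simp only [incr, Pi.sub_apply]
      ring
    have e3 : ((1 / 2 : ℝ≥0∞) ^ N) = (((1 / 2 : ℝ≥0) ^ N : ℝ≥0) : ℝ≥0∞) := by
      push_cast
      norm_num
    rw [e, e3]
    refine eLpNorm_incr_lt ?_
    have hc : ENNReal.ofReal lam / 2 = ENNReal.ofReal (lam / 2) := by
      rw [ENNReal.ofReal_div_of_pos (by norm_num)]; simp
    have e4 : (((1 / 2 : ℝ≥0) ^ N : ℝ≥0) : ℝ≥0∞) ^ 2 = ENNReal.ofReal (((1 / 2 : ℝ) ^ N) ^ 2) := by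
      rw [ENNReal.ofReal_pow (by positivity), ENNReal.ofReal_pow (by norm_num), ← e3,
        ENNReal.ofReal_div_of_pos (by norm_num)]
      simp
    have hpos : (0 : ℝ) < ((1 / 2) ^ N) ^ 2 := by positivity
    rw [hc] at h3
    by_contra! hcon
    rw [e4] at hcon
    have h5 : ENNReal.ofReal (lam / 2) * ENNReal.ofReal (((1 / 2 : ℝ) ^ N) ^ 2) ≤ 2 * ε N :=
      (mul_le_mul' le_rfl hcon).trans h3
    have e6 : 2 * ε N = ENNReal.ofReal (lam / 4 * ((1 / 2) ^ N) ^ 2) := by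
      rw [hε, show lam / 4 * (((1 : ℝ) / 2) ^ N) ^ 2 = 2 * (lam / 8 * ((1 / 2) ^ N) ^ 2) by ring,
        ENNReal.ofReal_mul (by norm_num : (0 : ℝ) ≤ 2)]
      simp
    rw [e6, ← ENNReal.ofReal_mul (by positivity),
      ENNReal.ofReal_le_ofReal_iff (by positivity)] at h5
    nlinarith
  have hsum : ∑' i, (1 / 2 : ℝ≥0∞) ^ i ≠ ∞ := by
    rw [ENNReal.tsum_geometric]
    simp
  obtain ⟨σ, hσ, hconvg⟩ := exists_subseq_tendsto_of_incr hd hκ (fun n => (hvK n).2)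
    (Lp.ae_tendsto_of_cauchy_eLpNorm (fun n => (hvK n).1.incr.aestronglyMeasurable) (by norm_num)
      hsum hcau)
  obtain ⟨w, hwm, hw⟩ := measurable_limit_of_tendsto_metrizable_ae
    (fun n => (hvK (σ n)).1.aemeasurable) hconvg
  set V : Ed d → ℝ := fun x => max 0 (min A (w x)) with hV
  have hVm : Measurable V := by fun_prop
  have hVK : V ∈ K := ⟨hVm, fun x => ⟨le_max_left _ _, max_le hA (min_le_left _ _)⟩⟩
  have hVlim : ∀ᵐ x : Ed d, Tendsto (fun n => v (σ n) x) atTop (𝓝 (V x)) := by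
    filter_upwards [hw] with x hx
    have h1 : 0 ≤ w x := ge_of_tendsto' hx fun n => ((hvK (σ n)).2 x).1
    have h2 : w x ≤ A := le_of_tendsto' hx fun n => ((hvK (σ n)).2 x).2
    simpa only [hV, min_eq_right h2, max_eq_right h1] using hx
  have hVinc : ∀ᵐ p ∂(jumpMeasure d s κ), Tendsto (fun n => ENNReal.ofReal (incr (v (σ n)) p ^ 2))
      atTop (𝓝 (ENNReal.ofReal (incr V p ^ 2))) := by
    refine jumpMeasure_absolutelyContinuous ?_
    have q1 := (Measure.quasiMeasurePreserving_fst (μ := (volume : Measure (Ed d)))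
      (ν := (volume : Measure (Ed d)))).ae hVlim
    have q2 := (Measure.quasiMeasurePreserving_snd (μ := (volume : Measure (Ed d)))
      (ν := (volume : Measure (Ed d)))).ae hVlim
    filter_upwards [q1, q2] with p h1 h2
    exact ENNReal.tendsto_ofReal ((h1.sub h2).pow 2)
  have hE : energySq d s κ V ≤ liminf (fun n => energySq d s κ (v (σ n))) atTop :=
    calc energySq d s κ V = ∫⁻ p, liminf (fun n => ENNReal.ofReal (incr (v (σ n)) p ^ 2)) atTop
          ∂(jumpMeasure d s κ) := lintegral_congr_ae (hVinc.mono fun a ha => ha.liminf_eq.symm)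
      _ ≤ _ := lintegral_liminf_le fun n => measurable_energySq_integrand (hvK _).1
  have hGl : G V ≤ liminf (fun n => G (v (σ n))) atTop :=
    calc G V = ∫⁻ x, liminf (fun n => ENNReal.ofReal (j x (v (σ n) x))) atTop ∂ν :=
          lintegral_congr_ae ((hVlim.filter_mono hν.ae_le).mono fun x hx =>
            (ENNReal.tendsto_ofReal (((hjc x).tendsto _).comp hx)).liminf_eq.symm)
      _ ≤ _ := lintegral_liminf_le fun n => hgm (hvK _).1
  have hJV : J V ≤ ι := by
    have hε' : Tendsto (fun n => ι + ε (σ n)) atTop (𝓝 ι) := by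
      have h0 : Tendsto (fun n : ℕ => lam / 8 * (((1 : ℝ) / 2) ^ n) ^ 2) atTop (𝓝 0) := by
        have := ((tendsto_pow_atTop_nhds_zero_of_lt_one (r := (1 : ℝ) / 2) (by norm_num)
          (by norm_num)).pow 2).const_mul (lam / 8)
        simpa using this
      have h1 := (ENNReal.tendsto_ofReal h0).comp hσ.tendsto_atTop
      rw [ENNReal.ofReal_zero] at h1
      have h2 := (tendsto_const_nhds (x := ι)).add h1
      rwa [add_zero] at h2
    calc J V ≤ ENNReal.ofReal lam * liminf (fun n => energySq d s κ (v (σ n))) atTop +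
          liminf (fun n => G (v (σ n))) atTop := add_le_add (mul_le_mul' le_rfl hE) hGl
      _ = liminf (fun n => ENNReal.ofReal lam * energySq d s κ (v (σ n))) atTop +
          liminf (fun n => G (v (σ n))) atTop := by
        rw [ENNReal.liminf_const_mul_of_ne_top ENNReal.ofReal_ne_top]
      _ ≤ liminf (fun n => J (v (σ n))) atTop :=
        liminf_add_liminf_le _ _
      _ ≤ liminf (fun n => ι + ε (σ n)) atTop :=
        liminf_le_liminf (.of_forall fun n => (hvJ (σ n)).le)
      _ = ι := hε'.liminf_eq
  have hJVtop : J V < ⊤ := hJV.trans_lt hιtop.lt_top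
  obtain ⟨t1, t2⟩ := ENNReal.add_lt_top.1 hJVtop
  refine ⟨V, hVm, hVK.2, ?_, t2, fun w hwm hw => hJV.trans (hιJ w ⟨hwm, hw⟩)⟩
  by_contra hcon
  rw [not_lt_top_iff.1 hcon, ENNReal.mul_top hl0] at t1
  exact lt_irrefl _ t1

end Minimisation

/-! ### The resolvent of the nonlinear operator -/

section Resolvent

variable {d : ℕ} {s κ γ c C m : ℝ} {ρ : Ed d → ℝ}

lemma rpow_tangent_le (hm : 1 < m) {a b : ℝ} (ha : 0 ≤ a) (hb : 0 ≤ b) :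
    m / (m + 1) * a ^ ((m + 1) / m) - m / (m + 1) * b ^ ((m + 1) / m) ≤ a ^ (1 / m) * (a - b) := by
  have hm0 : 0 < m := by linarith
  have hpq : ((m + 1) / m).HolderConjugate (m + 1) := by
    rw [Real.holderConjugate_iff]
    constructor
    · rw [lt_div_iff₀ hm0]; linarith
    · field_simp
  have hy := Real.young_inequality_of_nonneg hb (Real.rpow_nonneg ha (1 / m)) hpq
  have e1 : (a ^ (1 / m)) ^ (m + 1) = a ^ ((m + 1) / m) := by
    rw [← Real.rpow_mul ha]
    congr 1
    field_simp
  have e2 : a ^ ((m + 1) / m) = a ^ (1 / m) * a := by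
    rcases ha.eq_or_lt with rfl | ha
    · rw [mul_zero, Real.zero_rpow (by positivity)]
    · rw [show (m + 1) / m = 1 / m + 1 by field_simp; ring, Real.rpow_add_one ha.ne']
  rw [e1] at hy
  have e3 : b ^ ((m + 1) / m) / ((m + 1) / m) = m / (m + 1) * b ^ ((m + 1) / m) := by
    field_simp
  have e4 : a ^ ((m + 1) / m) / (m + 1) + m / (m + 1) * a ^ ((m + 1) / m) = a ^ ((m + 1) / m) := by
    field_simp
    ring
  rw [e3] at hy
  nlinarith

lemma rpow_clip_tangent_le (hm : 1 < m) {B r v f : ℝ} (hB : 0 ≤ B) (hv : 0 ≤ v)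
    (hf : f ∈ Icc 0 B) :
    (m / (m + 1) * (max 0 (min (B ^ m) r)) ^ ((m + 1) / m) +
        f * (B ^ m - max 0 (min (B ^ m) r))) -
      (m / (m + 1) * v ^ ((m + 1) / m) + f * (B ^ m - v)) ≤
      ((max 0 (min (B ^ m) r)) ^ (1 / m) - f) * (r - v) := by
  have hA : 0 ≤ B ^ m := Real.rpow_nonneg hB m
  set T := max 0 (min (B ^ m) r) with hT
  have hT0 : 0 ≤ T := le_max_left _ _
  have h1 := rpow_tangent_le hm hT0 hv
  have h2 : 0 ≤ (T ^ (1 / m) - f) * (r - T) := by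
    rcases le_total r 0 with hr | hr
    · have : T = 0 := by rw [hT, max_eq_left]; exact (min_le_right _ _).trans hr
      rw [this, Real.zero_rpow (by positivity)]
      nlinarith [hf.1]
    · rcases le_total r (B ^ m) with hr2 | hr2
      · have : T = r := by rw [hT, min_eq_right hr2, max_eq_right hr]
        rw [this]
        simp
      · have : T = B ^ m := by rw [hT, min_eq_left hr2, max_eq_right hA]
        rw [this, ← Real.rpow_mul hB, mul_one_div_cancel (by linarith), Real.rpow_one]
        nlinarith [hf.2]
  nlinarith

lemma abs_clip_sub_clip_le (A a b : ℝ) :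
    |max 0 (min A a) - max 0 (min A b)| ≤ |a - b| := by
  have h1 := abs_max_sub_max_le_max 0 (min A a) 0 (min A b)
  have h2 := abs_min_sub_min_le_max A a A b
  rw [sub_self, abs_zero, max_eq_right (abs_nonneg (min A a - min A b))] at h1
  rw [sub_self, abs_zero, max_eq_right (abs_nonneg (a - b))] at h2
  exact h1.trans h2

lemma FiniteEnergy.energy_nonneg_of_monotone {v w : Ed d → ℝ}
    (h : ∀ x y, 0 ≤ (v x - v y) * (w x - w y)) : 0 ≤ energy d s κ v w :=
  integral_nonneg fun p => h p.1 p.2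

/-- Unit plateau functions built from superlevel sets. -/
lemma EnergyDecaying.plateau {φ : Ed d → ℝ} (hφ : EnergyDecaying d s κ ρ φ) {ε : ℝ} (hε : 0 < ε) :
    EnergyTest d s κ ρ (fun x => min (1 / ε * max (φ x - ε) 0) 1) := by
  have h1 := (hφ.posPart_sub hε).const_mul (1 / ε)
  have hm : Measurable fun x => min (1 / ε * max (φ x - ε) 0) 1 :=
    h1.measurable.min measurable_const
  have hb : ∀ x, |min (1 / ε * max (φ x - ε) 0) 1| ≤ 1 := fun x => by
    rw [abs_of_nonneg (le_min (by positivity) zero_le_one)]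
    exact min_le_right _ _
  refine ⟨h1.toFiniteEnergy.of_abs_incr_le hm fun x y => by
    simpa using abs_min_sub_min_le_max (1 / ε * max (φ x - ε) 0) 1 (1 / ε * max (φ y - ε) 0) 1,
    ⟨1, hb⟩,
    hφ.integrable_of_support hm hε hb fun x hx => ?_⟩
  rw [max_eq_right (by linarith [le_abs_self (φ x)])]
  simp

lemma tendsto_plateau {a : ℝ} (ha : 0 < a) :
    Tendsto (fun n : ℕ => min (1 / (1 / ((n : ℝ) + 1)) * max (a - 1 / ((n : ℝ) + 1)) 0) 1) atTop
      (𝓝 1) := by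
  have h0 := tendsto_one_div_add_atTop_nhds_zero_nat (𝕜 := ℝ)
  refine tendsto_const_nhds.congr' ?_
  filter_upwards [h0.eventually_lt_const (half_pos ha)] with n hn
  have hpos : 0 < 1 / ((n : ℝ) + 1) := by positivity
  rw [min_eq_right]
  rw [div_mul_eq_mul_div, one_mul, le_div_iff₀ hpos]
  exact le_trans (by linarith) (le_max_left _ _)

/-- A weak supersolution estimate: the mass of a nonnegative bounded solution of the resolvent
equation is at most that of the datum. -/
lemma integrable_of_resolvent {lam : ℝ} (hlam : 0 < lam) {f u v : Ed d → ℝ}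
    (hf : IsSource ρ f) (hum : Measurable u) (hu0 : ∀ x, 0 ≤ u x) {B : ℝ} (hB : ∀ x, u x ≤ B)
    (hv : EnergyDecaying d s κ ρ v) (huv : ∀ x, u x ≠ 0 → 0 < v x)
    (hid : ∀ φ, EnergyTest d s κ ρ φ →
      lam * energy d s κ v φ = ∫ x, (f x - u x) * φ x ∂(weightMeasure ρ)) :
    Integrable u (weightMeasure ρ) := by
  set P : ℕ → Ed d → ℝ := fun n x =>
    min (1 / (1 / ((n : ℝ) + 1)) * max (v x - 1 / ((n : ℝ) + 1)) 0) 1 with hP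
  have hPt : ∀ n, EnergyTest d s κ ρ (P n) := fun n => hv.plateau (by positivity)
  have hP0 : ∀ n x, 0 ≤ P n x := fun n x => le_min (by positivity) zero_le_one
  have hP1 : ∀ n x, P n x ≤ 1 := fun n x => min_le_right _ _
  have huP : ∀ n, Integrable (fun x => u x * P n x) (weightMeasure ρ) := fun n =>
    (hPt n).integrable.bdd_mul hum.aestronglyMeasurable
      (.of_forall fun x => by rw [Real.norm_eq_abs, abs_of_nonneg (hu0 x)]; exact hB x)
  have key : ∀ n, ∫⁻ x, ENNReal.ofReal (u x * P n x) ∂(weightMeasure ρ) ≤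
      ENNReal.ofReal (∫ x, f x ∂(weightMeasure ρ)) := fun n => by
    rw [← ofReal_integral_eq_lintegral_ofReal (huP n)
      (.of_forall fun x => mul_nonneg (hu0 x) (hP0 n x))]
    refine ENNReal.ofReal_le_ofReal ?_
    have h1 : 0 ≤ energy d s κ v (P n) := by
      refine FiniteEnergy.energy_nonneg_of_monotone fun x y => ?_
      have hmono : Monotone fun a : ℝ =>
          min (1 / (1 / ((n : ℝ) + 1)) * max (a - 1 / ((n : ℝ) + 1)) 0) 1 :=
        fun a b hab => by
          refine min_le_min_right _ (mul_le_mul_of_nonneg_left ?_ (by positivity))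
          exact max_le_max_right _ (by linarith)
      rcases le_total (v x) (v y) with hxy | hxy
      · exact mul_nonneg_of_nonpos_of_nonpos (by linarith)
          (by have := hmono hxy; simp only [hP]; linarith)
      · exact mul_nonneg (by linarith) (by have := hmono hxy; simp only [hP]; linarith)
    have h2 := hid _ (hPt n)
    have hfP := (hPt n).integrable_bdd_mul hf.integrable
    simp only [sub_mul] at h2
    rw [integral_sub hfP (huP n)] at h2
    have h3 : ∫ x, f x * P n x ∂(weightMeasure ρ) ≤ ∫ x, f x ∂(weightMeasure ρ) :=
      integral_mono hfP hf.integrable fun x =>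
        mul_le_of_le_one_right (hf.nonneg x) (hP1 n x)
    nlinarith
  have hfat := lintegral_le_of_tendsto (μ := weightMeasure ρ)
    (F := fun n x => ENNReal.ofReal (u x * P n x)) (G := fun x => ENNReal.ofReal (u x))
    (fun n => (hum.mul (hPt n).measurable).ennreal_ofReal.aemeasurable)
    (.of_forall fun x => by
      refine ENNReal.tendsto_ofReal ?_
      by_cases h0 : u x = 0
      · simp [h0]
      · have h1 := (tendsto_plateau (huv x h0)).const_mul (u x)
        rwa [mul_one] at h1) key
  refine ⟨hum.aestronglyMeasurable, ?_⟩
  rw [hasFiniteIntegral_iff_ofReal (.of_forall hu0)]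
  exact hfat.trans_lt ENNReal.ofReal_lt_top

theorem exists_resolvent (h : Setup d s κ γ c C ρ) (hm : 1 < m) {lam : ℝ} (hlam : 0 < lam)
    {f : Ed d → ℝ} (hf : IsSource ρ f) {B : ℝ} (hB : ∀ x, f x ≤ B) :
    ∃ u, IsSource ρ u ∧ (∀ x, u x ≤ B) ∧ EnergyTest d s κ ρ (fun x => u x ^ m) ∧
      ∀ φ, EnergyTest d s κ ρ φ → lam * energy d s κ (fun x => u x ^ m) φ =
        ∫ x, (f x - u x) * φ x ∂(weightMeasure ρ) := by
  have hm0 : 0 < m := by linarith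
  have hB0 : 0 ≤ B := (hf.nonneg 0).trans (hB 0)
  set A := B ^ m with hA
  have hA0 : 0 ≤ A := Real.rpow_nonneg hB0 m
  have hfm := hf.measurable
  have hp0 : 0 < (m + 1) / m := by positivity
  set j : Ed d → ℝ → ℝ := fun x a => m / (m + 1) * a ^ ((m + 1) / m) + f x * (A - a) with hj
  have hjm : Measurable (Function.uncurry j) := by
    simp only [hj, Function.uncurry_def]
    fun_prop
  have hjc : ∀ x, Continuous (j x) := fun x =>
    ((Real.continuous_rpow_const hp0.le).const_mul _).add
      ((continuous_const.sub continuous_id).const_mul _)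
  have hj0 : ∀ x, ∀ a ∈ Icc 0 A, 0 ≤ j x a := fun x a ha => by
    have h1 := Real.rpow_nonneg ha.1 ((m + 1) / m)
    have h2 := mul_nonneg (hf.nonneg x) (sub_nonneg.2 ha.2)
    simp only [hj]
    positivity
  obtain ⟨v, hvm, hv01, hvE, hvG, hmin⟩ := exists_minimizer (s := s) (κ := κ) h.dim_pos h.κ_pos
    (weightMeasure_absolutelyContinuous ρ) hA0 (half_pos hlam) hjm hjc hj0
    (fun x a ha b hb => by
      have hmid : 0 ≤ (a + b) / 2 := by linarith [ha.1, hb.1]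
      have h1 := rpow_tangent_le hm hmid ha.1
      have h2 := rpow_tangent_le hm hmid hb.1
      simp only [hj]
      nlinarith)
    (by
      have : ∀ x, j x 0 = A * f x := fun x => by
        simp only [hj]
        rw [Real.zero_rpow hp0.ne']
        ring
      simp only [this]
      have hi := (hf.integrable.const_mul A).2
      rw [hasFiniteIntegral_iff_ofReal (.of_forall fun x => mul_nonneg hA0 (hf.nonneg x))] at hi
      exact hi.ne)
  have hvF := finiteEnergy_of_energySq_lt_top hvm hvE
  have hjv0 : ∀ x, 0 ≤ j x (v x) := fun x => hj0 x _ (hv01 x)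
  have hjvm : Measurable fun x => j x (v x) := hjm.comp (measurable_id.prodMk hvm)
  have hjvi : Integrable (fun x => j x (v x)) (weightMeasure ρ) :=
    ⟨hjvm.aestronglyMeasurable, by rwa [hasFiniteIntegral_iff_ofReal (.of_forall hjv0)]⟩
  set β : ℝ → ℝ := fun r => (max 0 (min A r)) ^ (1 / m) with hβ
  have hβc : Continuous β := (Real.continuous_rpow_const (by positivity)).comp
    (continuous_const.max (continuous_const.min continuous_id))
  have hβ01 : ∀ r, β r ∈ Icc 0 B := fun r => by
    refine ⟨Real.rpow_nonneg (le_max_left _ _) _, ?_⟩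
    calc β r ≤ A ^ (1 / m) := Real.rpow_le_rpow (le_max_left _ _)
          (max_le hA0 (min_le_left _ _)) (by positivity)
      _ = B := by rw [hA, ← Real.rpow_mul hB0, mul_one_div_cancel hm0.ne', Real.rpow_one]
  have hβf : ∀ r x, |β r - f x| ≤ B := fun r x => by
    have h1 := hβ01 r
    have h2 := hf.nonneg x
    have h3 := hB x
    rw [abs_le]
    constructor <;> linarith [h1.1, h1.2]
  have hint : ∀ {φ : Ed d → ℝ}, EnergyTest d s κ ρ φ → ∀ t : ℝ,
      Integrable (fun x => (β (v x + t * φ x) - f x) * φ x) (weightMeasure ρ) := fun hφ t =>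
    hφ.integrable.bdd_mul (c := B)
      ((hβc.measurable.comp (hvm.add (hφ.measurable.const_mul t))).sub hfm).aestronglyMeasurable
      (.of_forall fun x => hβf _ x)
  have hvar : ∀ φ, EnergyTest d s κ ρ φ → ∀ t : ℝ, 0 < t →
      0 ≤ lam * energy d s κ v φ + lam / 2 * t * energy d s κ φ φ +
        ∫ x, (β (v x + t * φ x) - f x) * φ x ∂(weightMeasure ρ) := by
    intro φ hφ t ht
    have hφm := hφ.measurable
    have hrF : FiniteEnergy d s κ (fun x => v x + t * φ x) :=
      hvF.add (hφ.toFiniteEnergy.const_mul t)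
    set w : Ed d → ℝ := fun x => max 0 (min A (v x + t * φ x)) with hw
    have hwm : Measurable w := by fun_prop
    have hw01 : ∀ x, w x ∈ Icc 0 A := fun x => ⟨le_max_left _ _, max_le hA0 (min_le_left _ _)⟩
    have hwF : FiniteEnergy d s κ w := hrF.of_abs_incr_le hwm fun x y => by
      exact abs_clip_sub_clip_le A _ _
    have hwE : energy d s κ w w ≤
        energy d s κ (fun x => v x + t * φ x) (fun x => v x + t * φ x) := by
      refine integral_mono (hwF.integrable_mul hwF) (hrF.integrable_mul hrF) fun p => ?_
      refine abs_le_iff_mul_self_le.1 ?_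
      exact abs_clip_sub_clip_le A _ _
    have htan : ∀ x, j x (w x) - j x (v x) ≤ t * ((β (v x + t * φ x) - f x) * φ x) := fun x => by
      have := rpow_clip_tangent_le hm (r := v x + t * φ x) hB0 (hv01 x).1 ⟨hf.nonneg x, hB x⟩
      calc _ ≤ _ := this
        _ = _ := by simp only [hβ]; ring
    have hjw0 : ∀ x, 0 ≤ j x (w x) := fun x => hj0 x _ (hw01 x)
    have hsum : Integrable (fun x => j x (v x) + t * ((β (v x + t * φ x) - f x) * φ x))
        (weightMeasure ρ) := hjvi.add ((hint hφ t).const_mul t)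
    have hjwi : Integrable (fun x => j x (w x)) (weightMeasure ρ) :=
      hsum.mono' (hjm.comp (measurable_id.prodMk hwm)).aestronglyMeasurable
        (.of_forall fun x => by
          rw [Real.norm_eq_abs, abs_of_nonneg (hjw0 x)]
          linarith [htan x])
    have h1 := hmin w hwm hw01
    rw [← hvF.ofReal_energy, ← hwF.ofReal_energy,
      ← ofReal_integral_eq_lintegral_ofReal hjvi (.of_forall hjv0),
      ← ofReal_integral_eq_lintegral_ofReal hjwi (.of_forall hjw0),
      ← ENNReal.ofReal_mul (by positivity), ← ENNReal.ofReal_mul (by positivity),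
      ← ENNReal.ofReal_add (mul_nonneg (by positivity) (energy_self_nonneg _))
        (integral_nonneg hjv0),
      ← ENNReal.ofReal_add (mul_nonneg (by positivity) (energy_self_nonneg _))
        (integral_nonneg hjw0), ENNReal.ofReal_le_ofReal_iff
        (add_nonneg (mul_nonneg (by positivity) (energy_self_nonneg _))
        (integral_nonneg hjw0))] at h1
    have h2 : ∫ x, j x (w x) ∂(weightMeasure ρ) ≤ ∫ x, j x (v x) ∂(weightMeasure ρ) +
        t * ∫ x, (β (v x + t * φ x) - f x) * φ x ∂(weightMeasure ρ) := by
      rw [← integral_const_mul, ← integral_add hjvi ((hint hφ t).const_mul t)]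
      exact integral_mono hjwi hsum fun x => by linarith [htan x]
    have htφ := hφ.toFiniteEnergy.const_mul t
    rw [energy_add_left hvF htφ hrF, energy_add_right hvF htφ hvF, energy_add_right hvF htφ htφ,
      energy_const_mul_left, energy_const_mul_right, energy_const_mul_right, energy_const_mul_left,
      energy_comm φ v] at hwE
    have h3 : 0 ≤ t * (lam * energy d s κ v φ + lam / 2 * t * energy d s κ φ φ +
        ∫ x, (β (v x + t * φ x) - f x) * φ x ∂(weightMeasure ρ)) := by
      nlinarith [mul_le_mul_of_nonneg_left hwE (half_pos hlam).le]
    exact nonneg_of_mul_nonneg_right h3 ht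
  have hβv : ∀ x, β (v x) = v x ^ (1 / m) := fun x => by
    simp only [hβ]
    rw [min_eq_right (hv01 x).2, max_eq_right (hv01 x).1]
  set u : Ed d → ℝ := fun x => v x ^ (1 / m) with hu
  have hum : Measurable u := hvm.pow_const _
  have hu01 : ∀ x, u x ∈ Icc 0 B := fun x => by
    have := hβ01 (v x)
    rwa [hβv] at this
  have huv : (fun x => u x ^ m) = v := by
    ext x
    simp only [hu]
    rw [← Real.rpow_mul (hv01 x).1, one_div_mul_cancel hm0.ne', Real.rpow_one]
  have hineq : ∀ φ, EnergyTest d s κ ρ φ →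
      0 ≤ lam * energy d s κ v φ + ∫ x, (u x - f x) * φ x ∂(weightMeasure ρ) := by
    intro φ hφ
    have h0 := tendsto_one_div_add_atTop_nhds_zero_nat (𝕜 := ℝ)
    have hl : Tendsto (fun n : ℕ => ∫ x, (β (v x + 1 / ((n : ℝ) + 1) * φ x) - f x) * φ x
        ∂(weightMeasure ρ)) atTop (𝓝 (∫ x, (u x - f x) * φ x ∂(weightMeasure ρ))) := by
      refine tendsto_integral_of_dominated_convergence (fun x => B * |φ x|)
        (fun n => (hint hφ _).aestronglyMeasurable) (hφ.integrable.abs.const_mul B)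
        (fun n => .of_forall fun x => ?_) (.of_forall fun x => ?_)
      · rw [norm_mul]
        exact mul_le_mul_of_nonneg_right (hβf _ x) (abs_nonneg _)
      · have h1 : Tendsto (fun n : ℕ => v x + 1 / ((n : ℝ) + 1) * φ x) atTop (𝓝 (v x)) := by
          simpa using (h0.mul_const (φ x)).const_add (v x)
        have h2 := (((hβc.tendsto _).comp h1).sub_const (f x)).mul_const (φ x)
        rwa [hβv] at h2
    have hl2 := ((h0.const_mul (lam / 2)).mul_const (energy d s κ φ φ)).const_add
      (lam * energy d s κ v φ) |>.add hl
    rw [mul_zero, zero_mul, add_zero] at hl2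
    exact ge_of_tendsto' hl2 fun n => hvar φ hφ _ (by positivity)
  have hid : ∀ φ, EnergyTest d s κ ρ φ → lam * energy d s κ v φ =
      ∫ x, (f x - u x) * φ x ∂(weightMeasure ρ) := by
    intro φ hφ
    have h1 := hineq φ hφ
    have h2 := hineq _ (hφ.const_mul (-1))
    rw [energy_const_mul_right] at h2
    have e1 : ∫ x, (u x - f x) * (-1 * φ x) ∂(weightMeasure ρ) =
        ∫ x, (f x - u x) * φ x ∂(weightMeasure ρ) :=
      integral_congr_ae (.of_forall fun x => by ring)
    have e2 : ∫ x, (u x - f x) * φ x ∂(weightMeasure ρ) =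
        -∫ x, (f x - u x) * φ x ∂(weightMeasure ρ) := by
      rw [← integral_neg]
      exact integral_congr_ae (.of_forall fun x => by ring)
    rw [e1] at h2
    rw [e2] at h1
    linarith
  have hvb : ∀ x, |v x| ≤ A := fun x => by
    rw [abs_of_nonneg (hv01 x).1]
    exact (hv01 x).2
  have hvD : EnergyDecaying d s κ ρ v := by
    refine ⟨hvF, ⟨A, hvb⟩, fun ε hε => ?_⟩
    have hε' : 0 < m / (m + 1) * ε ^ ((m + 1) / m) := by positivity
    refine (measure_mono fun x hx => ?_).trans_lt (hjvi.norm.measure_gt_lt_top (half_pos hε'))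
    simp only [mem_ofPred_eq, abs_of_nonneg (hv01 x).1] at hx ⊢
    rw [Real.norm_eq_abs, abs_of_nonneg (hjv0 x)]
    have h1 : ε ^ ((m + 1) / m) ≤ v x ^ ((m + 1) / m) :=
      Real.rpow_le_rpow hε.le hx.le hp0.le
    have h2 : m / (m + 1) * ε ^ ((m + 1) / m) ≤ m / (m + 1) * v x ^ ((m + 1) / m) := by gcongr
    have h3 := mul_nonneg (hf.nonneg x) (sub_nonneg.2 (hv01 x).2)
    simp only [hj]
    linarith
  have hui : Integrable u (weightMeasure ρ) :=
    integrable_of_resolvent hlam hf hum (fun x => (hu01 x).1) (fun x => (hu01 x).2) hvD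
      (fun x hx => by
        rcases (hv01 x).1.eq_or_lt with h0 | h0
        · simp only [hu, ← h0] at hx
          rw [Real.zero_rpow (by positivity)] at hx
          exact absurd rfl hx
        · exact h0) hid
  have hvi : Integrable v (weightMeasure ρ) := by
    refine (hui.const_mul (B ^ (m - 1))).mono' hvm.aestronglyMeasurable (.of_forall fun x => ?_)
    rw [Real.norm_eq_abs, abs_of_nonneg (hv01 x).1, ← congrFun huv x]
    rcases (hu01 x).1.eq_or_lt with h0 | h0
    · rw [← h0, Real.zero_rpow hm0.ne', mul_zero]
    · calc u x ^ m = u x ^ (m - 1) * u x := by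
            rw [← Real.rpow_add_one h0.ne', sub_add_cancel]
        _ ≤ B ^ (m - 1) * u x := by
            have := Real.rpow_le_rpow h0.le (hu01 x).2 (by linarith : 0 ≤ m - 1)
            gcongr
  refine ⟨u, ⟨hum, fun x => (hu01 x).1, ⟨B, fun x => (hu01 x).2⟩, hui⟩, fun x => (hu01 x).2,
    ?_, ?_⟩
  · rw [huv]
    exact ⟨hvF, ⟨A, hvb⟩, hvi⟩
  · rw [huv]
    exact hid

end Resolvent

/-! ### Comparison principles -/

section Comparison

variable {d : ℕ} {s κ γ c C m : ℝ} {ρ : Ed d → ℝ}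

lemma EnergyTest.posPart_isSource {φ : Ed d → ℝ} (hφ : EnergyTest d s κ ρ φ) :
    IsSource ρ (fun x => max (φ x) 0) := by
  obtain ⟨B, hB⟩ := hφ.bdd
  exact ⟨hφ.measurable.max measurable_const, fun x => le_max_right _ _,
    ⟨B, fun x => max_le ((le_abs_self _).trans (hB x)) ((abs_nonneg _).trans (hB x))⟩,
    hφ.integrable.pos_part⟩

/-- Pairing against a source is controlled by the energy. -/
lemma exists_integral_sq_le_energy (h : Setup d s κ γ c C ρ) {ψ : Ed d → ℝ} (hψ : IsSource ρ ψ) :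
    ∃ K : ℝ, ∀ φ, EnergyTest d s κ ρ φ →
      (∫ x, ψ x * φ x ∂(weightMeasure ρ)) ^ 2 ≤ K * energy d s κ φ φ := by
  obtain ⟨U, hU⟩ := exists_isPotential h hψ
  refine ⟨energy d s κ U U, fun φ hφ => ?_⟩
  rw [← hU.energy_eq φ hφ]
  exact energy_sq_le hU.toFiniteEnergy hφ.toFiniteEnergy

lemma ae_nonpos_of_energy_eq_zero (h : Setup d s κ γ c C ρ) {φ : Ed d → ℝ}
    (hφ : EnergyTest d s κ ρ φ) (h0 : energy d s κ φ φ ≤ 0) :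
    ∀ᵐ x ∂(weightMeasure ρ), φ x ≤ 0 := by
  obtain ⟨K, hK⟩ := exists_integral_sq_le_energy h hφ.posPart_isSource
  have h1 := hK φ hφ
  rw [le_antisymm h0 (energy_self_nonneg _), mul_zero] at h1
  have h2 : ∫ x, max (φ x) 0 * φ x ∂(weightMeasure ρ) = 0 := by nlinarith
  have hnn : ∀ x, 0 ≤ max (φ x) 0 * φ x := fun x => by
    rcases le_total (φ x) 0 with hx | hx
    · simp [max_eq_right hx]
    · rw [max_eq_left hx]
      positivity
  rw [integral_eq_zero_iff_of_nonneg hnn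
    (hφ.integrable_bdd_mul hφ.posPart_isSource.integrable)] at h2
  filter_upwards [h2] with x hx
  by_contra! hcon
  simp only [Pi.zero_apply, max_eq_left hcon.le] at hx
  nlinarith

lemma EnergyDecaying.ae_le_of_energy_nonpos (h : Setup d s κ γ c C ρ) {D : Ed d → ℝ}
    (hD : EnergyDecaying d s κ ρ D) {ε : ℝ} (hε : 0 < ε)
    (h0 : energy d s κ D (fun x => max (D x - ε) 0) ≤ 0) :
    ∀ᵐ x ∂(weightMeasure ρ), D x ≤ ε := by
  filter_upwards [ae_nonpos_of_energy_eq_zero h (hD.posPart_sub hε)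
    ((hD.energy_posPart_le hε).trans h0)] with x hx
  linarith [le_max_left (D x - ε) 0]

lemma EnergyDecaying.ae_nonpos_of_energy_eq_zero (h : Setup d s κ γ c C ρ) {D : Ed d → ℝ}
    (hD : EnergyDecaying d s κ ρ D) (h0 : ∀ φ, EnergyTest d s κ ρ φ → energy d s κ D φ = 0) :
    ∀ᵐ x ∂(weightMeasure ρ), D x ≤ 0 := by
  have h1 : ∀ᵐ x ∂(weightMeasure ρ), ∀ n : ℕ, D x ≤ 1 / ((n : ℝ) + 1) :=
    ae_all_iff.2 fun n => hD.ae_le_of_energy_nonpos h (by positivity)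
      (h0 _ (hD.posPart_sub (by positivity))).le
  filter_upwards [h1] with x hx
  exact ge_of_tendsto' (tendsto_one_div_add_atTop_nhds_zero_nat (𝕜 := ℝ)) hx

lemma EnergyDecaying.ae_eq_zero_of_energy_eq_zero (h : Setup d s κ γ c C ρ) {D : Ed d → ℝ}
    (hD : EnergyDecaying d s κ ρ D) (h0 : ∀ φ, EnergyTest d s κ ρ φ → energy d s κ D φ = 0) :
    ∀ᵐ x ∂(weightMeasure ρ), D x = 0 := by
  have h2 : ∀ᵐ x ∂(weightMeasure ρ), -1 * D x ≤ 0 :=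
    (hD.const_mul (-1)).ae_nonpos_of_energy_eq_zero h fun φ hφ => by
      rw [energy_const_mul_left, h0 φ hφ, mul_zero]
  filter_upwards [hD.ae_nonpos_of_energy_eq_zero h h0, h2] with x h1 h2
  linarith

/-- `u` solves the resolvent equation with datum `f` and parameter `lam`. -/
structure IsResolvent (d : ℕ) (s κ m lam : ℝ) (ρ f u : Ed d → ℝ) : Prop
    extends IsSource ρ u where
  test : EnergyTest d s κ ρ (fun x => u x ^ m)
  energy_eq : ∀ φ, EnergyTest d s κ ρ φ → lam * energy d s κ (fun x => u x ^ m) φ =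
    ∫ x, (f x - u x) * φ x ∂(weightMeasure ρ)

lemma exists_isResolvent (h : Setup d s κ γ c C ρ) (hm : 1 < m) {lam : ℝ} (hlam : 0 < lam)
    {f : Ed d → ℝ} (hf : IsSource ρ f) : ∃ u, IsResolvent d s κ m lam ρ f u := by
  obtain ⟨B, hB⟩ := hf.bdd
  obtain ⟨u, h1, -, h2, h3⟩ := exists_resolvent h hm hlam hf hB
  exact ⟨u, h1, h2, h3⟩

/-- `D` has the fractional Laplacian `(f - g) ρ` in the energy sense. -/
def EnergyEq (d : ℕ) (s κ : ℝ) (ρ D f g : Ed d → ℝ) : Prop :=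
  ∀ φ, EnergyTest d s κ ρ φ → energy d s κ D φ = ∫ x, (f x - g x) * φ x ∂(weightMeasure ρ)

lemma IsSource.integrable_sub_mul {f g φ : Ed d → ℝ} (hf : IsSource ρ f) (hg : IsSource ρ g)
    (hφ : EnergyTest d s κ ρ φ) :
    Integrable (fun x => (f x - g x) * φ x) (weightMeasure ρ) :=
  hφ.integrable_bdd_mul (hf.integrable.sub hg.integrable)

/-- One resolvent step preserves upper bounds for the difference of potentials. -/
lemma energyEq_resolvent_step (h : Setup d s κ γ c C ρ) (hm : 0 < m) {lam : ℝ} (hlam : 0 < lam)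
    {D f g u v : Ed d → ℝ} (hf : IsSource ρ f) (hg : IsSource ρ g)
    (hD : EnergyDecaying d s κ ρ D) (hDfg : EnergyEq d s κ ρ D f g)
    (hu : IsResolvent d s κ m lam ρ f u) (hv : IsResolvent d s κ m lam ρ g v)
    {ε : ℝ} (hε : 0 < ε) (hle : ∀ᵐ x ∂(weightMeasure ρ), D x ≤ ε) :
    EnergyDecaying d s κ ρ (fun x => D x - lam * (u x ^ m - v x ^ m)) ∧
      EnergyEq d s κ ρ (fun x => D x - lam * (u x ^ m - v x ^ m)) u v ∧
      ∀ᵐ x ∂(weightMeasure ρ), D x - lam * (u x ^ m - v x ^ m) ≤ ε := by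
  have hw : EnergyTest d s κ ρ (fun x => lam * (u x ^ m - v x ^ m)) :=
    (hu.test.sub hv.test).const_mul lam
  have hD1 : EnergyDecaying d s κ ρ (fun x => D x - lam * (u x ^ m - v x ^ m)) :=
    hD.sub hw.energyDecaying
  have hE : EnergyEq d s κ ρ (fun x => D x - lam * (u x ^ m - v x ^ m)) u v := by
    intro φ hφ
    rw [energy_sub_left hD.toFiniteEnergy hw.toFiniteEnergy hφ.toFiniteEnergy,
      energy_const_mul_left, energy_sub_left hu.test.toFiniteEnergy hv.test.toFiniteEnergy
      hφ.toFiniteEnergy, mul_sub, hu.energy_eq φ hφ, hv.energy_eq φ hφ, hDfg φ hφ,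
      ← integral_sub (hf.integrable_sub_mul hu.toIsSource hφ)
        (hg.integrable_sub_mul hv.toIsSource hφ)]
    have i3 : Integrable (fun x => (f x - u x) * φ x - (g x - v x) * φ x) (weightMeasure ρ) :=
      (hf.integrable_sub_mul hu.toIsSource hφ).sub (hg.integrable_sub_mul hv.toIsSource hφ)
    rw [← integral_sub (hf.integrable_sub_mul hg hφ) i3]
    exact integral_congr_ae (.of_forall fun x => by ring)
  refine ⟨hD1, hE, hD1.ae_le_of_energy_nonpos h hε ?_⟩
  rw [hE _ (hD1.posPart_sub hε)]
  refine integral_nonpos_of_ae ?_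
  filter_upwards [hle] with x hx
  simp only [Pi.zero_apply]
  rcases le_total (D x - lam * (u x ^ m - v x ^ m) - ε) 0 with h1 | h1
  · rw [max_eq_right h1, mul_zero]
  · refine mul_nonpos_of_nonpos_of_nonneg ?_ (le_max_right _ _)
    have h2 : u x ^ m ≤ v x ^ m := by nlinarith
    have h3 := (Real.rpow_le_rpow_iff (hu.nonneg x) (hv.nonneg x) hm).1 h2
    linarith

end Comparison

/-! ### Time integrals -/

section TimeIntegral

variable {d : ℕ} {s κ : ℝ} {ρ : Ed d → ℝ}

/-- The integral of `w` over the time interval `(a, b]`. -/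
def timeInt {d : ℕ} (w : Ed d → ℝ → ℝ) (a b : ℝ) (x : Ed d) : ℝ := ∫ t in Ioc a b, w x t

variable {w : Ed d → ℝ → ℝ} {a b B : ℝ}

lemma measurable_timeInt (hw : Measurable (Function.uncurry w)) (a b : ℝ) :
    Measurable (timeInt w a b) := by
  refine StronglyMeasurable.measurable ?_
  exact StronglyMeasurable.integral_prod_right (f := w) hw.stronglyMeasurable

lemma integrableOn_time (hw : Measurable (Function.uncurry w))
    (hB : ∀ t ∈ Ioc a b, ∀ x, |w x t| ≤ B) (x : Ed d) : IntegrableOn (w x) (Ioc a b) := by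
  refine Measure.integrableOn_of_bounded (M := B) (by simp)
    (hw.comp measurable_prodMk_left).aestronglyMeasurable ?_
  filter_upwards [ae_restrict_mem measurableSet_Ioc] with t ht
  exact hB t ht x

lemma abs_timeInt_le (hab : a ≤ b) (hB : ∀ t ∈ Ioc a b, ∀ x, |w x t| ≤ B) (x : Ed d) :
    |timeInt w a b x| ≤ B * (b - a) := by
  have := norm_setIntegral_le_of_norm_le_const (μ := volume) (s := Ioc a b) (f := w x) (C := B)
    (by simp) fun t ht => hB t ht x
  simpa [timeInt, Measure.real, hab] using this

lemma timeInt_add (hw : Measurable (Function.uncurry w)) {e : ℝ} (hae : a ≤ e) (heb : e ≤ b)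
    (hB : ∀ t ∈ Ioc a b, ∀ x, |w x t| ≤ B) (x : Ed d) :
    timeInt w a b x = timeInt w a e x + timeInt w e b x := by
  have h := integrableOn_time hw hB x
  simp only [timeInt]
  rw [← Ioc_union_Ioc_eq_Ioc hae heb]
  exact setIntegral_union (Ioc_disjoint_Ioc_of_le le_rfl) measurableSet_Ioc
    (h.mono_set (Ioc_subset_Ioc_right heb)) (h.mono_set (Ioc_subset_Ioc_left hae))

lemma incr_timeInt (hw : Measurable (Function.uncurry w))
    (hB : ∀ t ∈ Ioc a b, ∀ x, |w x t| ≤ B) (p : Ed d × Ed d) :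
    incr (timeInt w a b) p = ∫ t in Ioc a b, incr (fun x => w x t) p := by
  simp only [incr, timeInt]
  exact (integral_sub (integrableOn_time hw hB _) (integrableOn_time hw hB _)).symm

lemma measurable_incr_time (hw : Measurable (Function.uncurry w)) :
    Measurable fun q : (Ed d × Ed d) × ℝ => incr (fun x => w x q.2) q.1 :=
  (hw.comp (measurable_fst.fst.prodMk measurable_snd)).sub
    (hw.comp (measurable_fst.snd.prodMk measurable_snd))

lemma measurable_energySq_time (hw : Measurable (Function.uncurry w)) :
    Measurable fun t => energySq d s κ (fun x => w x t) := by
  have h : Measurable fun q : ℝ × (Ed d × Ed d) =>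
      ENNReal.ofReal (incr (fun x => w x q.1) q.2 ^ 2) :=
    (((measurable_incr_time hw).comp measurable_swap).pow_const 2).ennreal_ofReal
  exact h.lintegral_prod_right'

lemma energySq_timeInt_le (hw : Measurable (Function.uncurry w)) (hab : a < b)
    (hB : ∀ t ∈ Ioc a b, ∀ x, |w x t| ≤ B) :
    energySq d s κ (timeInt w a b) ≤
      ENNReal.ofReal (b - a) * ∫⁻ t in Ioc a b, energySq d s κ (fun x => w x t) := by
  have hba : 0 < b - a := sub_pos.2 hab
  have hmi := measurable_incr_time hw
  have hpt : ∀ p, ENNReal.ofReal (incr (timeInt w a b) p ^ 2) ≤ ENNReal.ofReal (b - a) *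
      ∫⁻ t in Ioc a b, ENNReal.ofReal (incr (fun x => w x t) p ^ 2) := fun p => by
    set g : ℝ → ℝ := (Ioc a b).indicator fun t => incr (fun x => w x t) p with hg
    have hm0 : Measurable fun t => incr (fun x => w x t) p := hmi.comp measurable_prodMk_left
    have hgm : Measurable g := hm0.indicator measurableSet_Ioc
    have hgB : ∀ t, |g t| ≤ |B| + |B| := fun t => by
      by_cases ht : t ∈ Ioc a b
      · rw [hg, indicator_of_mem ht]
        exact (abs_sub _ _).trans (add_le_add ((hB t ht _).trans (le_abs_self _))
          ((hB t ht _).trans (le_abs_self _)))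
      · rw [hg, indicator_of_notMem ht]
        simp only [abs_zero]
        positivity
    have hI : Integrable (fun _ : ℝ => 1 / (b - a)) (volume.restrict (Ioc a b)) :=
      integrable_const _
    have h1 : ∫ _t in Ioc a b, 1 / (b - a) = 1 := by
      simp [Measure.real, hab.le, hba.ne']
    have hJ := sq_integral_mul_le (fun _ => by positivity) hI h1 hgm hgB
    rw [integral_const_mul, integral_const_mul] at hJ
    have e1 : ∫ t in Ioc a b, g t = incr (timeInt w a b) p := by
      rw [incr_timeInt hw hB]
      exact setIntegral_congr_fun measurableSet_Ioc fun t ht => indicator_of_mem ht _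
    have i2 : Integrable (fun t => g t ^ 2) (volume.restrict (Ioc a b)) :=
      Measure.integrableOn_of_bounded (M := (|B| + |B|) ^ 2) (by simp)
        (hgm.pow_const 2).aestronglyMeasurable (.of_forall fun t => by
          rw [norm_pow]
          exact pow_le_pow_left₀ (norm_nonneg _) (hgB t) 2)
    rw [e1] at hJ
    have h2 : incr (timeInt w a b) p ^ 2 ≤ (b - a) * ∫ t in Ioc a b, g t ^ 2 := by
      rw [mul_pow, div_pow, one_pow, one_div_mul_eq_div, div_mul_eq_mul_div, one_mul] at hJ
      rw [div_le_div_iff₀ (by positivity) hba] at hJ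
      nlinarith
    refine (ENNReal.ofReal_le_ofReal h2).trans (le_of_eq ?_)
    rw [ENNReal.ofReal_mul hba.le, ofReal_integral_eq_lintegral_ofReal i2
      (.of_forall fun t => sq_nonneg _)]
    congr 1
    refine setLIntegral_congr_fun measurableSet_Ioc fun t ht => ?_
    simp only [hg, indicator_of_mem ht]
  have hG : Measurable fun q : (Ed d × Ed d) × ℝ =>
      ENNReal.ofReal (incr (fun x => w x q.2) q.1 ^ 2) := (hmi.pow_const 2).ennreal_ofReal
  calc energySq d s κ (timeInt w a b)
      ≤ ∫⁻ p, ENNReal.ofReal (b - a) *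
        (∫⁻ t in Ioc a b, ENNReal.ofReal (incr (fun x => w x t) p ^ 2))
        ∂(jumpMeasure d s κ) := lintegral_mono hpt
    _ = ENNReal.ofReal (b - a) * ∫⁻ p,
        (∫⁻ t in Ioc a b, ENNReal.ofReal (incr (fun x => w x t) p ^ 2))
        ∂(jumpMeasure d s κ) := lintegral_const_mul' _ _ ENNReal.ofReal_ne_top
    _ = _ := by
        rw [lintegral_lintegral_swap hG.aemeasurable]
        rfl

/-- Time integrals of bounded functions with integrable energy are energy test functions. -/
lemma energyTest_timeInt (hw : Measurable (Function.uncurry w)) (hab : a < b)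
    (hB : ∀ t ∈ Ioc a b, ∀ x, |w x t| ≤ B) {M : ℝ≥0∞} (hM : M < ⊤)
    (hint : ∀ t ∈ Ioc a b, ∫⁻ x, ENNReal.ofReal |w x t| ∂(weightMeasure ρ) ≤ M)
    (he : ∫⁻ t in Ioc a b, energySq d s κ (fun x => w x t) < ⊤) :
    EnergyTest d s κ ρ (timeInt w a b) := by
  have hm := measurable_timeInt hw a b
  refine ⟨finiteEnergy_of_energySq_lt_top hm ((energySq_timeInt_le hw hab hB).trans_lt
    (ENNReal.mul_lt_top ENNReal.ofReal_lt_top he)), ⟨_, abs_timeInt_le hab.le hB⟩,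
    hm.aestronglyMeasurable, ?_⟩
  have hG : Measurable fun q : Ed d × ℝ => ENNReal.ofReal |w q.1 q.2| :=
    (continuous_abs.measurable.comp hw).ennreal_ofReal
  calc ∫⁻ x, ‖timeInt w a b x‖ₑ ∂(weightMeasure ρ)
      ≤ ∫⁻ x, (∫⁻ t in Ioc a b, ENNReal.ofReal |w x t|) ∂(weightMeasure ρ) := by
        refine lintegral_mono fun x => (enorm_integral_le_lintegral_enorm _).trans ?_
        simp only [Real.enorm_eq_ofReal_abs]
        exact le_rfl
    _ = ∫⁻ t in Ioc a b, (∫⁻ x, ENNReal.ofReal |w x t| ∂(weightMeasure ρ)) :=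
        lintegral_lintegral_swap hG.aemeasurable
    _ ≤ ∫⁻ t in Ioc a b, M := setLIntegral_mono measurable_const hint
    _ < ⊤ := by
        rw [setLIntegral_const, Real.volume_Ioc]
        exact ENNReal.mul_lt_top hM ENNReal.ofReal_lt_top

/-- Exchange of a weighted space integral and a time integral. -/
lemma integral_mul_timeInt {g : Ed d → ℝ}
    (hgi : Integrable g (weightMeasure ρ))
    (hw : Measurable (Function.uncurry w)) (hB : ∀ t ∈ Ioc a b, ∀ x, |w x t| ≤ B) :
    IntegrableOn (fun t => ∫ x, g x * w x t ∂(weightMeasure ρ)) (Ioc a b) ∧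
    ∫ x, g x * timeInt w a b x ∂(weightMeasure ρ) =
      ∫ t in Ioc a b, ∫ x, g x * w x t ∂(weightMeasure ρ) := by
  have hI : Integrable (fun q : Ed d × ℝ => g q.1 * w q.1 q.2)
      ((weightMeasure ρ).prod (volume.restrict (Ioc a b))) := by
    have h1 : Integrable (fun q : Ed d × ℝ => g q.1)
        ((weightMeasure ρ).prod (volume.restrict (Ioc a b))) := hgi.comp_fst _
    refine h1.mul_bdd (c := B) (g := fun q : Ed d × ℝ => w q.1 q.2) hw.aestronglyMeasurable ?_
    have h2 : ∀ᵐ q : Ed d × ℝ ∂((weightMeasure ρ).prod (volume.restrict (Ioc a b))),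
        q.2 ∈ Ioc a b := by
      have := Measure.quasiMeasurePreserving_snd (μ := weightMeasure ρ)
        (ν := volume.restrict (Ioc a b))
      exact this.ae (ae_restrict_mem measurableSet_Ioc)
    filter_upwards [h2] with q hq
    exact hB _ hq _
  refine ⟨hI.integral_prod_right, ?_⟩
  rw [← integral_integral_swap (f := fun x t => g x * w x t) hI]
  simp only [timeInt, integral_const_mul]

end TimeIntegral

/-! ### Approximation of solutions by resolvent iterations -/

section CleanSolution

variable {d : ℕ} {s κ γ c C m : ℝ} {ρ : Ed d → ℝ}

/-- A representative of a weak solution for which all integrated identities hold between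
any two times of a set `𝒯` of full measure. -/
structure CleanSol (d : ℕ) (s κ m : ℝ) (ρ : Ed d → ℝ) (u : Ed d → ℝ → ℝ) (𝒯 : Set ℝ) :
    Prop where
  measurable : Measurable (Function.uncurry u)
  nonneg : ∀ x t, 0 ≤ u x t
  bdd : ∀ τ, 0 < τ → ∃ B, ∀ t, τ < t → ∀ x, u x t ≤ B
  mass : ∃ M, ∀ t, Integrable (fun x => u x t) (weightMeasure ρ) ∧
    ∫ x, u x t ∂(weightMeasure ρ) ≤ M
  finiteEnergy : ∀ t, FiniteEnergy d s κ fun x => u x t ^ m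
  energy_lt_top : ∀ a b, 0 < a → a < b →
    ∫⁻ t in Ioc a b, energySq d s κ (fun x => u x t ^ m) < ⊤
  pos : ∀ t ∈ 𝒯, 0 < t
  full : ∀ᵐ t : ℝ, 0 < t → t ∈ 𝒯
  energy_eq : ∀ a ∈ 𝒯, ∀ b ∈ 𝒯, a < b →
    EnergyEq d s κ ρ (timeInt (fun x t => u x t ^ m) a b) (fun x => u x a) (fun x => u x b)

lemma two_mul_abs_energy_le {v w : Ed d → ℝ} (hv : FiniteEnergy d s κ v)
    (hw : FiniteEnergy d s κ w) {lam : ℝ} (hlam : 0 < lam) :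
    2 * |energy d s κ v w| ≤ energy d s κ v v / lam + lam * energy d s κ w w := by
  have h1 := energy_sq_le hv hw
  have h2 := energy_self_nonneg (d := d) (s := s) (κ := κ) v
  have h3 := energy_self_nonneg (d := d) (s := s) (κ := κ) w
  have h4 : 0 ≤ energy d s κ v v / lam + lam * energy d s κ w w := by positivity
  refine abs_le_of_sq_le_sq' ?_ h4 |>.2
  rw [mul_pow, sq_abs]
  have h5 : energy d s κ v v / lam * (lam * energy d s κ w w) =
      energy d s κ v v * energy d s κ w w := by field_simp
  nlinarith [sq_nonneg (energy d s κ v v / lam - lam * energy d s κ w w)]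

namespace CleanSol

variable {u : Ed d → ℝ → ℝ} {𝒯 : Set ℝ}

lemma measurable_pow (hu : CleanSol d s κ m ρ u 𝒯) :
    Measurable (Function.uncurry fun x t => u x t ^ m) :=
  hu.measurable.pow_const m

lemma measurable_slice (hu : CleanSol d s κ m ρ u 𝒯) (t : ℝ) : Measurable fun x => u x t :=
  hu.measurable.comp measurable_prodMk_right

lemma isSource (hu : CleanSol d s κ m ρ u 𝒯) {t : ℝ} (ht : 0 < t) :
    IsSource ρ fun x => u x t := by
  obtain ⟨B, hB⟩ := hu.bdd (t / 2) (by positivity)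
  obtain ⟨M, hM⟩ := hu.mass
  exact ⟨hu.measurable_slice t, fun x => hu.nonneg x t, ⟨B, hB t (by linarith)⟩, (hM t).1⟩

lemma pow_bdd (hu : CleanSol d s κ m ρ u 𝒯) (hm : 1 < m) {a : ℝ} (ha : 0 < a) (b : ℝ) :
    ∃ B, 0 ≤ B ∧ ∀ t ∈ Ioc a b, ∀ x, |u x t ^ m| ≤ B := by
  obtain ⟨B, hB⟩ := hu.bdd a ha
  refine ⟨|B| ^ m, by positivity, fun t ht x => ?_⟩
  rw [abs_of_nonneg (Real.rpow_nonneg (hu.nonneg x t) m)]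
  exact Real.rpow_le_rpow (hu.nonneg x t) ((hB t ht.1 x).trans (le_abs_self B)) (by linarith)

lemma pow_le_mul (hu : CleanSol d s κ m ρ u 𝒯) (hm : 1 < m) {a : ℝ} (ha : 0 < a) :
    ∃ B, 0 ≤ B ∧ ∀ t, a < t → ∀ x, u x t ^ m ≤ B * u x t := by
  obtain ⟨B, hB⟩ := hu.bdd a ha
  refine ⟨|B| ^ (m - 1), by positivity, fun t ht x => ?_⟩
  have h0 := hu.nonneg x t
  rcases h0.eq_or_lt with h1 | h1
  · rw [← h1, Real.zero_rpow (by linarith), mul_zero]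
  · have e : u x t ^ m = u x t ^ (m - 1) * u x t := by
      rw [← Real.rpow_add_one h1.ne', sub_add_cancel]
    rw [e]
    exact mul_le_mul_of_nonneg_right (Real.rpow_le_rpow h0
      ((hB t ht x).trans (le_abs_self B)) (by linarith)) h0

lemma energyTest_pow (hu : CleanSol d s κ m ρ u 𝒯) (hm : 1 < m) {t : ℝ} (ht : 0 < t) :
    EnergyTest d s κ ρ fun x => u x t ^ m := by
  obtain ⟨B, -, hB⟩ := hu.pow_bdd hm (half_pos ht) t
  obtain ⟨K, -, hK⟩ := hu.pow_le_mul hm (half_pos ht)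
  have ht2 : t / 2 < t := by linarith
  refine ⟨hu.finiteEnergy t, ⟨B, hB t ⟨ht2, le_rfl⟩⟩, ?_⟩
  refine ((hu.isSource ht).integrable.const_mul K).mono'
    (hu.finiteEnergy t).measurable.aestronglyMeasurable (.of_forall fun x => ?_)
  rw [Real.norm_eq_abs, abs_of_nonneg (Real.rpow_nonneg (hu.nonneg x t) m)]
  exact hK t ht2 x

lemma energyTest_timeInt (hu : CleanSol d s κ m ρ u 𝒯) (hm : 1 < m) {a b : ℝ} (ha : 0 < a)
    (hab : a < b) : EnergyTest d s κ ρ (timeInt (fun x t => u x t ^ m) a b) := by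
  obtain ⟨B, -, hB⟩ := hu.pow_bdd hm ha b
  obtain ⟨K, hK0, hK⟩ := hu.pow_le_mul hm ha
  obtain ⟨M, hM⟩ := hu.mass
  refine _root_.energyTest_timeInt hu.measurable_pow hab hB (M := ENNReal.ofReal (K * M))
    ENNReal.ofReal_lt_top (fun t ht => ?_) (hu.energy_lt_top a b ha hab)
  have hI := (hM t).1
  calc ∫⁻ x, ENNReal.ofReal |u x t ^ m| ∂(weightMeasure ρ)
      ≤ ∫⁻ x, ENNReal.ofReal (K * u x t) ∂(weightMeasure ρ) := by
        refine lintegral_mono fun x => ENNReal.ofReal_le_ofReal ?_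
        rw [abs_of_nonneg (Real.rpow_nonneg (hu.nonneg x t) m)]
        exact hK t ht.1 x
    _ = ENNReal.ofReal (∫ x, K * u x t ∂(weightMeasure ρ)) :=
        (ofReal_integral_eq_lintegral_ofReal (hI.const_mul K)
          (.of_forall fun x => mul_nonneg hK0 (hu.nonneg x t))).symm
    _ ≤ _ := by
        rw [integral_const_mul]
        exact ENNReal.ofReal_le_ofReal (mul_le_mul_of_nonneg_left (hM t).2 hK0)

lemma integrableOn_energy (hu : CleanSol d s κ m ρ u 𝒯) {a b : ℝ} (ha : 0 < a) (hab : a < b) :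
    IntegrableOn (fun t => energy d s κ (fun x => u x t ^ m) (fun x => u x t ^ m))
      (Ioc a b) ∧
    ENNReal.ofReal
      (∫ t in Ioc a b, energy d s κ (fun x => u x t ^ m) (fun x => u x t ^ m)) =
      ∫⁻ t in Ioc a b, energySq d s κ (fun x => u x t ^ m) := by
  have hm := measurable_energySq_time (s := s) (κ := κ) hu.measurable_pow
  have e : ∀ t, energy d s κ (fun x => u x t ^ m) (fun x => u x t ^ m) =
      (energySq d s κ fun x => u x t ^ m).toReal := fun t => by
    rw [← (hu.finiteEnergy t).ofReal_energy, ENNReal.toReal_ofReal (energy_self_nonneg _)]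
  have hI : IntegrableOn (fun t => energy d s κ (fun x => u x t ^ m) (fun x => u x t ^ m))
      (Ioc a b) := by
    simp only [e]
    exact integrable_toReal_of_lintegral_ne_top hm.aemeasurable
      (hu.energy_lt_top a b ha hab).ne
  refine ⟨hI, ?_⟩
  rw [ofReal_integral_eq_lintegral_ofReal hI (.of_forall fun t => energy_self_nonneg _)]
  exact lintegral_congr fun t => (hu.finiteEnergy t).ofReal_energy

lemma energy_timeInt_le (hu : CleanSol d s κ m ρ u 𝒯) (hm : 1 < m) {a b : ℝ} (ha : 0 < a)
    (hab : a < b) :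
    energy d s κ (timeInt (fun x t => u x t ^ m) a b) (timeInt (fun x t => u x t ^ m) a b) ≤
      (b - a) * ∫ t in Ioc a b, energy d s κ (fun x => u x t ^ m) (fun x => u x t ^ m) := by
  obtain ⟨B, -, hB⟩ := hu.pow_bdd hm ha b
  have h1 := energySq_timeInt_le (s := s) (κ := κ) hu.measurable_pow hab hB
  rw [← (hu.energyTest_timeInt hm ha hab).toFiniteEnergy.ofReal_energy,
    ← (hu.integrableOn_energy ha hab).2, ← ENNReal.ofReal_mul (sub_nonneg.2 hab.le)] at h1
  refine (ENNReal.ofReal_le_ofReal_iff (mul_nonneg (sub_nonneg.2 hab.le) ?_)).1 h1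
  exact integral_nonneg fun t => energy_self_nonneg _

lemma energy_timeInt_le_of_subset (hu : CleanSol d s κ m ρ u 𝒯) (hm : 1 < m) {a b a' b' : ℝ}
    (ha : 0 < a) (haa : a ≤ a') (hab' : a' < b') (hbb : b' ≤ b) :
    energy d s κ (timeInt (fun x t => u x t ^ m) a' b')
      (timeInt (fun x t => u x t ^ m) a' b') ≤
      (b - a) * ∫ t in Ioc a b, energy d s κ (fun x => u x t ^ m) (fun x => u x t ^ m) := by
  refine (hu.energy_timeInt_le hm (ha.trans_le haa) hab').trans ?_
  refine mul_le_mul (by linarith) ?_ (integral_nonneg fun t => energy_self_nonneg _)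
    (by linarith)
  exact setIntegral_mono_set (hu.integrableOn_energy ha (by linarith)).1
    (.of_forall fun t => energy_self_nonneg _) (Ioc_subset_Ioc haa hbb).eventuallyLE

/-- One step of the comparison between a solution and a resolvent iteration. -/
lemma resolvent_step (hu : CleanSol d s κ m ρ u 𝒯) (hm : 1 < m) {a b : ℝ} (ha : a ∈ 𝒯)
    (hb : b ∈ 𝒯) (hab : a < b) {f g Z : Ed d → ℝ} (hf : IsSource ρ f)
    (hg : IsResolvent d s κ m (b - a) ρ f g) (hZ : EnergyTest d s κ ρ Z)
    (hZe : EnergyEq d s κ ρ Z f fun x => u x a) {Z' : Ed d → ℝ}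
    (hZ' : Z' = fun x => Z x + (timeInt (fun x t => u x t ^ m) a b x - (b - a) * g x ^ m)) :
    EnergyTest d s κ ρ Z' ∧ EnergyEq d s κ ρ Z' g (fun x => u x b) ∧
    energy d s κ Z' Z' ≤ energy d s κ Z Z + 3 * (b - a) *
      ∫ t in Ioc a b, energy d s κ (fun x => u x t ^ m) (fun x => u x t ^ m) := by
  have ha0 := hu.pos a ha
  have hb0 := hu.pos b hb
  have hlam : 0 < b - a := sub_pos.2 hab
  set lam := b - a with hlamdef
  set w : Ed d → ℝ → ℝ := fun x t => u x t ^ m with hw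
  set V := timeInt w a b with hV
  set v : Ed d → ℝ := fun x => g x ^ m with hv
  set Δ : Ed d → ℝ := fun x => V x - lam * v x with hΔ
  set I := ∫ t in Ioc a b, energy d s κ (fun x => w x t) (fun x => w x t) with hI
  have tV : EnergyTest d s κ ρ V := hu.energyTest_timeInt hm ha0 hab
  have tv : EnergyTest d s κ ρ v := hg.test
  have tlv : EnergyTest d s κ ρ (fun x => lam * v x) := tv.const_mul lam
  have tΔ : EnergyTest d s κ ρ Δ := tV.sub tlv
  have tZ' : EnergyTest d s κ ρ Z' := hZ' ▸ hZ.add tΔ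
  have sa := hu.isSource ha0
  have sb := hu.isSource hb0
  have sg := hg.toIsSource
  have eZ' : EnergyEq d s κ ρ Z' g (fun x => u x b) := by
    intro φ hφ
    rw [hZ', energy_add_left hZ.toFiniteEnergy tΔ.toFiniteEnergy hφ.toFiniteEnergy,
      energy_sub_left tV.toFiniteEnergy tlv.toFiniteEnergy hφ.toFiniteEnergy,
      energy_const_mul_left, hg.energy_eq φ hφ, hZe φ hφ, hu.energy_eq a ha b hb hab φ hφ]
    rw [← integral_sub (sa.integrable_sub_mul sb hφ) (hf.integrable_sub_mul sg hφ)]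
    have i3 : Integrable (fun x => (u x a - u x b) * φ x - (f x - g x) * φ x)
        (weightMeasure ρ) := (sa.integrable_sub_mul sb hφ).sub (hf.integrable_sub_mul sg hφ)
    rw [← integral_add (hf.integrable_sub_mul sa hφ) i3]
    exact integral_congr_ae (.of_forall fun x => by ring)
  refine ⟨tZ', eZ', ?_⟩
  obtain ⟨B, hB0, hB⟩ := hu.pow_bdd hm ha0 b
  obtain ⟨Bv, hBv⟩ := tv.bdd
  have hwm : Measurable (Function.uncurry w) := hu.measurable_pow
  -- the pointwise-in-time estimate
  have key : ∀ t ∈ Ioo a b, t ∈ 𝒯 →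
      2 * ∫ x, (g x - u x b) * (w x t - v x) ∂(weightMeasure ρ) ≤
        2 * I + lam * energy d s κ (fun x => w x t) (fun x => w x t)
          - 2 * energy d s κ V v + lam * energy d s κ v v := by
    intro t ht htT
    have ht0 := hu.pos t htT
    have st := hu.isSource ht0
    have tw : EnergyTest d s κ ρ (fun x => w x t) := hu.energyTest_pow hm ht0
    have twv := tw.sub tv
    set V1 := timeInt w a t with hV1
    set V2 := timeInt w t b with hV2
    have tV1 : EnergyTest d s κ ρ V1 := hu.energyTest_timeInt hm ha0 ht.1
    have tV2 : EnergyTest d s κ ρ V2 := hu.energyTest_timeInt hm ht0 ht.2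
    have hVs : V = fun x => V1 x + V2 x :=
      funext fun x => timeInt_add hwm ht.1.le ht.2.le hB x
    have h1 : ∫ x, (g x - u x b) * (w x t - v x) ∂(weightMeasure ρ) ≤
        ∫ x, (u x t - u x b) * (w x t - v x) ∂(weightMeasure ρ) := by
      refine integral_mono (sg.integrable_sub_mul sb twv) (st.integrable_sub_mul sb twv)
        fun x => ?_
      simp only [hw, hv]
      rcases le_total (g x) (u x t) with h | h
      · have := Real.rpow_le_rpow (sg.nonneg x) h (by linarith : 0 ≤ m)
        exact mul_le_mul_of_nonneg_right (by linarith) (by linarith)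
      · have := Real.rpow_le_rpow (hu.nonneg x t) h (by linarith : 0 ≤ m)
        exact mul_le_mul_of_nonpos_right (by linarith) (by linarith)
    have h2 := hu.energy_eq t htT b hb ht.2 _ twv
    rw [energy_sub_right tw.toFiniteEnergy tv.toFiniteEnergy tV2.toFiniteEnergy] at h2
    have h3 : energy d s κ V v = energy d s κ V1 v + energy d s κ V2 v := by
      rw [hVs, energy_add_left tV1.toFiniteEnergy tV2.toFiniteEnergy tv.toFiniteEnergy]
    have h4 := two_mul_abs_energy_le tV2.toFiniteEnergy tw.toFiniteEnergy hlam
    have h5 := two_mul_abs_energy_le tV1.toFiniteEnergy tv.toFiniteEnergy hlam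
    have h6 : energy d s κ V1 V1 / lam ≤ I := by
      rw [div_le_iff₀' hlam]
      exact hu.energy_timeInt_le_of_subset hm ha0 le_rfl ht.1 ht.2.le
    have h7 : energy d s κ V2 V2 / lam ≤ I := by
      rw [div_le_iff₀' hlam]
      exact hu.energy_timeInt_le_of_subset hm ha0 ht.1.le ht.2 le_rfl
    have h8 := le_abs_self (energy d s κ V2 fun x => w x t)
    have h9 := le_abs_self (energy d s κ V1 v)
    linarith
  -- integration in time
  have hgu : Integrable (fun x => g x - u x b) (weightMeasure ρ) :=
    sg.integrable.sub sb.integrable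
  have hw' : Measurable (Function.uncurry fun x t => w x t - v x) :=
    hwm.sub (tv.measurable.comp measurable_fst)
  have hB' : ∀ t ∈ Ioc a b, ∀ x, |w x t - v x| ≤ B + Bv := fun t ht x =>
    (abs_sub _ _).trans (add_le_add (hB t ht x) (hBv x))
  obtain ⟨i1, e1⟩ := integral_mul_timeInt hgu hw' hB'
  have hΔ' : timeInt (fun x t => w x t - v x) a b = Δ := by
    funext x
    simp only [timeInt, hΔ, hV]
    rw [integral_sub (integrableOn_time hwm hB x) (integrable_const _)]
    simp [Measure.real, hab.le, hlamdef]
  rw [hΔ'] at e1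
  have e2 : energy d s κ Z' Δ = ∫ x, (g x - u x b) * Δ x ∂(weightMeasure ρ) := eZ' Δ tΔ
  have iE : IntegrableOn (fun t => energy d s κ (fun x => w x t) fun x => w x t) (Ioc a b) :=
    (hu.integrableOn_energy ha0 hab).1
  have i2 : IntegrableOn (fun t => 2 * I + lam * energy d s κ (fun x => w x t)
      (fun x => w x t) - 2 * energy d s κ V v + lam * energy d s κ v v) (Ioc a b) :=
    (((integrable_const _).add (iE.const_mul lam)).sub (integrable_const _)).add
      (integrable_const _)
  have hmono : ∫ t in Ioc a b, 2 * ∫ x, (g x - u x b) * (w x t - v x) ∂(weightMeasure ρ) ≤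
      ∫ t in Ioc a b, (2 * I + lam * energy d s κ (fun x => w x t)
      (fun x => w x t) - 2 * energy d s κ V v + lam * energy d s κ v v) := by
    refine setIntegral_mono_ae_restrict (i1.const_mul 2) i2 ?_
    have hne : ∀ᵐ t : ℝ ∂(volume.restrict (Ioc a b)), t ≠ b :=
      ae_restrict_of_ae (by simp [ae_iff])
    filter_upwards [ae_restrict_mem measurableSet_Ioc, ae_restrict_of_ae hu.full, hne]
      with t ht htT htb
    exact key t ⟨ht.1, lt_of_le_of_ne ht.2 htb⟩ (htT (ha0.trans ht.1))
  have hval : ∫ t in Ioc a b, (2 * I + lam * energy d s κ (fun x => w x t)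
      (fun x => w x t) - 2 * energy d s κ V v + lam * energy d s κ v v) =
      lam * (2 * I) + lam * I - lam * (2 * energy d s κ V v)
        + lam * (lam * energy d s κ v v) := by
    have j1 : Integrable (fun t => 2 * I + lam * energy d s κ (fun x => w x t)
      (fun x => w x t)) (volume.restrict (Ioc a b)) :=
      (integrable_const _).add (iE.const_mul lam)
    have j2 : Integrable (fun t => 2 * I + lam * energy d s κ (fun x => w x t)
      (fun x => w x t) - 2 * energy d s κ V v) (volume.restrict (Ioc a b)) :=
      j1.sub (integrable_const _)
    rw [integral_add j2 (integrable_const _), integral_sub j1 (integrable_const _),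
      integral_add (integrable_const _) (iE.const_mul lam), integral_const_mul lam]
    have hvol : volume.real (Ioc a b) = lam := by simp [Measure.real, hab.le, hlamdef]
    simp only [setIntegral_const, smul_eq_mul, hvol]
    rw [← hI]
  rw [integral_const_mul, ← e1, ← e2, hval] at hmono
  have eΔ : energy d s κ Δ Δ = energy d s κ V V - 2 * lam * energy d s κ V v +
      lam ^ 2 * energy d s κ v v := by
    rw [hΔ, energy_sub_left tV.toFiniteEnergy tlv.toFiniteEnergy tΔ.toFiniteEnergy,
      energy_sub_right tV.toFiniteEnergy tlv.toFiniteEnergy tV.toFiniteEnergy,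
      energy_sub_right tV.toFiniteEnergy tlv.toFiniteEnergy tlv.toFiniteEnergy,
      energy_const_mul_left, energy_const_mul_left, energy_const_mul_right,
      energy_const_mul_right, energy_comm v V]
    ring
  have eZ : energy d s κ Z' Z' = energy d s κ Z Z + 2 * energy d s κ Z' Δ -
      energy d s κ Δ Δ := by
    rw [hZ', energy_add_left hZ.toFiniteEnergy tΔ.toFiniteEnergy
        (hZ.add tΔ).toFiniteEnergy,
      energy_add_left hZ.toFiniteEnergy tΔ.toFiniteEnergy tΔ.toFiniteEnergy,
      energy_add_right hZ.toFiniteEnergy tΔ.toFiniteEnergy hZ.toFiniteEnergy,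
      energy_add_right hZ.toFiniteEnergy tΔ.toFiniteEnergy tΔ.toFiniteEnergy,
      energy_comm Δ Z]
    ring
  have hVV := energy_self_nonneg (d := d) (s := s) (κ := κ) V
  nlinarith

end CleanSol

end CleanSolution

/-! ### Propagation of potential comparison in time -/

section Propagation

variable {d : ℕ} {s κ γ c C m : ℝ} {ρ : Ed d → ℝ}

lemma energyEq_zero (f : Ed d → ℝ) : EnergyEq d s κ ρ (fun _ => 0) f f := fun φ _ => by
  simp [energy, incr]

/-- The energy dissipated by a solution in the time interval `(a, b]`. -/
def dissipation (d : ℕ) (s κ m : ℝ) (u : Ed d → ℝ → ℝ) (a b : ℝ) : ℝ :=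
  ∫ t in Ioc a b, energy d s κ (fun x => u x t ^ m) (fun x => u x t ^ m)

lemma CleanSol.dissipation_add {u : Ed d → ℝ → ℝ} {𝒯 : Set ℝ} (hu : CleanSol d s κ m ρ u 𝒯)
    {a e b : ℝ} (ha : 0 < a) (hae : a ≤ e) (heb : e < b) :
    dissipation d s κ m u a b = dissipation d s κ m u a e + dissipation d s κ m u e b := by
  have h := (hu.integrableOn_energy ha (hae.trans_lt heb)).1
  simp only [dissipation]
  rw [← Ioc_union_Ioc_eq_Ioc hae heb.le]
  exact setIntegral_union (Ioc_disjoint_Ioc_of_le le_rfl) measurableSet_Ioc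
    (h.mono_set (Ioc_subset_Ioc_right heb.le)) (h.mono_set (Ioc_subset_Ioc_left hae))

/-- Data produced by a resolvent iteration started from `u · a` and run up to time `b`: the
iterate `f` and the discrepancy `Z`. -/
structure IterData (d : ℕ) (s κ m lam : ℝ) (ρ : Ed d → ℝ) (u : Ed d → ℝ → ℝ) (a b : ℝ)
    (f Z : Ed d → ℝ) : Prop where
  isSource : IsSource ρ f
  test : EnergyTest d s κ ρ Z
  energy_eq : EnergyEq d s κ ρ Z f fun x => u x b
  energy_le : energy d s κ Z Z ≤ 3 * lam * dissipation d s κ m u a b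

lemma CleanSol.iterData_zero {u : Ed d → ℝ → ℝ} {𝒯 : Set ℝ} (hu : CleanSol d s κ m ρ u 𝒯)
    {a : ℝ} (ha : 0 < a) (lam : ℝ) :
    IterData d s κ m lam ρ u a a (fun x => u x a) fun _ => 0 :=
  ⟨hu.isSource ha, .zero, energyEq_zero _, by simp [energy, incr, dissipation]⟩

lemma CleanSol.iterData_step {u : Ed d → ℝ → ℝ} {𝒯 : Set ℝ} (hu : CleanSol d s κ m ρ u 𝒯)
    (hm : 1 < m) {a e b lam : ℝ} (ha : 0 < a) (hae : a ≤ e) (he : e ∈ 𝒯) (hb : b ∈ 𝒯)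
    (hlam : 0 < lam) (heb : b - e = lam) {f Z g : Ed d → ℝ}
    (hi : IterData d s κ m lam ρ u a e f Z) (hg : IsResolvent d s κ m lam ρ f g) :
    IterData d s κ m lam ρ u a b g fun x =>
      Z x + (timeInt (fun x t => u x t ^ m) e b x - lam * g x ^ m) := by
  subst heb
  obtain ⟨h1, h2, h3⟩ := hu.resolvent_step hm he hb (sub_pos.1 hlam) hi.isSource hg hi.test
    hi.energy_eq rfl
  refine ⟨hg.toIsSource, h1, h2, h3.trans ?_⟩
  rw [hu.dissipation_add ha hae (sub_pos.1 hlam), mul_add]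
  exact add_le_add hi.energy_le le_rfl

variable {u₁ u₂ : Ed d → ℝ → ℝ} {𝒯₁ 𝒯₂ : Set ℝ} {a₁ a₂ : ℝ}

lemma exists_iterData (h : Setup d s κ γ c C ρ) (hm : 1 < m) (hu₁ : CleanSol d s κ m ρ u₁ 𝒯₁)
    (hu₂ : CleanSol d s κ m ρ u₂ 𝒯₂) (ha₁ : 0 < a₁) (ha₂ : 0 < a₂) {lam : ℝ} (hlam : 0 < lam)
    {D : Ed d → ℝ} (hD : EnergyDecaying d s κ ρ D)
    (hDe : EnergyEq d s κ ρ D (fun x => u₂ x a₂) fun x => u₁ x a₁) {ε : ℝ} (hε : 0 < ε)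
    (hle : ∀ᵐ x ∂(weightMeasure ρ), D x ≤ ε) (N : ℕ)
    (hN : ∀ k : ℕ, k ≤ N → a₁ + k * lam ∈ 𝒯₁ ∧ a₂ + k * lam ∈ 𝒯₂) :
    ∃ f₁ f₂ Z₁ Z₂ D' : Ed d → ℝ, IterData d s κ m lam ρ u₁ a₁ (a₁ + N * lam) f₁ Z₁ ∧
      IterData d s κ m lam ρ u₂ a₂ (a₂ + N * lam) f₂ Z₂ ∧ EnergyDecaying d s κ ρ D' ∧
      EnergyEq d s κ ρ D' f₂ f₁ ∧ (∀ᵐ x ∂(weightMeasure ρ), D' x ≤ ε) ∧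
      ∀ x, D' x = D x - timeInt (fun x t => u₂ x t ^ m) a₂ (a₂ + N * lam) x
        + timeInt (fun x t => u₁ x t ^ m) a₁ (a₁ + N * lam) x + Z₂ x - Z₁ x := by
  induction N with
  | zero =>
    refine ⟨_, _, fun _ => 0, fun _ => 0, D, ?_, ?_, hD, hDe, hle, ?_⟩
    · simpa using hu₁.iterData_zero ha₁ lam
    · simpa using hu₂.iterData_zero ha₂ lam
    · intro x
      simp [timeInt]
  | succ N ih =>
    obtain ⟨f₁, f₂, Z₁, Z₂, D', i₁, i₂, hD', hD'e, hD'le, hD'x⟩ :=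
      ih fun k hk => hN k (hk.trans N.le_succ)
    obtain ⟨g₁, hg₁⟩ := exists_isResolvent h hm hlam i₁.isSource
    obtain ⟨g₂, hg₂⟩ := exists_isResolvent h hm hlam i₂.isSource
    obtain ⟨k1, k2, k3⟩ := energyEq_resolvent_step h (by linarith) hlam i₂.isSource i₁.isSource
      hD' hD'e hg₂ hg₁ hε hD'le
    have hNl : 0 ≤ N * lam := by positivity
    have e₁ : a₁ + ((N + 1 : ℕ) : ℝ) * lam - (a₁ + N * lam) = lam := by push_cast; ring
    have e₂ : a₂ + ((N + 1 : ℕ) : ℝ) * lam - (a₂ + N * lam) = lam := by push_cast; ring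
    refine ⟨g₁, g₂, _, _, _,
      hu₁.iterData_step hm ha₁ (by linarith) (hN N N.le_succ).1 (hN _ le_rfl).1 hlam e₁ i₁ hg₁,
      hu₂.iterData_step hm ha₂ (by linarith) (hN N N.le_succ).2 (hN _ le_rfl).2 hlam e₂ i₂ hg₂,
      k1, k2, k3, fun x => ?_⟩
    obtain ⟨B₁, -, hB₁⟩ := hu₁.pow_bdd hm ha₁ (a₁ + ((N + 1 : ℕ) : ℝ) * lam)
    obtain ⟨B₂, -, hB₂⟩ := hu₂.pow_bdd hm ha₂ (a₂ + ((N + 1 : ℕ) : ℝ) * lam)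
    rw [hD'x x,
      timeInt_add hu₁.measurable_pow (e := a₁ + N * lam) (by linarith) (by linarith) hB₁ x,
      timeInt_add hu₂.measurable_pow (e := a₂ + N * lam) (by linarith) (by linarith) hB₂ x]
    ring

/-- Comparison of potentials propagates to later times. -/
lemma ae_potential_le (h : Setup d s κ γ c C ρ) (hm : 1 < m) (hu₁ : CleanSol d s κ m ρ u₁ 𝒯₁)
    (hu₂ : CleanSol d s κ m ρ u₂ 𝒯₂) (ha₁ : 0 < a₁) (ha₂ : 0 < a₂) {T : ℝ} (hT : 0 < T)
    (hN : ∀ N k : ℕ, k ≤ N + 1 → a₁ + k * (T / (N + 1)) ∈ 𝒯₁ ∧ a₂ + k * (T / (N + 1)) ∈ 𝒯₂)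
    {D : Ed d → ℝ} (hD : EnergyDecaying d s κ ρ D)
    (hDe : EnergyEq d s κ ρ D (fun x => u₂ x a₂) fun x => u₁ x a₁) {ε : ℝ} (hε : 0 < ε)
    (hle : ∀ᵐ x ∂(weightMeasure ρ), D x ≤ ε) :
    ∀ᵐ x ∂(weightMeasure ρ), D x - timeInt (fun x t => u₂ x t ^ m) a₂ (a₂ + T) x
      + timeInt (fun x t => u₁ x t ^ m) a₁ (a₁ + T) x ≤ ε := by
  set F : Ed d → ℝ := fun x => D x - timeInt (fun x t => u₂ x t ^ m) a₂ (a₂ + T) x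
      + timeInt (fun x t => u₁ x t ^ m) a₁ (a₁ + T) x with hF
  have tF : EnergyDecaying d s κ ρ F :=
    (hD.sub (hu₂.energyTest_timeInt hm ha₂ (by linarith)).energyDecaying).add
      (hu₁.energyTest_timeInt hm ha₁ (by linarith)).energyDecaying
  set P : Ed d → ℝ := fun x => max (F x - ε) 0 with hP
  have tP : EnergyTest d s κ ρ P := tF.posPart_sub hε
  have hP0 : ∀ x, 0 ≤ P x := fun x => le_max_right _ _
  have sP : IsSource ρ P := by
    obtain ⟨B, hB⟩ := tP.bdd
    exact ⟨tP.measurable, hP0, ⟨B, fun x => (le_abs_self _).trans (hB x)⟩, tP.integrable⟩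
  obtain ⟨K, hK⟩ := exists_integral_sq_le_energy h sP (s := s) (κ := κ)
  have iPP : Integrable (fun x => P x * P x) (weightMeasure ρ) :=
    tP.integrable_bdd_mul tP.integrable
  set A := ∫ x, P x * P x ∂(weightMeasure ρ) with hA
  have hA0 : 0 ≤ A := integral_nonneg fun x => mul_self_nonneg _
  set L := 2 * (|K| * (3 * T * dissipation d s κ m u₁ a₁ (a₁ + T)) +
    |K| * (3 * T * dissipation d s κ m u₂ a₂ (a₂ + T))) with hL
  have hbound : ∀ N : ℕ, A ^ 2 ≤ L * (1 / ((N : ℝ) + 1)) := by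
    intro N
    have hlam : 0 < T / ((N : ℝ) + 1) := by positivity
    have eT : ((N + 1 : ℕ) : ℝ) * (T / ((N : ℝ) + 1)) = T := by
      push_cast
      field_simp
    obtain ⟨f₁, f₂, Z₁, Z₂, D', i₁, i₂, -, -, hle', hx⟩ :=
      exists_iterData h hm hu₁ hu₂ ha₁ ha₂ hlam hD hDe hε hle (N + 1) (hN N)
    rw [eT] at i₁ i₂ hx
    have j₁ := tP.integrable_bdd_mul i₁.test.integrable
    have j₂ := tP.integrable_bdd_mul i₂.test.integrable
    have hAle : A ≤ (∫ x, P x * Z₁ x ∂(weightMeasure ρ)) -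
        ∫ x, P x * Z₂ x ∂(weightMeasure ρ) := by
      simp only [mul_comm (P _)]
      rw [← integral_sub j₁ j₂]
      refine integral_mono_ae iPP (j₁.sub j₂) ?_
      filter_upwards [hle'] with x hx'
      rw [hx x] at hx'
      rcases le_total (F x - ε) 0 with h0 | h0
      · have : P x = 0 := max_eq_right h0
        simp [this]
      · have h1 : P x = F x - ε := max_eq_left h0
        have h2 : P x ≤ Z₁ x - Z₂ x := by
          rw [h1]
          simp only [hF]
          linarith
        nlinarith [hP0 x]
    have q : ∀ {u : Ed d → ℝ → ℝ} {a : ℝ} {f Z : Ed d → ℝ},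
        IterData d s κ m (T / ((N : ℝ) + 1)) ρ u a (a + T) f Z →
        (∫ x, P x * Z x ∂(weightMeasure ρ)) ^ 2 ≤
          |K| * (3 * T * dissipation d s κ m u a (a + T)) * (1 / ((N : ℝ) + 1)) := by
      intro u a f Z hi
      calc _ ≤ K * energy d s κ Z Z := hK Z hi.test
        _ ≤ |K| * energy d s κ Z Z :=
          mul_le_mul_of_nonneg_right (le_abs_self K) (energy_self_nonneg Z)
        _ ≤ |K| * (3 * (T / ((N : ℝ) + 1)) * dissipation d s κ m u a (a + T)) :=
          mul_le_mul_of_nonneg_left hi.energy_le (abs_nonneg K)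
        _ = _ := by ring
    have q₁ := q i₁
    have q₂ := q i₂
    set X := ∫ x, P x * Z₁ x ∂(weightMeasure ρ)
    set Y := ∫ x, P x * Z₂ x ∂(weightMeasure ρ)
    have : A ^ 2 ≤ (X - Y) ^ 2 := pow_le_pow_left₀ hA0 hAle 2
    rw [hL]
    nlinarith [sq_nonneg (X + Y)]
  have hA2 : A ^ 2 ≤ 0 := by
    have ht : Tendsto (fun N : ℕ => L * (1 / ((N : ℝ) + 1))) atTop (𝓝 (L * 0)) :=
      tendsto_one_div_add_atTop_nhds_zero_nat.const_mul L
    rw [mul_zero] at ht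
    exact ge_of_tendsto' ht hbound
  have hAz : A = 0 := by nlinarith
  rw [hA, integral_eq_zero_iff_of_nonneg (fun x => mul_self_nonneg _) iPP] at hAz
  filter_upwards [hAz] with x hx
  have h0 : P x = 0 := mul_self_eq_zero.1 hx
  have := le_max_left (F x - ε) 0
  rw [show max (F x - ε) 0 = 0 from h0] at this
  linarith

/-- Almost every time step has all its rational multiples in a set of full measure. -/
lemma ae_forall_div_mem {𝒯 : Set ℝ} (h : ∀ᵐ t : ℝ, 0 < t → t ∈ 𝒯) {a : ℝ} (ha : 0 < a)
    (haT : a ∈ 𝒯) :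
    ∀ᵐ T : ℝ, 0 < T → ∀ N k : ℕ, a + k * (T / ((N : ℝ) + 1)) ∈ 𝒯 := by
  have key : ∀ N k : ℕ, ∀ᵐ T : ℝ, 0 < T → a + k * (T / ((N : ℝ) + 1)) ∈ 𝒯 := by
    intro N k
    rcases Nat.eq_zero_or_pos k with rfl | hk
    · simp [haT]
    · have hk' : (0 : ℝ) < k := by exact_mod_cast hk
      set r : ℝ := k / ((N : ℝ) + 1) with hr
      have hr0 : 0 < r := by positivity
      have q1 : Measure.QuasiMeasurePreserving (fun T : ℝ => r * T) volume volume := by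
        refine ⟨measurable_const_mul r, ?_⟩
        rw [Real.map_volume_mul_left hr0.ne']
        exact Measure.smul_absolutelyContinuous
      have q2 : Measure.QuasiMeasurePreserving (fun T : ℝ => a + T) volume volume :=
        (measurePreserving_add_left volume a).quasiMeasurePreserving
      filter_upwards [(q2.comp q1).ae h] with T hT hT0
      have e : a + k * (T / ((N : ℝ) + 1)) = a + r * T := by
        rw [hr]
        ring
      rw [e]
      exact hT (by
        have : 0 < r * T := by positivity
        simp only [Function.comp_apply]
        linarith)
  have := ae_all_iff.2 fun N => ae_all_iff.2 (key N)
  filter_upwards [this] with T hT hT0 N k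
  exact hT N k hT0

end Propagation

section
variable {d : ℕ} {s κ γ c C : ℝ} {ρ : Ed d → ℝ}

lemma exists_convKernel (h : Setup d s κ γ c C ρ) {r : ℝ} (hr : 0 < r) :
    ∃ k : Ed d → ℝ, Continuous k ∧ (∀ x, 0 ≤ k x) ∧ (∃ A, ∀ x, k x ≤ A) ∧
      ∀ x, ENNReal.ofReal (k x) = ∫⁻ y, truncKernel s r (x - y) * rieszKernel s y := by
  have hs := h.s_pos
  have hd0 := h.dim_pos
  set K : ℝ := subordConst d ((d : ℝ) / 2 - s) with hK
  have hK0 : 0 < K := subordConst_pos (by linarith [h.lt_dim])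
  set M : ℝ≥0∞ := ENNReal.ofReal (r ^ (-s) / s) *
    ENNReal.ofReal ((4 * Real.pi * r) ^ (-(d : ℝ) / 2))
    with hM
  have hMtop : M ≠ ⊤ := ENNReal.mul_ne_top ENNReal.ofReal_ne_top ENNReal.ofReal_ne_top
  have hle : ∀ x : Ed d, truncKernel s r x ≤ M := truncKernel_le hs hr
  set g : Ed d → ℝ := fun y => K * (truncKernel s r y).toReal with hg
  have hgi : Integrable g := (integrable_truncKernel hs hr).const_mul K
  have hg0 : ∀ y, 0 ≤ g y := fun y => mul_nonneg hK0.le ENNReal.toReal_nonneg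
  have hgM : ∀ᵐ y, g y ≤ (K * M.toReal) * ‖y‖ ^ (-(0 : ℝ)) := .of_forall fun y => by
    rw [neg_zero, Real.rpow_zero, mul_one]
    exact mul_le_mul_of_nonneg_left (ENNReal.toReal_mono hMtop (hle y)) hK0.le
  set a : ℝ := (d : ℝ) - 2 * s with ha
  have ha0 : 0 < a := by linarith [h.lt_dim]
  have haγ : a + 0 < d := by linarith
  set U : Ed d → ℝ := fun x => ∫ y, ‖x - y‖ ^ (-a) * g y with hU
  have hUc : Continuous U := continuous_potential hd0 ha0 le_rfl haγ hgi hg0 hgM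
  have hUlim : Tendsto U (cocompact (Ed d)) (𝓝 0) :=
    tendsto_potential_cocompact hd0 ha0 le_rfl haγ hgi hg0 hgM
  refine ⟨U, hUc, fun x => integral_nonneg fun y => ?_, ?_, fun x => ?_⟩
  · have := hg0 y
    positivity
  · obtain ⟨S, hS, hS2⟩ := mem_cocompact.1 (hUlim.eventually_lt_const zero_lt_one)
    obtain ⟨A, hA⟩ := hS.bddAbove_image hUc.continuousOn
    refine ⟨max 1 A, fun x => ?_⟩
    by_cases hx : x ∈ S
    · exact (hA ⟨x, hx, rfl⟩).trans (le_max_right _ _)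
    · exact (show U x < 1 from hS2 hx).le.trans (le_max_left _ _)
  · rw [← lintegral_sub_left_eq_self (fun y => truncKernel s r (x - y) * rieszKernel s y) x, hU,
      ofReal_integral_eq_lintegral_ofReal
        (integrable_norm_sub_rpow_mul hd0 ha0 le_rfl haγ hgi hg0 hgM x)
        (.of_forall fun y => by
          have := hg0 y
          simp only [Pi.zero_apply]
          positivity)]
    refine lintegral_congr_ae ((ae_ne_of_pos hd0 x).mono fun y hy => ?_)
    simp only [sub_sub_cancel]
    rw [rieszKernel_eq h.lt_dim (sub_ne_zero.2 hy.symm), ENNReal.ofReal_mul (by positivity), hg,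
      ENNReal.ofReal_mul hK0.le, ENNReal.ofReal_toReal (truncKernel_lt_top hs hr y).ne,
      ENNReal.ofReal_mul hK0.le]
    ring

/-- Truncated averages of a potential are integrals of its source against a bounded continuous
kernel. -/
lemma IsPotential.lintegral_truncKernel (h : Setup d s κ γ c C ρ) {f U : Ed d → ℝ}
    (hf : IsSource ρ f) (hU : IsPotential d s κ ρ f U) {r : ℝ} {k : Ed d → ℝ}
    (hkc : Continuous k) (hk0 : ∀ x, 0 ≤ k x) {A : ℝ} (hkA : ∀ x, k x ≤ A)
    (hk : ∀ x, ENNReal.ofReal (k x) = ∫⁻ y, truncKernel s r (x - y) * rieszKernel s y) (x : Ed d) :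
    ∫⁻ y, truncKernel s r (x - y) * ENNReal.ofReal (U y) =
      ENNReal.ofReal (1 / potConst d s κ * ∫ z, k (x - z) * f z ∂(weightMeasure ρ)) := by
  have hP := potConst_pos (d := d) h.s_pos h.s_lt_one h.κ_pos
  have hi : Integrable (fun z => k (x - z) * f z) (weightMeasure ρ) :=
    hf.integrable.bdd_mul (c := A)
      (hkc.comp (continuous_const.sub continuous_id)).aestronglyMeasurable
      (.of_forall fun z => by rw [Real.norm_eq_abs, abs_of_nonneg (hk0 _)]; exact hkA _)
  have hfm : Measurable fun z => ENNReal.ofReal (f z) := hf.measurable.ennreal_ofReal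
  have hm0 : Measurable fun p : Ed d × Ed d =>
      rieszKernel s (p.1 - p.2) * ENNReal.ofReal (f p.2) :=
    (measurable_rieszKernel.comp (measurable_fst.sub measurable_snd)).mul
      (hfm.comp measurable_snd)
  have hm : Measurable fun p : Ed d × Ed d =>
      truncKernel s r (x - p.1) * (rieszKernel s (p.1 - p.2) * ENNReal.ofReal (f p.2)) :=
    ((measurable_truncKernel r).comp (measurable_fst.const_sub x)).mul hm0
  have hm1 : Measurable fun y => ∫⁻ z, truncKernel s r (x - y) *
      (rieszKernel s (y - z) * ENNReal.ofReal (f z)) ∂(weightMeasure ρ) := hm.lintegral_prod_right'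
  calc ∫⁻ y, truncKernel s r (x - y) * ENNReal.ofReal (U y)
      = ∫⁻ y, ENNReal.ofReal (1 / potConst d s κ) * ∫⁻ z, truncKernel s r (x - y) *
          (rieszKernel s (y - z) * ENNReal.ofReal (f z)) ∂(weightMeasure ρ) := by
        refine lintegral_congr fun y => ?_
        have hm2 : Measurable fun z => rieszKernel s (y - z) * ENNReal.ofReal (f z) :=
          (measurable_rieszKernel.comp (measurable_id.const_sub y)).mul hfm
        rw [hU.ofReal_eq, lintegral_const_mul _ hm2, mul_left_comm]
    _ = ENNReal.ofReal (1 / potConst d s κ) * ∫⁻ z, (∫⁻ y, truncKernel s r (x - y) *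
          (rieszKernel s (y - z) * ENNReal.ofReal (f z))) ∂(weightMeasure ρ) := by
        rw [lintegral_const_mul _ hm1, lintegral_lintegral_swap]
        exact hm.aemeasurable
    _ = ENNReal.ofReal (1 / potConst d s κ) *
          ∫⁻ z, ENNReal.ofReal (k (x - z) * f z) ∂(weightMeasure ρ) := by
        congr 1
        refine lintegral_congr fun z => ?_
        rw [ENNReal.ofReal_mul (hk0 _), hk, ← lintegral_add_right_eq_self (fun y =>
          truncKernel s r (x - y) * (rieszKernel s (y - z) * ENNReal.ofReal (f z))) z]
        simp only [add_sub_cancel_right, ← mul_assoc]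
        rw [lintegral_mul_const]
        · simp only [sub_sub, add_comm z]
        · exact ((measurable_truncKernel r).comp ((measurable_id.add_const z).const_sub x)).mul
            measurable_rieszKernel
    _ = _ := by
        rw [ENNReal.ofReal_mul (by positivity), ofReal_integral_eq_lintegral_ofReal hi]
        exact .of_forall fun z => mul_nonneg (hk0 _) (hf.nonneg _)
end

section
variable {d : ℕ} {s κ γ c C m : ℝ} {ρ : Ed d → ℝ} {u u₁ u₂ : Ed d → ℝ → ℝ} {𝒯 𝒯₁ 𝒯₂ : Set ℝ}
  {U U₁ U₂ : ℝ → Ed d → ℝ}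

lemma Setup.forall_le_of_ae_le (h : Setup d s κ γ c C ρ) {f g : Ed d → ℝ} (hf : Continuous f)
    (hg : Continuous g) (hfg : ∀ᵐ x ∂(weightMeasure ρ), f x ≤ g x) (x : Ed d) : f x ≤ g x := by
  have h1 : ∀ᵐ x, f x ≤ g x := (absolutelyContinuous_weightMeasure h.measurable h.pos).ae_le hfg
  have ho : IsOpen {x | g x < f x} := isOpen_lt hg hf
  have h0 : volume {x | g x < f x} = 0 := by
    rw [ae_iff] at h1
    simpa using h1
  have he := (ho.measure_eq_zero_iff volume).1 h0
  by_contra hx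
  have : x ∈ {x | g x < f x} := not_le.1 hx
  rw [he] at this
  exact this

lemma exists_mem_Ioo_of_ae {P : ℝ → Prop} (h : ∀ᵐ t : ℝ, 0 < t → P t) {a b : ℝ} (ha : 0 ≤ a)
    (hab : a < b) : ∃ t ∈ Ioo a b, P t := by
  by_contra hcon
  push Not at hcon
  have h1 : volume (Ioo a b) = 0 :=
    measure_mono_null (fun t ht (hP : 0 < t → P t) => hcon t ht (hP (ha.trans_lt ht.1)))
      (ae_iff.1 h)
  rw [Real.volume_Ioo, ENNReal.ofReal_eq_zero] at h1
  linarith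

namespace CleanSol

lemma exists_mem (hu : CleanSol d s κ m ρ u 𝒯) {a b : ℝ} (ha : 0 ≤ a) (hab : a < b) :
    ∃ t ∈ Ioo a b, t ∈ 𝒯 := exists_mem_Ioo_of_ae hu.full ha hab

lemma neBot (hu : CleanSol d s κ m ρ u 𝒯) : (𝓝[𝒯] (0 : ℝ)).NeBot := by
  rw [← mem_closure_iff_nhdsWithin_neBot, Metric.mem_closure_iff]
  intro ε hε
  obtain ⟨t, ht, htT⟩ := hu.exists_mem le_rfl hε
  refine ⟨t, htT, ?_⟩
  rw [dist_comm, Real.dist_eq, sub_zero, abs_of_pos ht.1]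
  exact ht.2

lemma exists_potential (h : Setup d s κ γ c C ρ) (hu : CleanSol d s κ m ρ u 𝒯) :
    ∃ U : ℝ → Ed d → ℝ, ∀ t, 0 < t → IsPotential d s κ ρ (fun x => u x t) (U t) := by
  have key : ∀ t, ∃ V : Ed d → ℝ, 0 < t → IsPotential d s κ ρ (fun x => u x t) V := fun t => by
    by_cases ht : 0 < t
    · obtain ⟨V, hV⟩ := exists_isPotential h (hu.isSource ht)
      exact ⟨V, fun _ => hV⟩
    · exact ⟨0, fun h => (ht h).elim⟩
  choose U hU using key
  exact ⟨U, hU⟩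

lemma potential_sub_ae (h : Setup d s κ γ c C ρ) (hm : 1 < m) (hu : CleanSol d s κ m ρ u 𝒯)
    (hU : ∀ t, 0 < t → IsPotential d s κ ρ (fun x => u x t) (U t)) {a b : ℝ} (ha : a ∈ 𝒯)
    (hb : b ∈ 𝒯) (hab : a < b) :
    ∀ᵐ x ∂(weightMeasure ρ), U a x - U b x = timeInt (fun x t => u x t ^ m) a b x := by
  have ha0 := hu.pos a ha
  have hb0 := hu.pos b hb
  have hUa := hU a ha0
  have hUb := hU b hb0
  have hI := hu.energyTest_timeInt hm ha0 hab
  have hD := (hUa.toEnergyDecaying.sub hUb.toEnergyDecaying).sub hI.energyDecaying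
  refine (hD.ae_eq_zero_of_energy_eq_zero h fun φ hφ => ?_).mono fun x hx => sub_eq_zero.1 hx
  rw [energy_sub_left (hUa.toFiniteEnergy.sub hUb.toFiniteEnergy) hI.toFiniteEnergy
    hφ.toFiniteEnergy, energy_sub_left hUa.toFiniteEnergy hUb.toFiniteEnergy hφ.toFiniteEnergy,
    hUa.energy_eq φ hφ, hUb.energy_eq φ hφ, hu.energy_eq a ha b hb hab φ hφ,
    ← integral_sub (hφ.integrable_bdd_mul (hu.isSource ha0).integrable)
      (hφ.integrable_bdd_mul (hu.isSource hb0).integrable), sub_eq_zero]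
  refine integral_congr_ae (.of_forall fun x => ?_)
  simp only []
  ring

lemma potential_antitone (h : Setup d s κ γ c C ρ) (hm : 1 < m) (hu : CleanSol d s κ m ρ u 𝒯)
    (hU : ∀ t, 0 < t → IsPotential d s κ ρ (fun x => u x t) (U t)) {a b : ℝ} (ha : a ∈ 𝒯)
    (hb : b ∈ 𝒯) (hab : a ≤ b) (x : Ed d) : U b x ≤ U a x := by
  rcases hab.eq_or_lt with rfl | hab
  · rfl
  refine h.forall_le_of_ae_le (hU b (hu.pos b hb)).continuous (hU a (hu.pos a ha)).continuous
    ((hu.potential_sub_ae h hm hU ha hb hab).mono fun x hx => ?_) x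
  have : 0 ≤ timeInt (fun x t => u x t ^ m) a b x :=
    integral_nonneg fun t => Real.rpow_nonneg (hu.nonneg x t) m
  linarith

lemma exists_potential_le_add (h : Setup d s κ γ c C ρ) (hm : 1 < m)
    (hu : CleanSol d s κ m ρ u 𝒯)
    (hU : ∀ t, 0 < t → IsPotential d s κ ρ (fun x => u x t) (U t)) {b : ℝ}
    (hb : b ∈ 𝒯) {τ : ℝ} (hτ : 0 < τ) :
    ∃ B, 0 ≤ B ∧ ∀ a ∈ 𝒯, τ ≤ a → a < b → ∀ x, U a x ≤ U b x + B * (b - a) := by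
  obtain ⟨B, hB0, hB⟩ := hu.pow_bdd hm hτ b
  refine ⟨B, hB0, fun a ha hτa hab x => ?_⟩
  refine h.forall_le_of_ae_le (hU a (hu.pos a ha)).continuous
    ((hU b (hu.pos b hb)).continuous.add continuous_const)
    ((hu.potential_sub_ae h hm hU ha hb hab).mono fun x hx => ?_) x
  have h1 := abs_timeInt_le (w := fun x t => u x t ^ m) hab.le
    (fun t ht x => hB t ⟨hτa.trans_lt ht.1, ht.2⟩ x) x
  have h2 := (le_abs_self _).trans h1
  show U a x ≤ U b x + B * (b - a)
  linarith

/-- Comparison of potentials propagates forward in time. -/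
lemma ae_potential_le_add (h : Setup d s κ γ c C ρ) (hm : 1 < m)
    (hu₁ : CleanSol d s κ m ρ u₁ 𝒯₁) (hu₂ : CleanSol d s κ m ρ u₂ 𝒯₂)
    (hU₁ : ∀ t, 0 < t → IsPotential d s κ ρ (fun x => u₁ x t) (U₁ t))
    (hU₂ : ∀ t, 0 < t → IsPotential d s κ ρ (fun x => u₂ x t) (U₂ t)) {a₁ a₂ ε : ℝ}
    (ha₁ : a₁ ∈ 𝒯₁) (ha₂ : a₂ ∈ 𝒯₂) (hε : 0 < ε) (hle : ∀ x, U₂ a₂ x ≤ U₁ a₁ x + ε) :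
    ∀ᵐ T : ℝ, 0 < T → a₁ + T ∈ 𝒯₁ ∧ a₂ + T ∈ 𝒯₂ ∧ ∀ x, U₂ (a₂ + T) x ≤ U₁ (a₁ + T) x + ε := by
  have h1 := hu₁.pos a₁ ha₁
  have h2 := hu₂.pos a₂ ha₂
  filter_upwards [ae_forall_div_mem hu₁.full h1 ha₁, ae_forall_div_mem hu₂.full h2 ha₂]
    with T hT1 hT2 hT
  have hT1' : a₁ + T ∈ 𝒯₁ := by simpa using hT1 hT 0 1
  have hT2' : a₂ + T ∈ 𝒯₂ := by simpa using hT2 hT 0 1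
  refine ⟨hT1', hT2', ?_⟩
  have hV1 := hU₁ a₁ h1
  have hV2 := hU₂ a₂ h2
  have key := ae_potential_le h hm hu₁ hu₂ h1 h2 hT (fun N k _ => ⟨hT1 hT N k, hT2 hT N k⟩)
    (hV2.toEnergyDecaying.sub hV1.toEnergyDecaying) (fun φ hφ => by
      rw [energy_sub_left hV2.toFiniteEnergy hV1.toFiniteEnergy hφ.toFiniteEnergy,
        hV2.energy_eq φ hφ, hV1.energy_eq φ hφ,
        ← integral_sub (hφ.integrable_bdd_mul (hu₂.isSource h2).integrable)
          (hφ.integrable_bdd_mul (hu₁.isSource h1).integrable)]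
      refine integral_congr_ae (.of_forall fun x => ?_)
      simp only []
      ring) hε (.of_forall fun x => by linarith [hle x])
  refine h.forall_le_of_ae_le (hU₂ _ (hu₂.pos _ hT2')).continuous
    ((hU₁ _ (hu₁.pos _ hT1')).continuous.add continuous_const) ?_
  filter_upwards [key, hu₁.potential_sub_ae h hm hU₁ ha₁ hT1' (by linarith),
    hu₂.potential_sub_ae h hm hU₂ ha₂ hT2' (by linarith)] with x hx1 hx2 hx3
  linarith

lemma tendsto_average (h : Setup d s κ γ c C ρ) {μ : Measure (Ed d)}
    (hu : CleanSol d s κ m ρ u 𝒯)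
    (hU : ∀ t, 0 < t → IsPotential d s κ ρ (fun x => u x t) (U t))
    (htr : ∀ φ : Ed d → ℝ, Continuous φ → (∃ B, ∀ x, |φ x| ≤ B) →
      Tendsto (fun t => ∫ x, φ x * u x t ∂(weightMeasure ρ)) (𝓝[𝒯] 0) (𝓝 (∫ x, φ x ∂μ)))
    {r : ℝ} {k : Ed d → ℝ}
    (hkc : Continuous k) (hk0 : ∀ x, 0 ≤ k x) {A : ℝ} (hkA : ∀ x, k x ≤ A)
    (hk : ∀ x, ENNReal.ofReal (k x) = ∫⁻ y, truncKernel s r (x - y) * rieszKernel s y) (x : Ed d) :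
    Tendsto (fun t => ENNReal.ofReal (s * r ^ s) *
        ∫⁻ y, truncKernel s r (x - y) * ENNReal.ofReal (U t y)) (𝓝[𝒯] 0)
      (𝓝 (ENNReal.ofReal (s * r ^ s) *
        ENNReal.ofReal (1 / potConst d s κ * ∫ z, k (x - z) ∂μ))) := by
  have h1 := htr (fun z => k (x - z)) (hkc.comp (continuous_const.sub continuous_id))
    ⟨A, fun z => by rw [abs_of_nonneg (hk0 _)]; exact hkA _⟩
  have h2 := ENNReal.Tendsto.const_mul (a := ENNReal.ofReal (s * r ^ s))
    (ENNReal.tendsto_ofReal (h1.const_mul (1 / potConst d s κ))) (.inr ENNReal.ofReal_ne_top)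
  refine h2.congr' (eventually_mem_nhdsWithin.mono fun t ht => ?_)
  simp only []
  rw [(hU t (hu.pos t ht)).lintegral_truncKernel h (hu.isSource (hu.pos t ht)) hkc hk0 hkA hk]

lemma exists_potential_lt (h : Setup d s κ γ c C ρ) (hm : 1 < m) {μ : Measure (Ed d)}
    (hu₁ : CleanSol d s κ m ρ u₁ 𝒯₁) (hu₂ : CleanSol d s κ m ρ u₂ 𝒯₂)
    (hU₁ : ∀ t, 0 < t → IsPotential d s κ ρ (fun x => u₁ x t) (U₁ t))
    (hU₂ : ∀ t, 0 < t → IsPotential d s κ ρ (fun x => u₂ x t) (U₂ t))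
    (htr₁ : ∀ φ : Ed d → ℝ, Continuous φ → (∃ B, ∀ x, |φ x| ≤ B) →
      Tendsto (fun t => ∫ x, φ x * u₁ x t ∂(weightMeasure ρ)) (𝓝[𝒯₁] 0) (𝓝 (∫ x, φ x ∂μ)))
    (htr₂ : ∀ φ : Ed d → ℝ, Continuous φ → (∃ B, ∀ x, |φ x| ≤ B) →
      Tendsto (fun t => ∫ x, φ x * u₂ x t ∂(weightMeasure ρ)) (𝓝[𝒯₂] 0) (𝓝 (∫ x, φ x ∂μ)))
    {b δ T : ℝ} (hb : b ∈ 𝒯₂) (hδ : 0 < δ) (hT : 0 < T) (x : Ed d) :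
    ∃ t ∈ 𝒯₁, t < T ∧ U₂ b x < U₁ t x + δ := by
  have hb0 := hu₂.pos b hb
  rcases lt_or_ge (U₂ b x) δ with hlt | hge
  · obtain ⟨t, ht, htT⟩ := hu₁.exists_mem le_rfl hT
    exact ⟨t, htT, ht.2, by linarith [(hU₁ t ht.1).nonneg x]⟩
  obtain ⟨B, hB⟩ := (hU₂ b hb0).bdd
  have h1 := tendsto_truncKernel_conv h.s_pos (f := fun y => ENNReal.ofReal (U₂ b y))
    (ENNReal.continuous_ofReal.comp (hU₂ b hb0).continuous) (B := ENNReal.ofReal B)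
    ENNReal.ofReal_ne_top (fun y => ENNReal.ofReal_le_ofReal ((le_abs_self _).trans (hB y)))
    (ε := fun n : ℕ => 1 / ((n : ℝ) + 1)) (fun n => by positivity)
    tendsto_one_div_add_atTop_nhds_zero_nat x
  obtain ⟨n, hn⟩ := (h1.eventually_const_lt
    ((ENNReal.ofReal_lt_ofReal_iff (hδ.trans_le hge)).2 (sub_lt_self _ hδ))).exists
  set r : ℝ := 1 / ((n : ℝ) + 1) with hr
  have hr0 : 0 < r := by positivity
  obtain ⟨k, hkc, hk0, ⟨A, hkA⟩, hk⟩ := exists_convKernel h hr0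
  have hl1 := hu₁.tendsto_average h hU₁ htr₁ hkc hk0 hkA hk x
  have hl2 := hu₂.tendsto_average h hU₂ htr₂ hkc hk0 hkA hk x
  have := hu₁.neBot
  have := hu₂.neBot
  have hge2 := ge_of_tendsto hl2 (b := ENNReal.ofReal (s * r ^ s) *
      ∫⁻ y, truncKernel s r (x - y) * ENNReal.ofReal (U₂ b y)) (by
    filter_upwards [eventually_mem_nhdsWithin, nhdsWithin_le_nhds (Iio_mem_nhds hb0)] with t ht htb
    exact mul_le_mul' le_rfl (lintegral_mono fun y => mul_le_mul' le_rfl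
      (ENNReal.ofReal_le_ofReal (hu₂.potential_antitone h hm hU₂ ht hb (le_of_lt htb) y))))
  obtain ⟨t, ⟨ht1, ht2⟩, ht3⟩ := ((hl1.eventually_const_lt (hn.trans_le hge2)).and
    (nhdsWithin_le_nhds (Iio_mem_nhds hT)) |>.and eventually_mem_nhdsWithin).exists
  refine ⟨t, ht3, ht2, ?_⟩
  have := (ENNReal.ofReal_lt_ofReal_iff_of_nonneg (sub_nonneg.2 hge)).1
    (ht1.trans_le ((hU₁ t (hu₁.pos t ht3)).average_le r hr0 x))
  linarith

lemma exists_forall_potential_le (h : Setup d s κ γ c C ρ) (hm : 1 < m) {μ : Measure (Ed d)}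
    (hu₁ : CleanSol d s κ m ρ u₁ 𝒯₁) (hu₂ : CleanSol d s κ m ρ u₂ 𝒯₂)
    (hU₁ : ∀ t, 0 < t → IsPotential d s κ ρ (fun x => u₁ x t) (U₁ t))
    (hU₂ : ∀ t, 0 < t → IsPotential d s κ ρ (fun x => u₂ x t) (U₂ t))
    (htr₁ : ∀ φ : Ed d → ℝ, Continuous φ → (∃ B, ∀ x, |φ x| ≤ B) →
      Tendsto (fun t => ∫ x, φ x * u₁ x t ∂(weightMeasure ρ)) (𝓝[𝒯₁] 0) (𝓝 (∫ x, φ x ∂μ)))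
    (htr₂ : ∀ φ : Ed d → ℝ, Continuous φ → (∃ B, ∀ x, |φ x| ≤ B) →
      Tendsto (fun t => ∫ x, φ x * u₂ x t ∂(weightMeasure ρ)) (𝓝[𝒯₂] 0) (𝓝 (∫ x, φ x ∂μ)))
    {b ε T : ℝ} (hb : b ∈ 𝒯₂) (hε : 0 < ε) (hT : 0 < T) :
    ∃ t ∈ 𝒯₁, t < T ∧ ∀ x, U₂ b x ≤ U₁ t x + ε := by
  have hV := hU₂ b (hu₂.pos b hb)
  set K : Set (Ed d) := {x | ε ≤ U₂ b x} with hKdef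
  have hK : IsCompact K := by
    obtain ⟨S, hS, hS2⟩ := mem_cocompact.1 (hV.tendsto_zero.eventually_lt_const hε)
    refine hS.of_isClosed_subset (isClosed_le continuous_const hV.continuous) fun x hx => ?_
    by_contra hcon
    exact absurd (show U₂ b x < ε from hS2 hcon) (not_lt.2 hx)
  let ι := {t : ℝ // t ∈ 𝒯₁ ∧ t < T}
  obtain ⟨t0, ht0, ht0T⟩ := hu₁.exists_mem le_rfl hT
  have : Nonempty ι := ⟨⟨t0, ht0T, ht0.2⟩⟩
  obtain ⟨i, hi⟩ := hK.elim_directed_cover (fun i : ι => {x | U₂ b x < U₁ i.1 x + ε})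
    (fun i => isOpen_lt hV.continuous
      ((hU₁ i.1 (hu₁.pos _ i.2.1)).continuous.add continuous_const))
    (fun x _ => by
      obtain ⟨t, ht, htT, hlt⟩ := exists_potential_lt h hm hu₁ hu₂ hU₁ hU₂ htr₁ htr₂ hb hε hT x
      exact mem_iUnion.2 ⟨⟨t, ht, htT⟩, hlt⟩)
    (fun i j => by
      rcases le_total i.1 j.1 with hij | hij
      · exact ⟨i, subset_rfl, fun x hx => lt_of_lt_of_le hx
          (add_le_add_left (hu₁.potential_antitone h hm hU₁ i.2.1 j.2.1 hij x) ε)⟩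
      · exact ⟨j, fun x hx => lt_of_lt_of_le hx
          (add_le_add_left (hu₁.potential_antitone h hm hU₁ j.2.1 i.2.1 hij x) ε), subset_rfl⟩)
  refine ⟨i.1, i.2.1, i.2.2, fun x => ?_⟩
  by_cases hx : x ∈ K
  · exact (show U₂ b x < U₁ i.1 x + ε from hi hx).le
  · have : U₂ b x < ε := not_le.1 hx
    linarith [(hU₁ i.1 (hu₁.pos _ i.2.1)).nonneg x]

lemma potential_le (h : Setup d s κ γ c C ρ) (hm : 1 < m) {μ : Measure (Ed d)}
    (hu₁ : CleanSol d s κ m ρ u₁ 𝒯₁) (hu₂ : CleanSol d s κ m ρ u₂ 𝒯₂)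
    (hU₁ : ∀ t, 0 < t → IsPotential d s κ ρ (fun x => u₁ x t) (U₁ t))
    (hU₂ : ∀ t, 0 < t → IsPotential d s κ ρ (fun x => u₂ x t) (U₂ t))
    (htr₁ : ∀ φ : Ed d → ℝ, Continuous φ → (∃ B, ∀ x, |φ x| ≤ B) →
      Tendsto (fun t => ∫ x, φ x * u₁ x t ∂(weightMeasure ρ)) (𝓝[𝒯₁] 0) (𝓝 (∫ x, φ x ∂μ)))
    (htr₂ : ∀ φ : Ed d → ℝ, Continuous φ → (∃ B, ∀ x, |φ x| ≤ B) →
      Tendsto (fun t => ∫ x, φ x * u₂ x t ∂(weightMeasure ρ)) (𝓝[𝒯₂] 0) (𝓝 (∫ x, φ x ∂μ)))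
    {b : ℝ} (hb₁ : b ∈ 𝒯₁) (hb₂ : b ∈ 𝒯₂) (x : Ed d) : U₂ b x ≤ U₁ b x := by
  have hb0 := hu₁.pos b hb₁
  have key : ∀ a ∈ 𝒯₁, a < b → U₂ b x ≤ U₁ a x := fun a ha hab => by
    have ha0 := hu₁.pos a ha
    refine le_of_forall_pos_le_add fun ε hε => ?_
    obtain ⟨e, he, heT⟩ := hu₂.exists_mem le_rfl (sub_pos.2 hab)
    obtain ⟨t, ht, hta, hle⟩ := exists_forall_potential_le h hm hu₁ hu₂ hU₁ hU₂ htr₁ htr₂ heT hε ha0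
    have ht0 := hu₁.pos t ht
    obtain ⟨T, hT, hT1, hT2, hTle⟩ := exists_mem_Ioo_of_ae
      (ae_potential_le_add h hm hu₁ hu₂ hU₁ hU₂ ht heT hε hle) ha0.le
      (show a < b - e by linarith [he.2])
    calc U₂ b x ≤ U₂ (e + T) x :=
          hu₂.potential_antitone h hm hU₂ hT2 hb₂ (by linarith [hT.2]) x
      _ ≤ U₁ (t + T) x + ε := hTle x
      _ ≤ U₁ a x + ε := by
          linarith [hu₁.potential_antitone h hm hU₁ ha hT1 (by linarith [hT.1]) x]
  obtain ⟨B, hB0, hB⟩ := hu₁.exists_potential_le_add h hm hU₁ hb₁ (half_pos hb0)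
  refine le_of_forall_pos_le_add fun ε hε => ?_
  set δ : ℝ := min (b / 2) (ε / (B + 1)) with hδ
  have hδ0 : 0 < δ := lt_min (half_pos hb0) (by positivity)
  have hδb : δ ≤ b / 2 := min_le_left _ _
  obtain ⟨a, ha, haT⟩ := hu₁.exists_mem (a := b - δ) (b := b) (by linarith) (by linarith)
  refine (key a haT ha.2).trans ((hB a haT (by linarith [ha.1]) ha.2 x).trans ?_)
  have h1 : B * (b - a) ≤ (B + 1) * δ := by nlinarith [ha.1, ha.2]
  have h2 : (B + 1) * δ ≤ ε := by
    have := min_le_right (b / 2) (ε / (B + 1))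
    rw [← hδ, le_div_iff₀ (by positivity)] at this
    linarith
  linarith

/-- Two clean solutions with the same trace coincide at almost every point. -/
lemma ae_eq_of_trace (h : Setup d s κ γ c C ρ) (hm : 1 < m) {μ : Measure (Ed d)}
    (hu₁ : CleanSol d s κ m ρ u₁ 𝒯₁) (hu₂ : CleanSol d s κ m ρ u₂ 𝒯₂)
    (htr₁ : ∀ φ : Ed d → ℝ, Continuous φ → (∃ B, ∀ x, |φ x| ≤ B) →
      Tendsto (fun t => ∫ x, φ x * u₁ x t ∂(weightMeasure ρ)) (𝓝[𝒯₁] 0) (𝓝 (∫ x, φ x ∂μ)))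
    (htr₂ : ∀ φ : Ed d → ℝ, Continuous φ → (∃ B, ∀ x, |φ x| ≤ B) →
      Tendsto (fun t => ∫ x, φ x * u₂ x t ∂(weightMeasure ρ)) (𝓝[𝒯₂] 0) (𝓝 (∫ x, φ x ∂μ)))
    {t : ℝ} (ht₁ : t ∈ 𝒯₁) (ht₂ : t ∈ 𝒯₂) : ∀ᵐ x, u₁ x t = u₂ x t := by
  have ht0 := hu₁.pos t ht₁
  obtain ⟨U₁, hU₁⟩ := hu₁.exists_potential h
  obtain ⟨U₂, hU₂⟩ := hu₂.exists_potential h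
  have hU : U₁ t = U₂ t := funext fun x => le_antisymm
    (potential_le h hm hu₂ hu₁ hU₂ hU₁ htr₂ htr₁ ht₂ ht₁ x)
    (potential_le h hm hu₁ hu₂ hU₁ hU₂ htr₁ htr₂ ht₁ ht₂ x)
  have hi₁ := (integrable_weightMeasure_iff h.measurable h.pos _).1 (hu₁.isSource ht0).integrable
  have hi₂ := (integrable_weightMeasure_iff h.measurable h.pos _).1 (hu₂.isSource ht0).integrable
  have hi : Integrable fun x => u₁ x t * ρ x - u₂ x t * ρ x := hi₁.sub hi₂
  have h0 := ae_eq_zero_of_integral_contDiff_smul_eq_zero hi.locallyIntegrable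
    fun η hη hηc => by
      have hφ := energyTest_of_contDiff h hη hηc
      have e1 := (hU₁ t ht0).energy_eq η hφ
      have e2 := (hU₂ t ht0).energy_eq η hφ
      rw [hU, e2, integral_weightMeasure h.measurable h.pos,
        integral_weightMeasure h.measurable h.pos] at e1
      have j1 := (integrable_weightMeasure_iff h.measurable h.pos _).1
        (hφ.integrable_bdd_mul (hu₁.isSource ht0).integrable)
      have j2 := (integrable_weightMeasure_iff h.measurable h.pos _).1
        (hφ.integrable_bdd_mul (hu₂.isSource ht0).integrable)
      rw [← sub_eq_zero.2 e1.symm, ← integral_sub j1 j2]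
      refine integral_congr_ae (.of_forall fun x => ?_)
      simp only [smul_eq_mul]
      ring
  filter_upwards [h0] with x hx
  rw [← sub_mul] at hx
  exact sub_eq_zero.1 ((mul_eq_zero.1 hx).resolve_right (h.pos x).ne')

end CleanSol
end

/-! ### Weak derivatives on the half line -/

section BumpStep

/-- The primitive of a normalized bump function: a smooth transition from `0` to `1`. -/
def bumpStep (f : ContDiffBump (0 : ℝ)) (t : ℝ) : ℝ := ∫ τ in Iic t, f.normed volume τ

variable (f : ContDiffBump (0 : ℝ))

private lemma normed_eq_zero {t : ℝ} (ht : f.rOut ≤ |t|) : f.normed volume t = 0 := by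
  by_contra hcon
  have : t ∈ Function.support (f.normed volume) := hcon
  rw [f.support_normed_eq, Metric.mem_ball, Real.dist_eq, sub_zero] at this
  linarith

lemma bumpStep_nonneg (t : ℝ) : 0 ≤ bumpStep f t :=
  integral_nonneg fun _ => f.nonneg_normed _

lemma bumpStep_le_one (t : ℝ) : bumpStep f t ≤ 1 := by
  rw [← f.integral_normed (μ := volume)]
  exact setIntegral_le_integral f.integrable_normed (.of_forall fun _ => f.nonneg_normed _)

lemma bumpStep_eq_zero {t : ℝ} (ht : t ≤ -f.rOut) : bumpStep f t = 0 := by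
  refine setIntegral_eq_zero_of_forall_eq_zero fun τ hτ => normed_eq_zero f ?_
  have : τ ≤ t := hτ
  exact le_abs.2 (.inr (by linarith))

lemma bumpStep_eq_one {t : ℝ} (ht : f.rOut ≤ t) : bumpStep f t = 1 := by
  rw [← f.integral_normed (μ := volume)]
  refine setIntegral_eq_integral_of_forall_compl_eq_zero fun τ hτ => normed_eq_zero f ?_
  have : t < τ := not_le.1 hτ
  exact le_abs.2 (.inl (by linarith))

lemma hasDerivAt_bumpStep (t : ℝ) : HasDerivAt (bumpStep f) (f.normed volume t) t := by
  have h1 : bumpStep f = fun t => bumpStep f 0 + ∫ τ in (0 : ℝ)..t, f.normed volume τ := by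
    funext t
    rw [← intervalIntegral.integral_Iic_sub_Iic f.integrable_normed.integrableOn
      f.integrable_normed.integrableOn]
    simp only [bumpStep]
    ring
  rw [h1]
  exact ((f.continuous_normed.integral_hasStrictDerivAt 0 t).hasDerivAt).const_add _

lemma contDiff_bumpStep : ContDiff ℝ (⊤ : ℕ∞) (bumpStep f) := by
  refine contDiff_infty_iff_deriv.2 ⟨fun t => (hasDerivAt_bumpStep f t).differentiableAt, ?_⟩
  rw [show deriv (bumpStep f) = f.normed volume from
    funext fun t => (hasDerivAt_bumpStep f t).deriv]
  exact f.contDiff_normed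

end BumpStep

/-- A locally integrable function on the half line with weak derivative `-E` satisfies the
fundamental theorem of calculus between almost all pairs of points. -/
lemma exists_forall_sub_eq_setIntegral {F E : ℝ → ℝ} (hF : LocallyIntegrable F)
    (hE : ∀ a b, 0 < a → a < b → IntegrableOn E (Ioc a b))
    (hw : ∀ ψ : ℝ → ℝ, ContDiff ℝ (⊤ : ℕ∞) ψ → HasCompactSupport ψ → tsupport ψ ⊆ Ioi 0 →
      ∫ t in Ioi (0 : ℝ), F t * deriv ψ t = ∫ t in Ioi (0 : ℝ), E t * ψ t) :
    ∃ S : Set ℝ, (∀ᵐ t, t ∈ S) ∧ ∀ a ∈ S, ∀ b ∈ S, 0 < a → a < b →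
      F a - F b = ∫ t in Ioc a b, E t := by
  let f : ℕ → ContDiffBump (0 : ℝ) := fun n =>
    ⟨1 / ((n : ℝ) + 1), 2 / ((n : ℝ) + 1), by positivity, by gcongr; norm_num⟩
  have hlim : Tendsto (fun n => (f n).rOut) atTop (𝓝 0) := by
    have := (tendsto_one_div_add_atTop_nhds_zero_nat (𝕜 := ℝ)).const_mul 2
    rw [mul_zero] at this
    refine this.congr fun n => ?_
    simp only [f]
    ring
  have hae := ContDiffBump.ae_convolution_tendsto_right_of_locallyIntegrable (μ := volume) (K := 2)
    hlim (.of_forall fun n => by simp only [f]; exact le_of_eq (by ring)) hF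
  refine ⟨{x | Tendsto (fun n => MeasureTheory.convolution ((f n).normed volume) F
    (ContinuousLinearMap.lsmul ℝ ℝ) volume x) atTop (𝓝 (F x))}, hae, fun a ha b hb ha0 hab => ?_⟩
  have hconv : ∀ n x, MeasureTheory.convolution ((f n).normed volume) F
      (ContinuousLinearMap.lsmul ℝ ℝ) volume x = ∫ t, F t * (f n).normed volume (t - x) :=
    fun n x => by
      rw [MeasureTheory.convolution_eq_swap]
      refine integral_congr_ae (.of_forall fun t => ?_)
      simp only [ContinuousLinearMap.lsmul_apply, smul_eq_mul]
      rw [← neg_sub t x, ContDiffBump.normed_neg, mul_comm]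
  have ha' : Tendsto (fun n => ∫ t, F t * (f n).normed volume (t - a)) atTop (𝓝 (F a)) :=
    Tendsto.congr (fun n => hconv n a) ha
  have hb' : Tendsto (fun n => ∫ t, F t * (f n).normed volume (t - b)) atTop (𝓝 (F b)) :=
    Tendsto.congr (fun n => hconv n b) hb
  have hint : ∀ n x, Integrable fun t => F t * (f n).normed volume (t - x) := fun n x =>
    hF.integrable_smul_right_of_hasCompactSupport
      ((f n).continuous_normed.comp (continuous_id.sub continuous_const))
      ((f n).hasCompactSupport_normed.comp_homeomorph (Homeomorph.subRight x))
  set ψ : ℕ → ℝ → ℝ := fun n t => bumpStep (f n) (t - a) - bumpStep (f n) (t - b) with hψ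
  have hψd : ∀ n t, HasDerivAt (ψ n)
      ((f n).normed volume (t - a) - (f n).normed volume (t - b)) t := fun n t =>
    ((hasDerivAt_bumpStep (f n) (t - a)).comp_sub_const t a).sub
      ((hasDerivAt_bumpStep (f n) (t - b)).comp_sub_const t b)
  have hψs : ∀ n, ContDiff ℝ (⊤ : ℕ∞) (ψ n) := fun n =>
    ((contDiff_bumpStep (f n)).comp (contDiff_id.sub contDiff_const)).sub
      ((contDiff_bumpStep (f n)).comp (contDiff_id.sub contDiff_const))
  have hψb : ∀ n t, |ψ n t| ≤ 1 := fun n t => by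
    rw [abs_le]
    have h1 := bumpStep_nonneg (f n) (t - a)
    have h2 := bumpStep_nonneg (f n) (t - b)
    have h3 := bumpStep_le_one (f n) (t - a)
    have h4 := bumpStep_le_one (f n) (t - b)
    constructor <;> simp only [hψ] <;> linarith
  have hψ0 : ∀ n t, t ∉ Icc (a - (f n).rOut) (b + (f n).rOut) → ψ n t = 0 := fun n t ht => by
    rw [mem_Icc, not_and_or, not_le, not_le] at ht
    simp only [hψ]
    rcases ht with ht | ht
    · rw [bumpStep_eq_zero _ (by linarith), bumpStep_eq_zero _ (by linarith), sub_zero]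
    · rw [bumpStep_eq_one _ (by linarith), bumpStep_eq_one _ (by linarith), sub_self]
  have hts : ∀ n, tsupport (ψ n) ⊆ Icc (a - (f n).rOut) (b + (f n).rOut) := fun n =>
    closure_minimal (fun t ht => by
      by_contra hcon
      exact ht (hψ0 n t hcon)) isClosed_Icc
  have hcs : ∀ n, HasCompactSupport (ψ n) := fun n =>
    isCompact_Icc.of_isClosed_subset (isClosed_tsupport _) (hts n)
  have hr : ∀ᶠ n in atTop, (f n).rOut < min (a / 2) 1 :=
    hlim.eventually_lt_const (lt_min (half_pos ha0) one_pos)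
  set K : Set ℝ := Ioc (a / 3) (b + 1) with hK
  have hIccK : ∀ n, (f n).rOut < min (a / 2) 1 → Icc (a - (f n).rOut) (b + (f n).rOut) ⊆ K :=
    fun n hn t ht => by
      have h1 := hn.trans_le (min_le_left _ _)
      have h2 := hn.trans_le (min_le_right _ _)
      constructor <;> linarith [ht.1, ht.2]
  have hK0 : K ⊆ Ioi 0 := fun t ht => lt_trans (by positivity) ht.1
  have hEK : IntegrableOn E K := hE _ _ (by positivity) (by linarith)
  have hL : Tendsto (fun n => ∫ t in K, E t * ψ n t) atTop
      (𝓝 (∫ t in K, (Ioc a b).indicator E t)) := by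
    refine tendsto_integral_of_dominated_convergence (fun t => |E t|)
      (fun n => hEK.aestronglyMeasurable.mul (hψs n).continuous.aestronglyMeasurable) hEK.abs
      (fun n => .of_forall fun t => ?_) ?_
    · rw [Real.norm_eq_abs, abs_mul]
      exact mul_le_of_le_one_right (abs_nonneg _) (hψb n t)
    · have hne : ∀ c : ℝ, ∀ᵐ t ∂(volume.restrict K), t ≠ c := fun c =>
        ae_restrict_of_ae (by simp [ae_iff])
      filter_upwards [hne a, hne b] with t hta htb
      refine tendsto_const_nhds.congr' ?_
      have hd : 0 < min |t - a| |t - b| :=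
        lt_min (abs_pos.2 (sub_ne_zero.2 hta)) (abs_pos.2 (sub_ne_zero.2 htb))
      filter_upwards [hlim.eventually_lt_const hd] with n hn
      have h1 := (hn.trans_le (min_le_left _ _)).le
      have h2 := (hn.trans_le (min_le_right _ _)).le
      simp only [hψ]
      rcases lt_or_gt_of_ne hta with h3 | h3
      · have h4 : t < b := h3.trans hab
        rw [abs_of_neg (sub_neg.2 h3)] at h1
        rw [abs_of_neg (sub_neg.2 h4)] at h2
        rw [bumpStep_eq_zero _ (by linarith), bumpStep_eq_zero _ (by linarith), sub_zero, mul_zero,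
          indicator_of_notMem fun h => absurd h.1 h3.not_gt]
      · rw [abs_of_pos (sub_pos.2 h3)] at h1
        rcases lt_or_gt_of_ne htb with h4 | h4
        · rw [abs_of_neg (sub_neg.2 h4)] at h2
          rw [bumpStep_eq_one _ h1, bumpStep_eq_zero _ (by linarith), sub_zero, mul_one,
            indicator_of_mem (show t ∈ Ioc a b from ⟨h3, h4.le⟩)]
        · rw [abs_of_pos (sub_pos.2 h4)] at h2
          rw [bumpStep_eq_one _ h1, bumpStep_eq_one _ h2, sub_self, mul_zero,
            indicator_of_notMem fun h => absurd h.2 h4.not_ge]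
  have hlimit : ∫ t in K, (Ioc a b).indicator E t = ∫ t in Ioc a b, E t := by
    rw [setIntegral_indicator measurableSet_Ioc, inter_eq_self_of_subset_right]
    exact Ioc_subset_Ioc (by linarith) (by linarith)
  rw [hlimit] at hL
  refine tendsto_nhds_unique (ha'.sub hb') (hL.congr' (hr.mono fun n hn => ?_))
  have hI := hIccK n hn
  have e1 : ∫ t in K, E t * ψ n t = ∫ t in Ioi (0 : ℝ), E t * ψ n t := by
    refine (setIntegral_eq_of_subset_of_forall_sdiff_eq_zero measurableSet_Ioi hK0
      fun t ht => ?_).symm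
    rw [hψ0 n t fun h => ht.2 (hI h), mul_zero]
  rw [e1, ← hw (ψ n) (hψs n) (hcs n) ((hts n).trans (hI.trans hK0))]
  beta_reduce
  rw [← integral_sub (hint n a) (hint n b),
    setIntegral_eq_integral_of_forall_compl_eq_zero fun t ht => ?_]
  · refine integral_congr_ae (.of_forall fun t => ?_)
    simp only [(hψd n t).deriv]
    ring
  · have h0 : t ∉ tsupport (ψ n) := fun h => ht (hK0 (hI (hts n h)))
    have h1 : deriv (ψ n) t = 0 := by
      by_contra hcon
      exact h0 (support_deriv_subset hcon)
    rw [h1, mul_zero]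

/-! ### Exchange of energies and time integrals -/

section EnergyFubini

variable {d : ℕ} {s κ : ℝ} {ρ : Ed d → ℝ}

lemma incr_ae_eq {v w : Ed d → ℝ} (h : v =ᵐ[volume] w) :
    incr v =ᵐ[jumpMeasure d s κ] incr w := by
  have h1 : ∀ᵐ p : Ed d × Ed d, v p.1 = w p.1 :=
    (Measure.quasiMeasurePreserving_fst (μ := (volume : Measure (Ed d)))
      (ν := (volume : Measure (Ed d)))).ae h
  have h2 : ∀ᵐ p : Ed d × Ed d, v p.2 = w p.2 :=
    (Measure.quasiMeasurePreserving_snd (μ := (volume : Measure (Ed d)))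
      (ν := (volume : Measure (Ed d)))).ae h
  refine Filter.Eventually.filter_mono jumpMeasure_absolutelyContinuous.ae_le ?_
  filter_upwards [h1, h2] with p hp1 hp2
  rw [incr, incr, hp1, hp2]

lemma energySq_congr_ae {v w : Ed d → ℝ} (h : v =ᵐ[volume] w) :
    energySq d s κ v = energySq d s κ w :=
  lintegral_congr_ae ((incr_ae_eq h).mono fun p hp => by simp only [hp])

lemma energy_congr_ae_left {v w η : Ed d → ℝ} (h : v =ᵐ[volume] w) :
    energy d s κ v η = energy d s κ w η :=
  integral_congr_ae ((incr_ae_eq h).mono fun p hp => by simp only [hp])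

/-- Exchange of an energy pairing and a time integral. -/
lemma energy_timeInt {w : Ed d → ℝ → ℝ} {a b B : ℝ} (hw : Measurable (Function.uncurry w))
    (hB : ∀ t ∈ Ioc a b, ∀ x, |w x t| ≤ B)
    (he : ∫⁻ t in Ioc a b, energySq d s κ (fun x => w x t) < ⊤) {η : Ed d → ℝ}
    (hη : FiniteEnergy d s κ η) :
    IntegrableOn (fun t => energy d s κ (fun x => w x t) η) (Ioc a b) ∧
      energy d s κ (timeInt w a b) η = ∫ t in Ioc a b, energy d s κ (fun x => w x t) η := by
  have hmi := measurable_incr_time hw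
  have hm1 : Measurable fun q : (Ed d × Ed d) × ℝ =>
      ENNReal.ofReal (incr (fun x => w x q.2) q.1 ^ 2) := (hmi.pow_const 2).ennreal_ofReal
  have hI1 : MemLp (fun q : (Ed d × Ed d) × ℝ => incr (fun x => w x q.2) q.1) 2
      ((jumpMeasure d s κ).prod (volume.restrict (Ioc a b))) := by
    rw [← lintegral_sq_lt_top_iff_memLp hmi.aestronglyMeasurable,
      lintegral_prod_symm' _ hm1]
    exact he
  have hI2 : MemLp (fun q : (Ed d × Ed d) × ℝ => incr η q.1) 2
      ((jumpMeasure d s κ).prod (volume.restrict (Ioc a b))) := hη.memLp.comp_fst _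
  have hI : Integrable (fun q : (Ed d × Ed d) × ℝ => incr (fun x => w x q.2) q.1 * incr η q.1)
      ((jumpMeasure d s κ).prod (volume.restrict (Ioc a b))) := hI1.integrable_mul hI2
  refine ⟨hI.integral_prod_right, ?_⟩
  simp only [energy]
  rw [← integral_integral_swap (f := fun p t => incr (fun x => w x t) p * incr η p) hI]
  refine integral_congr_ae (.of_forall fun p => ?_)
  simp only [incr_timeInt hw hB, integral_mul_const]

end EnergyFubini

section SmoothDense

variable {d : ℕ} {s κ γ c C : ℝ} {ρ : Ed d → ℝ}

/-- A countable family of smooth functions suffices to test energy identities. -/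
lemma exists_countable_smooth_family (h : Setup d s κ γ c C ρ) :
    ∃ e : ℕ → Ed d → ℝ, (∀ n, ContDiff ℝ (⊤ : ℕ∞) (e n) ∧ HasCompactSupport (e n)) ∧
      ∀ V g : Ed d → ℝ, FiniteEnergy d s κ V → MemLp g 2 (weightMeasure ρ) →
        (∀ n, energy d s κ V (e n) = ∫ x, g x * e n x ∂(weightMeasure ρ)) →
        ∀ η : Ed d → ℝ, ContDiff ℝ (⊤ : ℕ∞) η → HasCompactSupport η →
          energy d s κ V η = ∫ x, g x * η x ∂(weightMeasure ρ) := by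
  let Y := {η : Ed d → ℝ // ContDiff ℝ (⊤ : ℕ∞) η ∧ HasCompactSupport η}
  have hE : ∀ η : Y, EnergyTest d s κ ρ η.1 := fun η => energyTest_of_contDiff h η.2.1 η.2.2
  have hL : ∀ η : Y, MemLp η.1 2 (weightMeasure ρ) := fun η => by
    obtain ⟨B, hB⟩ := (hE η).bdd
    rw [memLp_two_iff_integrable_sq (hE η).measurable.aestronglyMeasurable]
    have := (hE η).integrable.bdd_mul (hE η).measurable.aestronglyMeasurable (.of_forall hB)
    simpa only [sq] using this
  let Φ : Y → Lp ℝ 2 (jumpMeasure d s κ) × Lp ℝ 2 (weightMeasure ρ) := fun η =>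
    ((hE η).memLp.toLp _, (hL η).toLp _)
  let _ : TopologicalSpace Y := TopologicalSpace.induced Φ inferInstance
  have hΦ : Continuous Φ := continuous_induced_dom
  have h2 : Fact ((2 : ℝ≥0∞) ≠ ⊤) := ⟨by simp⟩
  have hsc : SecondCountableTopology Y := TopologicalSpace.secondCountableTopology_induced _ _ Φ
  have hne : Nonempty Y := ⟨⟨fun _ => 0, contDiff_const, HasCompactSupport.zero⟩⟩
  refine ⟨fun n => (TopologicalSpace.denseSeq Y n).1, fun n => (TopologicalSpace.denseSeq Y n).2,
    fun V g hV hg hid η hη hc => ?_⟩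
  let ℓ : Y → ℝ := fun η => inner ℝ (hV.memLp.toLp _) (Φ η).1 - inner ℝ (hg.toLp _) (Φ η).2
  have hℓ : ∀ η : Y, ℓ η = energy d s κ V η.1 - ∫ x, g x * η.1 x ∂(weightMeasure ρ) := fun η => by
    simp only [ℓ, L2.inner_def, Φ]
    congr 1
    · refine integral_congr_ae ?_
      filter_upwards [hV.memLp.coeFn_toLp, (hE η).memLp.coeFn_toLp] with p h1 h2
      simp only [h1, h2, RCLike.inner_apply, conj_trivial, mul_comm]
    · refine integral_congr_ae ?_
      filter_upwards [hg.coeFn_toLp, (hL η).coeFn_toLp] with p h1 h2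
      simp only [h1, h2, RCLike.inner_apply, conj_trivial, mul_comm]
  have hcont : Continuous ℓ :=
    (continuous_const.inner (continuous_fst.comp hΦ)).sub
      (continuous_const.inner (continuous_snd.comp hΦ))
  have hcl : IsClosed {η : Y | ℓ η = 0} := isClosed_eq hcont continuous_const
  have hall : ∀ η : Y, ℓ η = 0 := fun η => by
    have h1 : range (TopologicalSpace.denseSeq Y) ⊆ {η : Y | ℓ η = 0} := by
      rintro _ ⟨n, rfl⟩
      exact (hℓ _).trans (sub_eq_zero.2 (hid n))
    exact (hcl.closure_subset_iff.2 h1) ((TopologicalSpace.denseRange_denseSeq Y) η)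
  have := (hℓ ⟨η, hη, hc⟩).symm.trans (hall _)
  exact sub_eq_zero.1 this

end SmoothDense

/-! ### Representatives of weak solutions -/

section Representative

variable {d : ℕ} {s κ γ c C m : ℝ} {ρ : Ed d → ℝ} {u : Ed d → ℝ → ℝ}

lemma WeakSolCore.measurable_slice (hu : WeakSolCore d s m κ ρ u) (t : ℝ) :
    Measurable fun x => u x t :=
  hu.measurable.comp measurable_prodMk_right

lemma gagliardoSq_eq_energySq (hκ : 0 < κ) {v : Ed d → ℝ} (hv : Measurable v) :
    gagliardoSq d s κ v = energySq d s κ v :=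
  gagliardoSq_eq_lintegral hκ hv

lemma WeakSolCore.exists_pointwise_bound (hu : WeakSolCore d s m κ ρ u) :
    ∃ β : ℝ → ℝ, Measurable β ∧ (∀ t, 0 ≤ β t) ∧
      (∀ τ, 0 < τ → ∃ B, ∀ t, τ < t → β t ≤ B) ∧ ∀ᵐ t : ℝ, 0 < t → ∀ᵐ x, u x t ≤ β t := by
  choose B hB using fun n : ℕ => hu.essBdd (1 / ((n : ℝ) + 1)) (by positivity)
  refine ⟨fun t => ∑ i ∈ Finset.range (⌈1 / t⌉₊ + 1), |B i|, ?_, fun t => by positivity,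
    fun τ hτ => ⟨∑ i ∈ Finset.range (⌈1 / τ⌉₊ + 1), |B i|, fun t ht => ?_⟩, ?_⟩
  · have h1 : Measurable fun n : ℕ => ∑ i ∈ Finset.range (n + 1), |B i| := measurable_from_nat
    exact h1.comp (Nat.measurable_ceil.comp (measurable_const.div measurable_id))
  · refine Finset.sum_le_sum_of_subset_of_nonneg ?_ fun i _ _ => abs_nonneg _
    refine Finset.range_mono ?_
    gcongr
  · have h1 : ∀ᵐ t : ℝ, ∀ n : ℕ, ∀ᵐ x : Ed d, 1 / ((n : ℝ) + 1) < t → u x t ≤ B n := by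
      rw [ae_all_iff]
      intro n
      have h2 : ∀ᵐ p : ℝ × Ed d, 1 / ((n : ℝ) + 1) < p.1 → u p.2 p.1 ≤ B n :=
        (Measure.measurePreserving_swap (μ := (volume : Measure ℝ))
          (ν := (volume : Measure (Ed d)))).quasiMeasurePreserving.ae (hB n)
      exact Measure.ae_ae_of_ae_prod h2
    filter_upwards [h1] with t ht ht0
    have hlt : 1 / ((⌈1 / t⌉₊ : ℝ) + 1) < t := by
      rw [div_lt_comm₀ (by positivity) ht0]
      exact (Nat.le_ceil _).trans_lt (lt_add_one _)
    filter_upwards [ht ⌈1 / t⌉₊] with x hx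
    refine (hx hlt).trans ((le_abs_self _).trans ?_)
    exact Finset.single_le_sum (f := fun i => |B i|) (fun i _ => abs_nonneg _)
      (Finset.mem_range.2 (Nat.lt_succ_self _))

/-- A measurable set of full measure contained in a given set of full measure. -/
lemma exists_measurableSet_subset_of_ae {P : ℝ → Prop} (hP : ∀ᵐ t : ℝ, 0 < t → P t) :
    ∃ G : Set ℝ, MeasurableSet G ∧ (∀ t ∈ G, 0 < t ∧ P t) ∧ ∀ᵐ t : ℝ, 0 < t → t ∈ G := by
  have h0 : volume {t : ℝ | ¬ (0 < t → P t)} = 0 := hP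
  refine ⟨(toMeasurable volume {t : ℝ | ¬ (0 < t → P t)})ᶜ ∩ Ioi 0,
    (measurableSet_toMeasurable _ _).compl.inter measurableSet_Ioi, fun t ht => ⟨ht.2, ?_⟩, ?_⟩
  · by_contra hcon
    exact ht.1 (subset_toMeasurable _ _ fun h => hcon (h ht.2))
  · have h1 : volume (toMeasurable volume {t : ℝ | ¬ (0 < t → P t)}) = 0 := by
      rw [measure_toMeasurable, h0]
    filter_upwards [measure_eq_zero_iff_ae_notMem.1 h1] with t ht ht0
    exact ⟨ht, ht0⟩

/-- Truncation of a function of space and time in time-dependent height, extended by zero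
outside a set of times. -/
def truncTime {d : ℕ} (u : Ed d → ℝ → ℝ) (β : ℝ → ℝ) (G : Set ℝ) (x : Ed d) (t : ℝ) : ℝ :=
  G.indicator (fun r => min (u x r) (β r)) t

lemma measurable_truncTime (hu : Measurable (Function.uncurry u)) {β : ℝ → ℝ}
    (hβ : Measurable β) {G : Set ℝ} (hG : MeasurableSet G) :
    Measurable (Function.uncurry (truncTime u β G)) := by
  have h1 : Measurable ((Prod.snd ⁻¹' G : Set (Ed d × ℝ)).indicator
      fun p => min (u p.1 p.2) (β p.2)) :=
    (hu.min (hβ.comp measurable_snd)).indicator (measurable_snd hG)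
  exact h1

lemma truncTime_of_notMem {β : ℝ → ℝ} {G : Set ℝ} {t : ℝ} (ht : t ∉ G) (x : Ed d) :
    truncTime u β G x t = 0 := indicator_of_notMem ht _

lemma truncTime_ae_eq {β : ℝ → ℝ} {G : Set ℝ} {t : ℝ} (ht : t ∈ G) (h : ∀ᵐ x, u x t ≤ β t) :
    (fun x => truncTime u β G x t) =ᵐ[volume] fun x => u x t :=
  h.mono fun x hx => by
    simp only [truncTime, indicator_of_mem ht, min_eq_left hx]

/-- The weak formulation tested against products of a time and a space function. -/
lemma WeakSolCore.weakForm_mul (h : Setup d s κ γ c C ρ) (hu : WeakSolCore d s m κ ρ u)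
    {η : Ed d → ℝ} (hη : ContDiff ℝ (⊤ : ℕ∞) η) (hc : HasCompactSupport η) {ψ : ℝ → ℝ}
    (hψ : ContDiff ℝ (⊤ : ℕ∞) ψ) (hψc : HasCompactSupport ψ) (hψs : tsupport ψ ⊆ Ioi 0) :
    ∫ t in Ioi (0 : ℝ), (∫ x, u x t * η x ∂(weightMeasure ρ)) * deriv ψ t =
      ∫ t in Ioi (0 : ℝ), energy d s κ (fun x => u x t ^ m) η * ψ t := by
  have hts : tsupport (fun p : Ed d × ℝ => ψ p.2 * η p.1) ⊆ tsupport η ×ˢ tsupport ψ := by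
    refine closure_minimal (fun p hp => ?_)
      ((isClosed_tsupport _).prod (isClosed_tsupport _))
    exact ⟨subset_tsupport _ fun h0 => hp (by simp [h0]),
      subset_tsupport _ fun h0 => hp (by simp [h0])⟩
  have hφ : IsTestFn d fun p => ψ p.2 * η p.1 :=
    ⟨(hψ.comp contDiff_snd).mul (hη.comp contDiff_fst),
      (hc.isCompact.prod hψc.isCompact).of_isClosed_subset (isClosed_tsupport _) hts,
      hts.trans (prod_mono (subset_univ _) hψs)⟩
  have hw := hu.weakForm _ hφ
  have e1 : ∀ t, ∫ x, u x t * deriv (fun τ => ψ τ * η x) t * ρ x =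
      (∫ x, u x t * η x ∂(weightMeasure ρ)) * deriv ψ t := fun t => by
    rw [integral_weightMeasure h.measurable h.pos, ← integral_mul_const]
    refine integral_congr_ae (.of_forall fun x => ?_)
    have hd : DifferentiableAt ℝ ψ t := (hψ.differentiable (by simp)).differentiableAt
    simp only [deriv_mul_const hd]
    ring
  have e2 : ∀ t, gagliardoE d s κ (fun x => u x t ^ m) (fun x => ψ t * η x) =
      energy d s κ (fun x => u x t ^ m) η * ψ t := fun t => by
    rw [gagliardoE_eq_energy h.κ_pos, energy_const_mul_right, mul_comm]
  simp only [e1, e2] at hw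
  linarith

end Representative

/-! ### Weak solutions as clean solutions -/

section Cleaning

variable {d : ℕ} {s κ γ c C m : ℝ} {ρ : Ed d → ℝ} {u v : Ed d → ℝ → ℝ}

/-- Weak formulation integrated in time, for one fixed smooth test function. -/
lemma WeakSolCore.exists_times_energy_timeInt (h : Setup d s κ γ c C ρ) (hm : 0 < m)
    (hu : WeakSolCore d s m κ ρ u) (hv : Measurable (Function.uncurry v))
    (hv0 : ∀ x t, 0 ≤ v x t)
    (hvb : ∀ τ, 0 < τ → ∃ B, ∀ t, τ < t → ∀ x, v x t ≤ B)
    (hvM : ∃ M, ∀ t, Integrable (fun x => v x t) (weightMeasure ρ) ∧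
      ∫ x, v x t ∂(weightMeasure ρ) ≤ M)
    (hve : ∀ a b, 0 < a → a < b → ∫⁻ t in Ioc a b, energySq d s κ (fun x => v x t ^ m) < ⊤)
    (huv : ∀ᵐ t : ℝ, 0 < t → (fun x => v x t) =ᵐ[volume] fun x => u x t)
    {η : Ed d → ℝ} (hη : ContDiff ℝ (⊤ : ℕ∞) η) (hc : HasCompactSupport η) :
    ∃ S : Set ℝ, (∀ᵐ t, t ∈ S) ∧ ∀ a ∈ S, ∀ b ∈ S, 0 < a → a < b →
      energy d s κ (timeInt (fun x t => v x t ^ m) a b) η =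
        ∫ x, (v x a - v x b) * η x ∂(weightMeasure ρ) := by
  have hηt := energyTest_of_contDiff h hη hc
  obtain ⟨A, hA⟩ := hηt.bdd
  obtain ⟨M, hM⟩ := hvM
  have hvm : Measurable (Function.uncurry fun x t => v x t ^ m) := hv.pow_const m
  have hvi : ∀ t, Integrable (fun x => v x t * η x) (weightMeasure ρ) := fun t =>
    hηt.integrable_bdd_mul (hM t).1
  have hbd : ∀ a b, 0 < a → ∃ B, ∀ t ∈ Ioc a b, ∀ x, |v x t ^ m| ≤ B := fun a b ha => by
    obtain ⟨B, hB⟩ := hvb a ha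
    refine ⟨B ^ m, fun t ht x => ?_⟩
    rw [abs_of_nonneg (Real.rpow_nonneg (hv0 x t) m)]
    exact Real.rpow_le_rpow (hv0 x t) (hB t ht.1 x) hm.le
  have hEI : ∀ a b, 0 < a → a < b →
      IntegrableOn (fun t => energy d s κ (fun x => v x t ^ m) η) (Ioc a b) ∧
      energy d s κ (timeInt (fun x t => v x t ^ m) a b) η =
        ∫ t in Ioc a b, energy d s κ (fun x => v x t ^ m) η := fun a b ha hab => by
    obtain ⟨B, hB⟩ := hbd a b ha
    exact energy_timeInt hvm hB (hve a b ha hab) hηt.toFiniteEnergy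
  have hFm : Measurable fun t => ∫ x, v x t * η x ∂(weightMeasure ρ) := by
    have h1 : Measurable fun q : ℝ × Ed d => v q.2 q.1 * η q.2 :=
      (hv.comp measurable_swap).mul (hη.continuous.measurable.comp measurable_snd)
    exact (h1.stronglyMeasurable.integral_prod_right' (ν := weightMeasure ρ)).measurable
  have hF : LocallyIntegrable fun t => ∫ x, v x t * η x ∂(weightMeasure ρ) := by
    have hc1 : LocallyIntegrable (fun _ : ℝ => A * M) := locallyIntegrable_const _
    refine hc1.mono hFm.aestronglyMeasurable (.of_forall fun t => ?_)
    have h1 : ‖∫ x, v x t * η x ∂(weightMeasure ρ)‖ ≤ ∫ x, A * v x t ∂(weightMeasure ρ) := by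
      refine norm_integral_le_of_norm_le ((hM t).1.const_mul A) (.of_forall fun x => ?_)
      rw [Real.norm_eq_abs, abs_mul, abs_of_nonneg (hv0 x t), mul_comm]
      exact mul_le_mul_of_nonneg_right (hA x) (hv0 x t)
    refine h1.trans ((le_of_eq (integral_const_mul _ _)).trans (le_trans ?_ (le_abs_self _)))
    exact mul_le_mul_of_nonneg_left (hM t).2 ((abs_nonneg _).trans (hA 0))
  obtain ⟨S, hS, hSE⟩ := exists_forall_sub_eq_setIntegral hF
    (fun a b ha hab => (hEI a b ha hab).1) (fun ψ hψ hψc hψs => by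
      have e1 : ∫ t in Ioi (0 : ℝ), (∫ x, v x t * η x ∂(weightMeasure ρ)) * deriv ψ t =
          ∫ t in Ioi (0 : ℝ), (∫ x, u x t * η x ∂(weightMeasure ρ)) * deriv ψ t := by
        refine setIntegral_congr_ae measurableSet_Ioi (huv.mono fun t ht ht0 => ?_)
        have h2 := (ht ht0).filter_mono (weightMeasure_absolutelyContinuous ρ).ae_le
        congr 1
        exact integral_congr_ae (h2.mono fun x hx => by simp only [hx])
      have e2 : ∫ t in Ioi (0 : ℝ), energy d s κ (fun x => v x t ^ m) η * ψ t =
          ∫ t in Ioi (0 : ℝ), energy d s κ (fun x => u x t ^ m) η * ψ t := by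
        refine setIntegral_congr_ae measurableSet_Ioi (huv.mono fun t ht ht0 => ?_)
        congr 1
        exact energy_congr_ae_left ((ht ht0).mono fun x hx => by simp only [hx])
      rw [e1, e2]
      exact hu.weakForm_mul h hη hc hψ hψc hψs)
  refine ⟨S, hS, fun a ha b hb ha0 hab => ?_⟩
  rw [(hEI a b ha0 hab).2, ← hSE a ha b hb ha0 hab, ← integral_sub (hvi a) (hvi b)]
  simp only [sub_mul]

/-- Every weak solution agrees, at almost every time, with a clean solution. -/
theorem WeakSolCore.exists_cleanSol (h : Setup d s κ γ c C ρ) (hm : 1 < m)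
    (hu : WeakSolCore d s m κ ρ u) {N : Set ℝ} (hN : volume N = 0) :
    ∃ (v : Ed d → ℝ → ℝ) (𝒯 : Set ℝ), CleanSol d s κ m ρ v 𝒯 ∧
      (∀ t ∈ 𝒯, (fun x => v x t) =ᵐ[volume] fun x => u x t) ∧ 𝒯 ⊆ Ioi 0 \ N := by
  have hm0 : 0 < m := one_pos.trans hm
  obtain ⟨β, hβm, hβ0, hβb, hβ⟩ := hu.exists_pointwise_bound
  obtain ⟨M, hM⟩ := hu.massBound
  have hP : ∀ᵐ t : ℝ, 0 < t → (Integrable (fun x => u x t) (weightMeasure ρ) ∧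
      ∫ x, u x t ∂(weightMeasure ρ) ≤ M) ∧ energySq d s κ (fun x => u x t ^ m) < ⊤ ∧
      (∀ᵐ x, u x t ≤ β t) ∧ t ∉ N := by
    filter_upwards [(ae_restrict_iff' measurableSet_Ioi).1 hM,
      (ae_restrict_iff' measurableSet_Ioi).1 hu.energyFinite, hβ,
      measure_eq_zero_iff_ae_notMem.1 hN] with t h1 h2 h3 h4 ht
    refine ⟨?_, ?_, h3 ht, h4⟩
    · rw [integrable_weightMeasure_iff h.measurable h.pos,
        integral_weightMeasure h.measurable h.pos]
      exact h1 ht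
    · rw [← gagliardoSq_eq_energySq h.κ_pos ((hu.measurable_slice t).pow_const m)]
      exact h2 ht
  obtain ⟨G, hGm, hG, hGf⟩ := exists_measurableSet_subset_of_ae hP
  set v := truncTime u β G with hvdef
  have hvm : Measurable (Function.uncurry v) := measurable_truncTime hu.measurable hβm hGm
  have hvs : ∀ t, Measurable fun x => v x t := fun t => hvm.comp measurable_prodMk_right
  have hz : ∀ t, t ∉ G → ∀ x, v x t = 0 := fun t ht x => truncTime_of_notMem ht x
  have heq : ∀ t ∈ G, (fun x => v x t) =ᵐ[volume] fun x => u x t := fun t ht =>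
    truncTime_ae_eq ht (hG t ht).2.2.2.1
  have hv0 : ∀ x t, 0 ≤ v x t := fun x t =>
    indicator_nonneg (fun r _ => le_min (hu.nonneg x r) (hβ0 r)) t
  have hvb : ∀ τ, 0 < τ → ∃ B, ∀ t, τ < t → ∀ x, v x t ≤ B := fun τ hτ => by
    obtain ⟨B, hB⟩ := hβb τ hτ
    refine ⟨B, fun t ht x => ?_⟩
    by_cases htG : t ∈ G
    · simp only [hvdef, truncTime, indicator_of_mem htG]
      exact (min_le_right _ _).trans (hB t ht)
    · rw [hz t htG x]
      exact (hβ0 t).trans (hB t ht)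
  have hvM : ∃ M, ∀ t, Integrable (fun x => v x t) (weightMeasure ρ) ∧
      ∫ x, v x t ∂(weightMeasure ρ) ≤ M := by
    refine ⟨|M|, fun t => ?_⟩
    by_cases htG : t ∈ G
    · have h1 := (heq t htG).filter_mono (weightMeasure_absolutelyContinuous ρ).ae_le
      rw [integrable_congr h1, integral_congr_ae h1]
      exact ⟨(hG t htG).2.1.1, (hG t htG).2.1.2.trans (le_abs_self M)⟩
    · simp only [hz t htG, integral_zero]
      exact ⟨integrable_zero _ _ _, abs_nonneg M⟩
  have hpow : ∀ t ∈ G, energySq d s κ (fun x => v x t ^ m) =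
      energySq d s κ (fun x => u x t ^ m) := fun t ht =>
    energySq_congr_ae ((heq t ht).mono fun x hx => by simp only [hx])
  have hfe : ∀ t, FiniteEnergy d s κ fun x => v x t ^ m := fun t => by
    by_cases htG : t ∈ G
    · refine finiteEnergy_of_energySq_lt_top ((hvs t).pow_const m) ?_
      rw [hpow t htG]
      exact (hG t htG).2.2.1
    · simp only [hz t htG, Real.zero_rpow hm0.ne']
      exact FiniteEnergy.zero
  have hve : ∀ a b, 0 < a → a < b →
      ∫⁻ t in Ioc a b, energySq d s κ (fun x => v x t ^ m) < ⊤ := fun a b ha hab => by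
    have e1 : ∫⁻ t in Ioc a b, energySq d s κ (fun x => v x t ^ m) =
        ∫⁻ t in Ioc a b, gagliardoSq d s κ (fun x => u x t ^ m) := by
      refine setLIntegral_congr_fun_ae measurableSet_Ioc (hGf.mono fun t ht htI => ?_)
      rw [hpow t (ht (ha.trans htI.1)),
        gagliardoSq_eq_energySq h.κ_pos ((hu.measurable_slice t).pow_const m)]
    rw [e1]
    exact (hu.energyLocInt a b ha hab).lt_top
  obtain ⟨e, he, hdense⟩ := exists_countable_smooth_family h
  choose S hS hSE using fun n => hu.exists_times_energy_timeInt h hm0 hvm hv0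
    hvb hvM hve
    (hGf.mono fun t ht ht0 => heq t (ht ht0)) (he n).1 (he n).2
  refine ⟨v, G ∩ ⋂ n, S n, ⟨hvm, hv0, hvb, hvM, hfe, hve, fun t ht => (hG t ht.1).1, ?_, ?_⟩,
    fun t ht => heq t ht.1, fun t ht => ⟨(hG t ht.1).1, (hG t ht.1).2.2.2.2⟩⟩
  · filter_upwards [hGf, ae_all_iff.2 hS] with t h1 h2 ht
    exact ⟨h1 ht, mem_iInter.2 h2⟩
  · intro a ha b hb hab φ hφ
    have ha0 := (hG a ha.1).1
    obtain ⟨B, hB⟩ := hvb (a / 2) (half_pos ha0)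
    obtain ⟨M', hM'⟩ := hvM
    have hBa : ∀ x, v x a ≤ B := hB a (half_lt_self ha0)
    have hBb : ∀ x, v x b ≤ B := hB b ((half_lt_self ha0).trans hab)
    have hgm : Measurable fun x => v x a - v x b := (hvs a).sub (hvs b)
    have hgB : ∀ x, |v x a - v x b| ≤ B := fun x => by
      rw [abs_le]
      constructor <;> linarith [hBa x, hBb x, hv0 x a, hv0 x b]
    have hg2 : MemLp (fun x => v x a - v x b) 2 (weightMeasure ρ) := by
      rw [memLp_two_iff_integrable_sq hgm.aestronglyMeasurable]
      have := ((hM' a).1.sub (hM' b).1).bdd_mul hgm.aestronglyMeasurable (.of_forall hgB)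
      simpa only [sq, Pi.sub_apply] using this
    have hV : FiniteEnergy d s κ (timeInt (fun x t => v x t ^ m) a b) := by
      have hpm : Measurable (Function.uncurry fun x t => v x t ^ m) := hvm.pow_const m
      refine finiteEnergy_of_energySq_lt_top (measurable_timeInt hpm a b)
        ((energySq_timeInt_le hpm hab (B := B ^ m) fun t ht x => ?_).trans_lt
          (ENNReal.mul_lt_top ENNReal.ofReal_lt_top (hve a b ha0 hab)))
      rw [abs_of_nonneg (Real.rpow_nonneg (hv0 x t) m)]
      exact Real.rpow_le_rpow (hv0 x t) (hB t ((half_lt_self ha0).trans ht.1) x) hm0.le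
    exact energy_eq_of_smooth h hV hgm hgB (hdense _ _ hV hg2 fun n =>
      hSE n a (mem_iInter.1 ha.2 n) b (mem_iInter.1 hb.2 n) ha0 hab) hφ

end Cleaning

/-! ### Conclusion -/

section Uniqueness

variable {d : ℕ} {s κ γ₀ γ c C m : ℝ} {ρ : Ed d → ℝ} {u u₁ u₂ : Ed d → ℝ → ℝ}
  {μ : Measure (Ed d)}

lemma AdmissibleWeight.setup (hs0 : 0 < s) (hs1 : s < 1) (hd : 2 * s < (d : ℝ)) (hκ : 0 < κ)
    (hγ₀0 : 0 ≤ γ₀) (hγ₀γ : γ₀ ≤ γ) (hγs : γ < 2 * s) (hρ : AdmissibleWeight d ρ γ₀ γ c C) :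
    Setup d s κ γ c C ρ := by
  obtain ⟨hc, hcC, hm, hpos, hin, hout⟩ := hρ
  have hC : 0 < C := hc.trans hcC
  have hγ : 0 ≤ γ := hγ₀0.trans hγ₀γ
  have hd0 : 0 < d := by
    have : (0 : ℝ) < d := by linarith
    exact_mod_cast this
  refine ⟨hs0, hs1, hd, hκ, hγ, hγs, hc, hC, hm, hpos, ?_, ?_⟩
  · filter_upwards [hin, hout, ae_ne_of_pos hd0 0] with x h1 h2 hx
    have hx0 : 0 < ‖x‖ := norm_pos_iff.2 hx
    rcases le_or_gt ‖x‖ 1 with hx1 | hx1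
    · refine le_trans ?_ (h1 hx1).1
      refine mul_le_mul_of_nonneg_left ?_ hc.le
      exact (Real.rpow_le_one_of_one_le_of_nonpos (by linarith) (by linarith)).trans
        (Real.one_le_rpow_of_pos_of_le_one_of_nonpos hx0 hx1 (by linarith))
    · refine le_trans ?_ (h2 hx1).1
      refine mul_le_mul_of_nonneg_left ?_ hc.le
      exact Real.rpow_le_rpow_of_nonpos hx0 (by linarith) (by linarith)
  · filter_upwards [hin, hout, ae_ne_of_pos hd0 0] with x h1 h2 hx
    have hx0 : 0 < ‖x‖ := norm_pos_iff.2 hx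
    rcases le_or_gt ‖x‖ 1 with hx1 | hx1
    · refine (h1 hx1).2.trans (mul_le_mul_of_nonneg_left ?_ hC.le)
      exact Real.rpow_le_rpow_of_exponent_ge hx0 hx1 (by linarith)
    · exact (h2 hx1).2

/-- A weak solution with an initial trace agrees with a clean solution attaining the trace
along its set of times. -/
lemma IsWeakSolution.exists_cleanSol (h : Setup d s κ γ c C ρ) (hm : 1 < m)
    (hu : IsWeakSolution d s m κ ρ μ u) :
    ∃ (v : Ed d → ℝ → ℝ) (𝒯 : Set ℝ), CleanSol d s κ m ρ v 𝒯 ∧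
      (∀ t ∈ 𝒯, (fun x => v x t) =ᵐ[volume] fun x => u x t) ∧
      ∀ φ : Ed d → ℝ, Continuous φ → (∃ B, ∀ x, |φ x| ≤ B) →
        Tendsto (fun t => ∫ x, φ x * v x t ∂(weightMeasure ρ)) (𝓝[𝒯] 0)
          (𝓝 (∫ x, φ x ∂μ)) := by
  obtain ⟨hcore, N, hN, htr⟩ := hu
  obtain ⟨v, 𝒯, hv, heq, hsub⟩ := hcore.exists_cleanSol h hm hN
  refine ⟨v, 𝒯, hv, heq, fun φ hφ hφb => ?_⟩
  refine ((htr φ hφ hφb).mono_left (nhdsWithin_mono 0 hsub)).congr' ?_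
  filter_upwards [self_mem_nhdsWithin] with t ht
  rw [integral_weightMeasure h.measurable h.pos]
  refine integral_congr_ae ((heq t ht).mono fun x hx => ?_)
  have hx' : v x t = u x t := hx
  simp only [hx', mul_assoc]

lemma ae_eq_of_isWeakSolution (h : Setup d s κ γ c C ρ) (hm : 1 < m)
    (h₁ : IsWeakSolution d s m κ ρ μ u₁) (h₂ : IsWeakSolution d s m κ ρ μ u₂) :
    ∀ᵐ p ∂(volume : Measure (Ed d × ℝ)), 0 < p.2 → u₁ p.1 p.2 = u₂ p.1 p.2 := by
  obtain ⟨v₁, 𝒯₁, hv₁, he₁, ht₁⟩ := h₁.exists_cleanSol h hm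
  obtain ⟨v₂, 𝒯₂, hv₂, he₂, ht₂⟩ := h₂.exists_cleanSol h hm
  have hae : ∀ᵐ t : ℝ, ∀ᵐ x : Ed d, 0 < t → u₁ x t = u₂ x t := by
    filter_upwards [hv₁.full, hv₂.full] with t h1 h2
    rcases le_or_gt t 0 with ht | ht
    · exact .of_forall fun x hx => absurd hx ht.not_gt
    · filter_upwards [he₁ t (h1 ht), he₂ t (h2 ht),
        CleanSol.ae_eq_of_trace h hm hv₁ hv₂ ht₁ ht₂ (h1 ht) (h2 ht)] with x e1 e2 e3 _
      have e1' : v₁ x t = u₁ x t := e1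
      have e2' : v₂ x t = u₂ x t := e2
      rw [← e1', ← e2', e3]
  have hms : MeasurableSet {p : ℝ × Ed d | 0 < p.1 → u₁ p.2 p.1 = u₂ p.2 p.1} := by
    have h1 : MeasurableSet {p : ℝ × Ed d | 0 < p.1} :=
      measurableSet_lt measurable_const measurable_fst
    have h2 : MeasurableSet {p : ℝ × Ed d | u₁ p.2 p.1 = u₂ p.2 p.1} :=
      measurableSet_eq_fun (h₁.1.measurable.comp measurable_swap)
        (h₂.1.measurable.comp measurable_swap)
    exact h1.imp h2
  have hprod : ∀ᵐ p : ℝ × Ed d, 0 < p.1 → u₁ p.2 p.1 = u₂ p.2 p.1 :=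
    (Measure.ae_prod_iff_ae_ae hms).2 hae
  exact (Measure.measurePreserving_swap (μ := (volume : Measure (Ed d)))
    (ν := (volume : Measure ℝ))).quasiMeasurePreserving.ae hprod

end Uniqueness

/-- **Uniqueness of weak solutions.** Two weak solutions of the Cauchy problem
`ρ u_t + (-Δ)^s(u^m) = 0` with the same positive finite Radon measure `μ` as
initial datum coincide a.e. on `ℝ^d × (0,∞)`. -/
theorem uniqueness_of_weak_solutions
    (d : ℕ) (s m κ γ₀ γ c C : ℝ)
    (hs0 : 0 < s) (hs1 : s < 1) (hd : 2 * s < (d : ℝ)) (hm : 1 < m) (hκ : 0 < κ)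
    (hγ₀0 : 0 ≤ γ₀) (hγ₀γ : γ₀ ≤ γ) (hγs : γ < 2 * s) (hγd : γ ≤ (d : ℝ) - 2 * s)
    (ρ : Ed d → ℝ) (hρ : AdmissibleWeight d ρ γ₀ γ c C)
    (μ : Measure (Ed d)) (hμ : IsFiniteMeasure μ)
    (u₁ u₂ : Ed d → ℝ → ℝ)
    (h₁ : IsWeakSolution d s m κ ρ μ u₁) (h₂ : IsWeakSolution d s m κ ρ μ u₂) :
    ∀ᵐ p ∂(volume : Measure (Ed d × ℝ)), 0 < p.2 → u₁ p.1 p.2 = u₂ p.1 p.2 := by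
  exact ae_eq_of_isWeakSolution (hρ.setup hs0 hs1 hd hκ hγ₀0 hγ₀γ hγs) hm h₁ h₂
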